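/- Let Ω ⊂ ℂ be a bounded domain with boundary of class C^{1+ε}, 0 < ε < 1, and let n ≥ 1 be an integer. Then the kernel K_n(z,ζ) = ∫_{ℂ∖Ω} (z−w)^{−2} · n (conj(w−ζ))^{n−1} (w−ζ)^{−(n+1)} dA(w) satisfies |K_n(z₁,ζ) − K_n(z₂,ζ)| ≤ C |z₁ − z₂|^ε / |ζ − z₁|² for all z₁, z₂, ζ ∈ Ω with |ζ − z₁| ≥ 2|z₁ − z₂|, where C depends only on n, ε and Ω. -/

import Mathlib

open MeasureTheory Metric Set Filter Topology Complex
open scoped ENNReal NNReal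

noncomputable section

/-- `Ω ⊆ ℂ` has boundary of class `C^{1+ε}`: near each boundary point, after a rotation of
coordinates, `Ω` is the subgraph of a `C^1` function whose derivative is `ε`-Hölder. -/
def HasC1HolderBoundaryC (ε : ℝ) (Ω : Set ℂ) : Prop :=
  ∀ a ∈ frontier Ω, ∃ r > 0, ∃ e : ℂ, ‖e‖ = 1 ∧ ∃ φ : ℝ → ℝ,
    ContDiff ℝ 1 φ ∧
    (∃ c : ℝ≥0, HolderOnWith c ε.toNNReal (deriv φ) univ) ∧
    Ω ∩ ball a r = {z ∈ ball a r | (e * z).im < φ ((e * z).re)}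

/-- The kernel `K_n(z,ζ) = ∫_{ℂ∖Ω} (z−w)^{−2} · n conj(w−ζ)^{n−1} (w−ζ)^{−(n+1)} dA(w)`. -/
def Kker (Ω : Set ℂ) (n : ℕ) (z ζ : ℂ) : ℂ :=
  ∫ w in Ωᶜ,
    ((z - w) ^ 2)⁻¹ * ((n : ℂ) * (starRingEnd ℂ) (w - ζ) ^ (n - 1) / (w - ζ) ^ (n + 1))


lemma sum_shell (μ : Measure ℂ) (c : ℂ) (T : Set ℂ) (hT : MeasurableSet T) (f : ℂ → ℝ)
    (hf0 : ∀ w, 0 ≤ f w) (hfm : Measurable f) (S v m : ℕ → ℝ) (hv : ∀ k, 0 ≤ v k)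
    (hm : ∀ k, 0 ≤ m k)
    (hμ : ∀ k, μ (ball c (S k)) ≤ ENNReal.ofReal (m k))
    (hcov : ∀ w ∈ T, ∃ k, w ∈ ball c (S k) ∧ f w ≤ v k) (X : ℝ)
    (hX : HasSum (fun k => v k * m k) X) :
    IntegrableOn f T μ ∧ ∫ w in T, f w ∂μ ≤ X := by
  have hX0 : 0 ≤ X := hX.nonneg (fun k => mul_nonneg (hv k) (hm k))
  have key : ∫⁻ w in T, ENNReal.ofReal (f w) ∂μ ≤ ENNReal.ofReal X := by
    calc ∫⁻ w in T, ENNReal.ofReal (f w) ∂μ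
        ≤ ∫⁻ w in T, ∑' k, (ball c (S k)).indicator (fun _ => ENNReal.ofReal (v k)) w ∂μ := by
          apply setLIntegral_mono' hT
          intro w hw
          obtain ⟨k, hk, hk2⟩ := hcov w hw
          refine le_trans ?_ (ENNReal.le_tsum k)
          rw [indicator_of_mem hk]
          exact ENNReal.ofReal_le_ofReal hk2
      _ ≤ ∫⁻ w, ∑' k, (ball c (S k)).indicator (fun _ => ENNReal.ofReal (v k)) w ∂μ :=
          setLIntegral_le_lintegral _ _
      _ = ∑' k, ENNReal.ofReal (v k) * μ (ball c (S k)) := by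
          rw [lintegral_tsum]
          · congr 1; ext k
            rw [lintegral_indicator measurableSet_ball, setLIntegral_const]
          · intro k
            exact (measurable_const.indicator measurableSet_ball).aemeasurable
      _ ≤ ∑' k, ENNReal.ofReal (v k * m k) := by
          apply ENNReal.tsum_le_tsum
          intro k
          rw [ENNReal.ofReal_mul (hv k)]
          gcongr
          exact hμ k
      _ = ENNReal.ofReal X := by
          rw [← ENNReal.ofReal_tsum_of_nonneg (fun k => mul_nonneg (hv k) (hm k)) hX.summable,
            hX.tsum_eq]
  have hint : IntegrableOn f T μ := by
    refine ⟨hfm.aestronglyMeasurable, ?_⟩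
    rw [hasFiniteIntegral_iff_ofReal (Eventually.of_forall hf0)]
    exact lt_of_le_of_lt key ENNReal.ofReal_lt_top
  refine ⟨hint, ?_⟩
  rw [integral_eq_lintegral_of_nonneg_ae (Eventually.of_forall hf0) hfm.aestronglyMeasurable]
  exact ENNReal.toReal_le_of_le_ofReal hX0 key

lemma inner_shell (a b : ℝ) (hb : 0 < b) (hab : b < a) : ∃ C : ℝ, 0 < C ∧
    ∀ (μ : Measure ℂ) (c : ℂ) (A R : ℝ), 0 ≤ A → 0 < R →
    (∀ S : ℝ, 0 < S → μ (ball c S) ≤ ENNReal.ofReal (A * S ^ a)) →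
    IntegrableOn (fun w => ‖w - c‖ ^ (-b)) (ball c R) μ ∧
      ∫ w in ball c R, ‖w - c‖ ^ (-b) ∂μ ≤ C * A * R ^ (a - b) := by
  set q : ℝ := (1/2 : ℝ) ^ (a - b) with hq
  have hq0 : 0 < q := by positivity
  have hq1 : q < 1 := Real.rpow_lt_one (by norm_num) (by norm_num) (by linarith)
  refine ⟨(1/2 : ℝ) ^ (-b) * 2 ^ a * (1 - q)⁻¹, ?_, ?_⟩
  · have : 0 < 1 - q := by linarith
    positivity
  intro μ c A R hA hR hμ
  apply sum_shell μ c _ measurableSet_ball _ (fun w => by positivity) (by fun_prop)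
    (fun k => R * 2 * (1/2)^k) (fun k => (R * (1/2)^(k+1)) ^ (-b))
    (fun k => A * (R * 2 * (1/2)^k) ^ a) (fun k => by positivity) (fun k => by positivity)
    (fun k => hμ _ (by positivity))
  · intro w hw
    rw [mem_ball, dist_eq_norm] at hw
    rcases eq_or_lt_of_le (norm_nonneg (w - c)) with h0 | h0
    · refine ⟨0, ?_, ?_⟩
      · rw [mem_ball, dist_eq_norm, ← h0]; positivity
      · rw [← h0, Real.zero_rpow (by linarith)]; positivity
    · obtain ⟨k, hk1, hk2⟩ := exists_nat_pow_near_of_lt_one (x := ‖w - c‖ / R) (y := (1/2 : ℝ))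
        (by positivity) (by rw [div_le_one hR]; exact hw.le) (by norm_num) (by norm_num)
      refine ⟨k, ?_, ?_⟩
      · rw [mem_ball, dist_eq_norm]
        rw [div_le_iff₀ hR] at hk2
        have : 0 < (1/2:ℝ)^k * R := by positivity
        linarith
      · apply Real.rpow_le_rpow_of_nonpos (by positivity) _ (by linarith)
        rw [lt_div_iff₀ hR] at hk1
        linarith
  · have h := (hasSum_geometric_of_lt_one hq0.le hq1).mul_left
      ((1/2 : ℝ) ^ (-b) * 2 ^ a * A * R ^ (a - b))
    have hs : ∀ (F G : ℕ → ℝ) (x y : ℝ), x = y → (∀ k, F k = G k) → HasSum G y → HasSum F x := by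
      intro F G x y e h1 h2; rw [funext h1, e]; exact h2
    refine hs _ _ _ _ ?_ (fun k => ?_) h
    · ring
    · show _ * (A * _) = _
      have e1 : (R * (1/2)^(k+1)) ^ (-b) = R ^ (-b) * (1/2 : ℝ) ^ (-b) * ((1/2 : ℝ) ^ (-b)) ^ k := by
        rw [Real.mul_rpow hR.le (by positivity), pow_succ, Real.mul_rpow (by positivity) (by positivity),
          Real.rpow_pow_comm (by norm_num)]
        ring
      have e2 : (R * 2 * (1/2)^k) ^ a = R ^ a * 2 ^ a * ((1/2 : ℝ) ^ a) ^ k := by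
        rw [Real.mul_rpow (by positivity) (by positivity), Real.mul_rpow hR.le (by positivity),
          Real.rpow_pow_comm (by norm_num)]
      have e3 : q = (1/2 : ℝ) ^ a * (1/2 : ℝ) ^ (-b) := by
        rw [hq, sub_eq_add_neg, Real.rpow_add (by norm_num)]
      have e4 : R ^ (a - b) = R ^ a * R ^ (-b) := by
        rw [sub_eq_add_neg, Real.rpow_add hR]
      rw [e1, e2, e3, e4, mul_pow]
      ring

lemma outer_shell (a b : ℝ) (hb : 0 < b) (ha : 0 ≤ a) (hab : a < b) : ∃ C : ℝ, 0 < C ∧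
    ∀ (μ : Measure ℂ) (c : ℂ) (A R : ℝ), 0 ≤ A → 0 < R →
    (∀ S : ℝ, 0 < S → μ (ball c S) ≤ ENNReal.ofReal (A * S ^ a)) →
    IntegrableOn (fun w => ‖w - c‖ ^ (-b)) (ball c R)ᶜ μ ∧
      ∫ w in (ball c R)ᶜ, ‖w - c‖ ^ (-b) ∂μ ≤ C * A * R ^ (a - b) := by
  set q : ℝ := (2 : ℝ) ^ (a - b) with hq
  have hq0 : 0 < q := by positivity
  have hq1 : q < 1 := Real.rpow_lt_one_of_one_lt_of_neg (by norm_num) (by linarith)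
  refine ⟨2 ^ a * (1 - q)⁻¹, ?_, ?_⟩
  · have : 0 < 1 - q := by linarith
    positivity
  intro μ c A R hA hR hμ
  apply sum_shell μ c _ measurableSet_ball.compl _ (fun w => by positivity) (by fun_prop)
    (fun k => R * 2^(k+1)) (fun k => (R * 2^k) ^ (-b))
    (fun k => A * (R * 2 ^(k+1)) ^ a) (fun k => by positivity) (fun k => by positivity)
    (fun k => hμ _ (by positivity))
  · intro w hw
    rw [mem_compl_iff, mem_ball, dist_eq_norm, not_lt] at hw
    obtain ⟨k, hk1, hk2⟩ := exists_nat_pow_near (x := ‖w - c‖ / R) (y := (2 : ℝ))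
        (by rw [one_le_div hR]; exact hw) (by norm_num)
    refine ⟨k, ?_, ?_⟩
    · rw [mem_ball, dist_eq_norm]
      rw [div_lt_iff₀ hR] at hk2
      linarith
    · apply Real.rpow_le_rpow_of_nonpos (by positivity) _ (by linarith)
      rw [le_div_iff₀ hR] at hk1
      linarith
  · have h := (hasSum_geometric_of_lt_one hq0.le hq1).mul_left
      (2 ^ a * A * R ^ (a - b))
    have hs : ∀ (F G : ℕ → ℝ) (x y : ℝ), x = y → (∀ k, F k = G k) → HasSum G y → HasSum F x := by
      intro F G x y e h1 h2; rw [funext h1, e]; exact h2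
    refine hs _ _ _ _ ?_ (fun k => ?_) h
    · ring
    · show _ * (A * _) = _
      have e1 : (R * 2^k) ^ (-b) = R ^ (-b) * ((2 : ℝ) ^ (-b)) ^ k := by
        rw [Real.mul_rpow hR.le (by positivity),
          Real.rpow_pow_comm (by norm_num)]
      have e2 : (R * 2^(k+1)) ^ a = R ^ a * 2 ^ a * ((2 : ℝ) ^ a) ^ k := by
        rw [Real.mul_rpow (by positivity) (by positivity), pow_succ, 
          Real.mul_rpow (by positivity) (by positivity),
          Real.rpow_pow_comm (by norm_num)]
        ring
      have e3 : q = (2 : ℝ) ^ a * (2 : ℝ) ^ (-b) := by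
        rw [hq, sub_eq_add_neg, Real.rpow_add (by norm_num)]
      have e4 : R ^ (a - b) = R ^ a * R ^ (-b) := by
        rw [sub_eq_add_neg, Real.rpow_add hR]
      rw [e1, e2, e3, e4, mul_pow]
      ring

/-- area of balls, in the form needed for the shell lemmas -/
lemma vol_ball_le (c : ℂ) (S : ℝ) (hS : 0 < S) :
    (volume : Measure ℂ) (ball c S) ≤ ENNReal.ofReal (Real.pi * S ^ (2:ℝ)) := by
  rw [Complex.volume_ball]
  rw [mul_comm, ENNReal.ofReal_mul Real.pi_pos.le, ← ENNReal.ofReal_pow hS.le]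
  gcongr
  · rw [← ENNReal.ofReal_coe_nnreal]; simp
  · norm_num

lemma inner_vol (b : ℝ) (hb : 0 < b) (hab : b < 2) : ∃ C : ℝ, 0 < C ∧
    ∀ (c : ℂ) (R : ℝ), 0 < R →
    IntegrableOn (fun w => ‖w - c‖ ^ (-b)) (ball c R) volume ∧
      ∫ w in ball c R, ‖w - c‖ ^ (-b) ≤ C * R ^ (2 - b) := by
  obtain ⟨C, hC, h⟩ := inner_shell 2 b hb hab
  refine ⟨C * Real.pi, by positivity, fun c R hR => ?_⟩
  exact h volume c Real.pi R Real.pi_pos.le hR (vol_ball_le c)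

lemma outer_vol (b : ℝ) (hab : 2 < b) : ∃ C : ℝ, 0 < C ∧
    ∀ (c : ℂ) (R : ℝ), 0 < R →
    IntegrableOn (fun w => ‖w - c‖ ^ (-b)) (ball c R)ᶜ volume ∧
      ∫ w in (ball c R)ᶜ, ‖w - c‖ ^ (-b) ≤ C * R ^ (2 - b) := by
  obtain ⟨C, hC, h⟩ := outer_shell 2 b (by linarith) (by norm_num) hab
  refine ⟨C * Real.pi, by positivity, fun c R hR => ?_⟩
  exact h volume c Real.pi R Real.pi_pos.le hR (vol_ball_le c)


/-- holomorphic in the closed upper half plane with quadratic decay -/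
def UHP (h : ℂ → ℂ) : Prop :=
  (∀ w : ℂ, 0 ≤ w.im → DifferentiableAt ℂ h w) ∧
    ∃ A T : ℝ, 0 < T ∧ ∀ w : ℂ, 0 ≤ w.im → T ≤ ‖w‖ → ‖h w‖ ≤ A / ‖w‖ ^ 2

lemma UHP.sub {h k : ℂ → ℂ} (hh : UHP h) (hk : UHP k) : UHP (fun w => h w - k w) := by
  obtain ⟨h1, A, T, hT, h2⟩ := hh
  obtain ⟨k1, B, S, hS, k2⟩ := hk
  refine ⟨fun w hw => (h1 w hw).sub (k1 w hw), A + B, max T S, by positivity, fun w hw hw2 => ?_⟩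
  calc ‖h w - k w‖ ≤ ‖h w‖ + ‖k w‖ := norm_sub_le _ _
    _ ≤ A / ‖w‖ ^ 2 + B / ‖w‖ ^ 2 :=
      add_le_add (h2 w hw ((le_max_left _ _).trans hw2)) (k2 w hw ((le_max_right _ _).trans hw2))
    _ = _ := by ring

lemma UHP.mul {h k : ℂ → ℂ} (hh : UHP h) (hk : UHP k) : UHP (fun w => h w * k w) := by
  obtain ⟨h1, A, T, hT, h2⟩ := hh
  obtain ⟨k1, B, S, hS, k2⟩ := hk
  refine ⟨fun w hw => (h1 w hw).mul (k1 w hw), |A| * |B|, max (max T S) 1, by positivity,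
    fun w hw hw2 => ?_⟩
  have e1 : T ≤ ‖w‖ := le_trans (by simp) hw2
  have e2 : S ≤ ‖w‖ := le_trans (by simp) hw2
  have e3 : 1 ≤ ‖w‖ := le_trans (by simp) hw2
  have e4 : 1 ≤ ‖w‖ ^ 2 := one_le_pow₀ e3
  have a1 : ‖h w‖ ≤ |A| := (h2 w hw e1).trans (by
    rw [div_le_iff₀ (by positivity)]
    nlinarith [le_abs_self A, abs_nonneg A])
  have a2 : ‖k w‖ ≤ |B| / ‖w‖ ^ 2 := (k2 w hw e2).trans (by gcongr; exact le_abs_self B)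
  rw [norm_mul, mul_div_assoc]
  gcongr

lemma UHP.const_mul {h : ℂ → ℂ} (hh : UHP h) (c : ℂ) : UHP (fun w => c * h w) := by
  obtain ⟨h1, A, T, hT, h2⟩ := hh
  refine ⟨fun w hw => (h1 w hw).const_mul c, ‖c‖ * A, T, hT, fun w hw hw2 => ?_⟩
  rw [norm_mul, mul_div_assoc]
  gcongr
  exact h2 w hw hw2

lemma UHP_inv_sq (a : ℂ) (ha : a.im < 0) : UHP (fun w => ((w - a) ^ 2)⁻¹) := by
  refine ⟨fun w hw => ?_, 4, 2 * ‖a‖ + 1, by positivity, fun w hw hw2 => ?_⟩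
  · have : w - a ≠ 0 := fun h => by
      have := congrArg Complex.im h; simp at this; linarith
    have : (w - a) ^ 2 ≠ 0 := pow_ne_zero _ this
    fun_prop (disch := assumption)
  · have h1 : ‖w‖ / 2 ≤ ‖w - a‖ := by
      have := norm_sub_norm_le w a; linarith
    have h0 : 0 < ‖w‖ := by have := norm_nonneg a; linarith
    have h3 : 0 < ‖w - a‖ := by linarith
    rw [norm_inv, norm_pow, ← one_div, div_le_div_iff₀ (by positivity) (by positivity)]
    nlinarith

lemma UHP_frac (n : ℕ) (hn : 1 ≤ n) (b c : ℂ) (hb : b.im < 0) :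
    UHP (fun w => (w - c) ^ (n - 1) / (w - b) ^ (n + 1)) := by
  refine ⟨fun w hw => ?_, 2 ^ (n - 1) * 2 ^ (n + 1), 2 * ‖b‖ + ‖c‖ + 1, by positivity,
    fun w hw hw2 => ?_⟩
  · have : w - b ≠ 0 := fun h => by
      have := congrArg Complex.im h; simp at this; linarith
    have : (w - b) ^ (n + 1) ≠ 0 := pow_ne_zero _ this
    fun_prop (disch := assumption)
  · have hbn := norm_nonneg b
    have hcn := norm_nonneg c
    have h1 : ‖w‖ / 2 ≤ ‖w - b‖ := by
      have := norm_sub_norm_le w b; linarith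
    have h0 : 0 < ‖w‖ := by linarith
    have h2 : ‖w - c‖ ≤ 2 * ‖w‖ := by
      have := norm_sub_le w c; linarith
    rw [norm_div, norm_pow, norm_pow]
    calc ‖w - c‖ ^ (n - 1) / ‖w - b‖ ^ (n + 1)
        ≤ (2 * ‖w‖) ^ (n - 1) / (‖w‖ / 2) ^ (n + 1) := by gcongr
      _ = _ := by
        obtain ⟨m, rfl⟩ : ∃ m, n = m + 1 := ⟨n - 1, by omega⟩
        simp only [Nat.add_sub_cancel]
        rw [div_pow, mul_pow]
        field_simp
        ring

lemma line_zero (h : ℂ → ℂ) (hh : UHP h) : ∫ x : ℝ, h x = 0 := by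
  by_cases hi : Integrable (fun x : ℝ => h x)
  swap
  · exact integral_undef hi
  obtain ⟨h1, A, T₀, hT₀, h2⟩ := hh
  have lim := intervalIntegral_tendsto_integral hi tendsto_neg_atTop_atBot tendsto_id
  refine tendsto_nhds_unique lim ?_
  rw [tendsto_zero_iff_norm_tendsto_zero]
  have hA : Tendsto (fun T : ℝ => (4 * |A|) / T) atTop (𝓝 0) := tendsto_const_nhds.div_atTop tendsto_id
  refine squeeze_zero' (Eventually.of_forall fun _ => norm_nonneg _) ?_ hA
  filter_upwards [eventually_ge_atTop T₀] with T hT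
  have hTp : 0 < T := lt_of_lt_of_le hT₀ hT
  have rect := Complex.integral_boundary_rect_eq_zero_of_differentiableOn h (-T : ℝ) (T + T * I) (by
    intro w hw
    apply (h1 w _).differentiableWithinAt
    rw [Complex.mem_reProdIm] at hw
    have := hw.2
    simp at this
    rw [uIcc_of_le hTp.le] at this
    exact this.1)
  simp only [ofReal_re, ofReal_im, add_re, add_im, mul_re, mul_im, I_re, I_im, mul_zero, mul_one,
    sub_zero, zero_add, add_zero, neg_re, neg_im, neg_zero, ofReal_neg, ofReal_zero, zero_mul, smul_eq_mul] at rect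
  have bd : ∀ w : ℂ, 0 ≤ w.im → T ≤ ‖w‖ → ‖h w‖ ≤ |A| / T ^ 2 := by
    intro w hw hw2
    refine (h2 w hw (hT.trans hw2)).trans ?_
    gcongr
    exact le_abs_self A
  have b1 : ‖∫ x in (-T)..T, h (x + T * I)‖ ≤ |A| / T ^ 2 * |T - -T| := by
    apply intervalIntegral.norm_integral_le_of_norm_le_const
    intro x hx
    apply bd
    · simp; exact hTp.le
    · refine le_trans ?_ (Complex.abs_im_le_norm _); simp [le_abs_self]
  have b2 : ‖∫ y in (0:ℝ)..T, h (T + y * I)‖ ≤ |A| / T ^ 2 * |T - 0| := by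
    apply intervalIntegral.norm_integral_le_of_norm_le_const
    intro x hx
    rw [uIoc_of_le hTp.le] at hx
    apply bd
    · simp; exact hx.1.le
    · refine le_trans ?_ (Complex.abs_re_le_norm _); simp [le_abs_self]
  have b3 : ‖∫ y in (0:ℝ)..T, h (-T + y * I)‖ ≤ |A| / T ^ 2 * |T - 0| := by
    apply intervalIntegral.norm_integral_le_of_norm_le_const
    intro x hx
    rw [uIoc_of_le hTp.le] at hx
    apply bd
    · simp; exact hx.1.le
    · refine le_trans ?_ (Complex.abs_re_le_norm _); simp [le_abs_self]
  have e : (∫ x in (-T)..T, h x) = (∫ x in (-T)..T, h (x + T * I)) - I * (∫ y in (0:ℝ)..T, h (T + y * I))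
      + I * (∫ y in (0:ℝ)..T, h (-T + y * I)) := by
    linear_combination rect
  show ‖∫ x in (-T)..T, h x‖ ≤ _
  rw [e]
  refine (norm_add_le _ _).trans ?_
  refine (add_le_add_left (norm_sub_le _ _) _).trans ?_
  rw [norm_mul, norm_mul, norm_I, one_mul, one_mul]
  have e1 : |T - -T| = 2 * T := by rw [abs_of_pos] <;> linarith
  have e2 : |T - 0| = T := by rw [abs_of_pos] <;> linarith
  rw [e1] at b1; rw [e2] at b2 b3
  calc _ ≤ |A| / T ^ 2 * (2 * T) + |A| / T ^ 2 * T + |A| / T ^ 2 * T := by linarith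
    _ = _ := by field_simp; ring

lemma halfplane_zero (G : ℂ → ℂ) (ρ : ℝ)
    (hl : ∀ y : ℝ, ρ < y → ∫ x : ℝ, G (x + y * I) = 0) :
    ∫ v in {v : ℂ | ρ < v.im}, G v = 0 := by
  have hm : MeasurableSet {v : ℂ | ρ < v.im} := measurableSet_lt measurable_const Complex.measurable_im
  by_cases hi : IntegrableOn G {v : ℂ | ρ < v.im}
  swap
  · exact integral_undef hi
  rw [← integral_indicator hm]
  rw [← integrable_indicator_iff hm] at hi
  set F := indicator {v : ℂ | ρ < v.im} G with hF
  have mp := Complex.volume_preserving_equiv_real_prod.symm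
  have e1 : ∫ v, F v = ∫ p : ℝ × ℝ, F (Complex.measurableEquivRealProd.symm p) :=
    (mp.integral_comp' F).symm
  have hi2 : Integrable (fun p : ℝ × ℝ => F (Complex.measurableEquivRealProd.symm p)) :=
    (mp.integrable_comp_emb (MeasurableEquiv.measurableEmbedding _)).2 hi
  rw [e1, Measure.volume_eq_prod, integral_prod_symm _ hi2]
  apply integral_eq_zero_of_ae
  refine Eventually.of_forall fun y => ?_
  simp only [Pi.zero_apply]
  by_cases hy : ρ < y
  · rw [← hl y hy]
    congr 1; ext x
    have : Complex.measurableEquivRealProd.symm (x, y) = x + y * I := by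
      apply Complex.ext <;> simp [Complex.measurableEquivRealProd_symm_apply]
    rw [this, hF, indicator_of_mem]
    simp [hy]
  · have : ∀ x : ℝ, F (Complex.measurableEquivRealProd.symm (x, y)) = 0 := by
      intro x
      rw [hF, indicator_of_notMem]
      simp [Complex.measurableEquivRealProd_symm_apply] at *
      exact hy
    simp only [this, integral_zero]

/-- the kernel `n conj(w)^(n-1) / w^(n+1)` -/
def f0 (n : ℕ) (w : ℂ) : ℂ := (n : ℂ) * (starRingEnd ℂ) w ^ (n - 1) / w ^ (n + 1)

lemma f0_line (n : ℕ) (hn : 1 ≤ n) (ξ : ℂ) (y : ℝ) (hy : ξ.im < y) :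
    ∃ h : ℂ → ℂ, UHP h ∧ ∀ x : ℝ, f0 n (x + y * I - ξ) = h x := by
  refine ⟨_, (UHP_frac n hn (ξ - y * I) ((starRingEnd ℂ) ξ + y * I) (by simp; exact hy)).const_mul n,
    fun x => ?_⟩
  simp only [f0, map_sub, map_add, map_mul, conj_ofReal, conj_I, mul_div_assoc]
  congr 3 <;> ring

lemma sq_line (a : ℂ) (y : ℝ) (hy : a.im < y) :
    ∃ h : ℂ → ℂ, UHP h ∧ ∀ x : ℝ, ((x + y * I - a) ^ 2)⁻¹ = h x := by
  refine ⟨_, UHP_inv_sq (a - y * I) (by simp; exact hy), fun x => ?_⟩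
  congr 2; ring

def gker (l a v : ℂ) : ℂ := (v ^ 2)⁻¹ - l * ((v - a) ^ 2)⁻¹

lemma g_line (l a : ℂ) (y : ℝ) (hy : a.im < y) (hy0 : 0 < y) :
    ∃ h : ℂ → ℂ, UHP h ∧ ∀ x : ℝ, gker l a (x + y * I) = h x := by
  obtain ⟨h1, u1, e1⟩ := sq_line a y hy
  obtain ⟨h2, u2, e2⟩ := sq_line 0 y (by simpa using hy0)
  refine ⟨_, u2.sub (u1.const_mul l), fun x => ?_⟩
  simp only [gker, ← e1, ← e2, sub_zero]

lemma hp_zero_f0 (n : ℕ) (hn : 1 ≤ n) (ξ ξ' : ℂ) (ρ : ℝ) (h : ξ.im ≤ ρ) (h' : ξ'.im ≤ ρ) :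
    ∫ v in {v : ℂ | ρ < v.im}, (f0 n (v - ξ) - f0 n (v - ξ')) = 0 := by
  apply halfplane_zero (fun v => f0 n (v - ξ) - f0 n (v - ξ'))
  intro y hy
  obtain ⟨h1, u1, e1⟩ := f0_line n hn ξ y (by linarith)
  obtain ⟨h2, u2, e2⟩ := f0_line n hn ξ' y (by linarith)
  simp only [e1, e2]
  exact line_zero _ (u1.sub u2)

lemma hp_zero_g (l a : ℂ) (ρ : ℝ) (h : a.im ≤ ρ) (h' : 0 ≤ ρ) :
    ∫ v in {v : ℂ | ρ < v.im}, gker l a v = 0 := by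
  apply halfplane_zero
  intro y hy
  obtain ⟨h1, u1, e1⟩ := g_line l a y (by linarith) (by linarith)
  simp only [e1]
  exact line_zero _ u1

lemma hp_zero_gf (n : ℕ) (hn : 1 ≤ n) (l a ξ : ℂ) (ρ : ℝ) (h : a.im ≤ ρ) (h' : 0 ≤ ρ) (h2 : ξ.im ≤ ρ) :
    ∫ v in {v : ℂ | ρ < v.im}, gker l a v * f0 n (v - ξ) = 0 := by
  apply halfplane_zero (fun v => gker l a v * f0 n (v - ξ))
  intro y hy
  obtain ⟨h1, u1, e1⟩ := g_line l a y (by linarith) (by linarith)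
  obtain ⟨h2, u2, e2⟩ := f0_line n hn ξ y (by linarith)
  simp only [e1, e2]
  exact line_zero _ (u1.mul u2)


/-- `conj x ^ a / x ^ (a+m)` -/
def hk (a m : ℕ) (x : ℂ) : ℂ := (starRingEnd ℂ) x ^ a / x ^ (a + m)

lemma hk_norm (a m : ℕ) (x : ℂ) (hx : x ≠ 0) : ‖hk a m x‖ = 1 / ‖x‖ ^ m := by
  have : ‖x‖ ≠ 0 := norm_ne_zero_iff.2 hx
  rw [hk, norm_div, norm_pow, norm_pow, RCLike.norm_conj, pow_add]
  field_simp

lemma hk_alg (a m : ℕ) (X Y y : ℂ) (h : X ≠ 0) :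
    ((a : ℂ) * Y ^ (a - 1) * (starRingEnd ℂ) y * X ^ (a + m) -
      Y ^ a * (((a + m : ℕ) : ℂ) * X ^ (a + m - 1) * y)) / (X ^ (a + m)) ^ 2 =
    a * (starRingEnd ℂ) y * (Y ^ (a - 1) / X ^ (a - 1 + (m + 1))) -
        (a + m : ℕ) * y * (Y ^ a / X ^ (a + (m + 1))) := by
  rcases Nat.eq_zero_or_pos a with ha | ha
  · subst ha
    rcases Nat.eq_zero_or_pos m with hm | hm
    · subst hm; simp
    · obtain ⟨p, rfl⟩ : ∃ p, m = p + 1 := ⟨m - 1, by omega⟩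
      simp
      field_simp
      ring
  · obtain ⟨p, rfl⟩ : ∃ p, a = p + 1 := ⟨a - 1, by omega⟩
    have e1 : p + 1 + m - 1 = p + m := by omega
    have e2 : p + (m + 1) = p + 1 + m := by omega
    simp only [Nat.add_sub_cancel, e1, e2]
    push_cast
    field_simp
    ring

lemma hk_deriv (a m : ℕ) (x y : ℂ) (s : ℝ) (h : x + s * y ≠ 0) :
    HasDerivAt (fun s : ℝ => hk a m (x + s * y))
      (a * (starRingEnd ℂ) y * hk (a - 1) (m + 1) (x + s * y) -
        (a + m : ℕ) * y * hk a (m + 1) (x + s * y)) s := by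
  have h1 : HasDerivAt (fun s : ℝ => x + s * y) y s := by
    have : HasDerivAt (fun s : ℝ => (s : ℂ)) 1 s := Complex.ofRealCLM.hasDerivAt
    simpa using (this.mul_const y).const_add x
  have h2 : HasDerivAt (fun s : ℝ => (starRingEnd ℂ) (x + s * y)) ((starRingEnd ℂ) y) s := by
    have : HasDerivAt (fun s : ℝ => (s : ℂ)) 1 s := Complex.ofRealCLM.hasDerivAt
    simpa using (this.mul_const ((starRingEnd ℂ) y)).const_add ((starRingEnd ℂ) x)
  have h3 := (h2.pow a).div (h1.pow (a + m)) (pow_ne_zero _ h)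
  refine h3.congr_deriv ?_
  exact hk_alg a m _ _ y h

lemma seg_norm (x y : ℂ) (s : ℝ) (hs : s ∈ Icc (0:ℝ) 1) (h : ‖y‖ ≤ ‖x‖ / 2) :
    ‖x‖ / 2 ≤ ‖x + s * y‖ := by
  have : ‖(s : ℂ) * y‖ ≤ ‖x‖ / 2 := by
    rw [norm_mul, Complex.norm_real, Real.norm_of_nonneg hs.1]
    nlinarith [hs.1, hs.2, norm_nonneg y]
  have h2 := norm_sub_le (x + s * y) (s * y)
  rw [add_sub_cancel_right] at h2
  linarith

lemma hk_lip (a m : ℕ) : ∃ C : ℝ, 0 < C ∧ ∀ x y : ℂ, ‖y‖ ≤ ‖x‖ / 2 →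
    ‖hk a m (x + y) - hk a m x‖ ≤ C * ‖y‖ / ‖x‖ ^ (m + 1) := by
  refine ⟨(2 * a + m + 1 : ℝ) * 2 ^ (m + 1), by positivity, fun x y h => ?_⟩
  rcases eq_or_ne x 0 with rfl | hx
  · simp at h; simp [h]
  have hx0 : 0 < ‖x‖ := norm_pos_iff.2 hx
  have key := norm_image_sub_le_of_norm_deriv_le_segment_01' (f := fun s : ℝ => hk a m (x + s * y))
    (f' := fun s : ℝ => (a * (starRingEnd ℂ) y * hk (a - 1) (m + 1) (x + s * y) -
        (a + m : ℕ) * y * hk a (m + 1) (x + s * y)))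
    (C := (2 * a + m + 1 : ℝ) * 2 ^ (m + 1) * ‖y‖ / ‖x‖ ^ (m + 1)) (fun s hs => by
      apply HasDerivAt.hasDerivWithinAt
      apply hk_deriv
      have := seg_norm x y s hs h
      apply norm_pos_iff.1; linarith) (fun s hs => by
      have h1 := seg_norm x y s ⟨hs.1, hs.2.le⟩ h
      have h2 : x + s * y ≠ 0 := by apply norm_pos_iff.1; linarith
      refine (norm_sub_le _ _).trans ?_
      simp only [norm_mul, hk_norm _ _ _ h2, RCLike.norm_conj, Complex.norm_natCast]
      have h3 : 1 / ‖x + s * y‖ ^ (m + 1) ≤ 2 ^ (m + 1) / ‖x‖ ^ (m + 1) := by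
        rw [← div_pow, ← one_div_pow]
        refine pow_le_pow_left₀ (by positivity) ?_ _
        rw [div_le_div_iff₀ (by linarith) hx0]; linarith
      calc _ = ((2 * a + m) * ‖y‖) * (1 / ‖x + s * y‖ ^ (m + 1)) := by push_cast; ring
        _ ≤ ((2 * a + m + 1) * ‖y‖) * (2 ^ (m + 1) / ‖x‖ ^ (m + 1)) := by gcongr ?_ * _ * ?_; linarith
        _ = _ := by ring)
  simpa using key

lemma f0_eq (n : ℕ) (hn : 1 ≤ n) (w : ℂ) : f0 n w = n * hk (n - 1) 2 w := by
  rw [f0, hk, mul_div_assoc]; congr 3; omega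

lemma f0_norm (n : ℕ) (hn : 1 ≤ n) (w : ℂ) : ‖f0 n w‖ = n / ‖w‖ ^ 2 := by
  rcases eq_or_ne w 0 with rfl | hw
  · simp [f0]
  rw [f0_eq n hn, norm_mul, hk_norm _ _ _ hw, Complex.norm_natCast]; ring

lemma f0_lip (n : ℕ) (hn : 1 ≤ n) : ∃ C : ℝ, 0 < C ∧ ∀ x y : ℂ, ‖y‖ ≤ ‖x‖ / 2 →
    ‖f0 n (x + y) - f0 n x‖ ≤ C * ‖y‖ / ‖x‖ ^ 3 := by
  obtain ⟨C, hC, h⟩ := hk_lip (n - 1) 2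
  refine ⟨n * C, by positivity, fun x y hxy => ?_⟩
  rw [f0_eq n hn, f0_eq n hn, ← mul_sub, norm_mul, Complex.norm_natCast, mul_assoc, mul_div_assoc]
  gcongr
  exact h x y hxy

lemma hk_lip2 (a m : ℕ) : ∃ C : ℝ, 0 < C ∧ ∀ x y v : ℂ, ‖y‖ ≤ ‖x‖ / 4 → ‖v‖ ≤ ‖x‖ / 4 →
    ‖(hk a m (x + v + y) - hk a m (x + v)) - (hk a m (x + y) - hk a m x)‖
      ≤ C * ‖y‖ * ‖v‖ / ‖x‖ ^ (m + 2) := by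
  obtain ⟨C1, hC1, h1⟩ := hk_lip (a - 1) (m + 1)
  obtain ⟨C2, hC2, h2⟩ := hk_lip a (m + 1)
  refine ⟨(a * C1 + (a + m) * C2 + 1) * 2 ^ (m + 2), by positivity, fun x y v h hv => ?_⟩
  rcases eq_or_ne x 0 with rfl | hx
  · simp at h hv; simp [h, hv]
  have hx0 : 0 < ‖x‖ := norm_pos_iff.2 hx
  have sn : ∀ s ∈ Icc (0:ℝ) 1, 3 * ‖x‖ / 4 ≤ ‖x + s * y‖ := by
    intro s hs
    have : ‖(s : ℂ) * y‖ ≤ ‖x‖ / 4 := by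
      rw [norm_mul, Complex.norm_real, Real.norm_of_nonneg hs.1]
      nlinarith [hs.1, hs.2, norm_nonneg y]
    have h2 := norm_sub_le (x + s * y) (s * y)
    rw [add_sub_cancel_right] at h2
    linarith
  have sn2 : ∀ s ∈ Icc (0:ℝ) 1, ‖x‖ / 2 ≤ ‖x + v + s * y‖ := by
    intro s hs
    have h1 := sn s hs
    have h2 := norm_sub_le (x + v + s * y) v
    rw [show x + v + s * y - v = x + s * y by ring] at h2
    linarith
  have key := norm_image_sub_le_of_norm_deriv_le_segment_01'
    (f := fun s : ℝ => hk a m (x + v + s * y) - hk a m (x + s * y))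
    (f' := fun s : ℝ => (a * (starRingEnd ℂ) y * hk (a - 1) (m + 1) (x + v + s * y) -
        (a + m : ℕ) * y * hk a (m + 1) (x + v + s * y)) -
        (a * (starRingEnd ℂ) y * hk (a - 1) (m + 1) (x + s * y) -
        (a + m : ℕ) * y * hk a (m + 1) (x + s * y)))
    (C := (a * C1 + (a + m) * C2 + 1) * 2 ^ (m + 2) * ‖y‖ * ‖v‖ / ‖x‖ ^ (m + 2)) (fun s hs => by
      apply HasDerivAt.hasDerivWithinAt
      apply HasDerivAt.sub <;> apply hk_deriv
      · have := sn2 s hs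
        apply norm_pos_iff.1; linarith
      · have := sn s hs
        apply norm_pos_iff.1; linarith) (fun s hs => by
      have hs' : s ∈ Icc (0:ℝ) 1 := ⟨hs.1, hs.2.le⟩
      have k1 := sn s hs'
      have e : x + v + s * y = (x + s * y) + v := by ring
      rw [e]
      set X := x + s * y
      have b1 := h1 X v (by linarith)
      have b2 := h2 X v (by linarith)
      have b3 : 1 / ‖X‖ ^ (m + 2) ≤ 2 ^ (m + 2) / ‖x‖ ^ (m + 2) := by
        rw [← div_pow, ← one_div_pow]
        refine pow_le_pow_left₀ (by positivity) ?_ _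
        rw [div_le_div_iff₀ (by linarith) hx0]; linarith
      calc _ = ‖a * (starRingEnd ℂ) y * (hk (a - 1) (m + 1) (X + v) - hk (a - 1) (m + 1) X)
              - (a + m : ℕ) * y * (hk a (m + 1) (X + v) - hk a (m + 1) X)‖ := by congr 1; ring
        _ ≤ _ := norm_sub_le _ _
        _ = a * ‖y‖ * ‖hk (a - 1) (m + 1) (X + v) - hk (a - 1) (m + 1) X‖
              + (a + m) * ‖y‖ * ‖hk a (m + 1) (X + v) - hk a (m + 1) X‖ := by
            simp only [norm_mul, RCLike.norm_conj, Complex.norm_natCast]; push_cast; ring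
        _ ≤ a * ‖y‖ * (C1 * ‖v‖ / ‖X‖ ^ (m + 1 + 1)) + (a + m) * ‖y‖ * (C2 * ‖v‖ / ‖X‖ ^ (m + 1 + 1)) := by
            gcongr
        _ = ((a * C1 + (a + m) * C2) * ‖y‖ * ‖v‖) * (1 / ‖X‖ ^ (m + 2)) := by ring
        _ ≤ ((a * C1 + (a + m) * C2 + 1) * ‖y‖ * ‖v‖) * (2 ^ (m + 2) / ‖x‖ ^ (m + 2)) := by
            gcongr ?_ * _ * _ * ?_; linarith
        _ = _ := by ring)
  have e : (hk a m (x + v + y) - hk a m (x + v)) - (hk a m (x + y) - hk a m x) =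
    (hk a m (x + v + y) - hk a m (x + y)) - (hk a m (x + v) - hk a m x) := by ring
  rw [e]
  simpa using key

lemma f0_lip2 (n : ℕ) (hn : 1 ≤ n) : ∃ C : ℝ, 0 < C ∧ ∀ x y v : ℂ, ‖y‖ ≤ ‖x‖ / 4 → ‖v‖ ≤ ‖x‖ / 4 →
    ‖(f0 n (x + v + y) - f0 n (x + v)) - (f0 n (x + y) - f0 n x)‖
      ≤ C * ‖y‖ * ‖v‖ / ‖x‖ ^ 4 := by
  obtain ⟨C, hC, h⟩ := hk_lip2 (n - 1) 2
  refine ⟨n * C, by positivity, fun x y v hxy hv => ?_⟩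
  simp only [f0_eq n hn, ← mul_sub, norm_mul, Complex.norm_natCast]
  rw [mul_assoc, mul_assoc, mul_div_assoc]
  gcongr
  rw [← mul_assoc]
  exact h x y v hxy hv

lemma f0_rot (n : ℕ) (a v : ℂ) :
    f0 n (a * v) = ((starRingEnd ℂ) a ^ (n - 1) / a ^ (n + 1)) * f0 n v := by
  simp only [f0, map_mul, mul_pow]
  rw [div_mul_div_comm]; congr 1; ring

lemma f0_meas (n : ℕ) : Measurable (f0 n) := by
  unfold f0
  have := Complex.continuous_conj.measurable
  fun_prop

lemma set_bd (μ : Measure ℂ) (f : ℂ → ℂ) (hf : Measurable f) (s T : Set ℂ) (hs : MeasurableSet s) (hsT : s ⊆ T)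
    (b : ℂ → ℝ) (hb : IntegrableOn b T μ) (hb0 : ∀ v, 0 ≤ b v) (hfb : ∀ v ∈ s, ‖f v‖ ≤ b v) :
    IntegrableOn f s μ ∧ ‖∫ v in s, f v ∂μ‖ ≤ ∫ v in T, b v ∂μ := by
  have h1 : IntegrableOn b s μ := hb.mono_set hsT
  have h2 : ∀ᵐ v ∂(μ.restrict s), ‖f v‖ ≤ b v := by
    filter_upwards [ae_restrict_mem hs] with v hv using hfb v hv
  refine ⟨Integrable.mono' h1 hf.aestronglyMeasurable h2, ?_⟩
  refine (norm_integral_le_of_norm_le h1 h2).trans ?_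
  exact setIntegral_mono_set hb (Eventually.of_forall hb0) (LE.le.eventuallyLE hsT)

lemma const_bd (f : ℂ → ℂ) (hf : Measurable f) (s : Set ℂ) (hs : MeasurableSet s) (c : ℂ) (R K : ℝ)
    (hR : 0 < R) (hK : 0 ≤ K)
    (hsT : s ⊆ ball c R) (hfb : ∀ v ∈ s, ‖f v‖ ≤ K) :
    IntegrableOn f s ∧ ‖∫ v in s, f v‖ ≤ K * (Real.pi * R ^ 2) := by
  have hfin : volume (ball c R) ≠ ⊤ := (measure_ball_lt_top).ne
  obtain ⟨h1, h2⟩ := set_bd volume f hf s (ball c R) hs hsT (fun _ => K) (integrableOn_const hfin) (fun _ => hK) hfb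
  refine ⟨h1, h2.trans ?_⟩
  rw [setIntegral_const, smul_eq_mul, mul_comm, Measure.real]
  gcongr
  have := vol_ball_le c R hR
  refine ENNReal.toReal_le_of_le_ofReal (by positivity) (this.trans ?_)
  norm_num

lemma in_bd (b : ℝ) (hb : 0 < b) (hab : b < 2) : ∃ C : ℝ, 0 < C ∧
    ∀ (f : ℂ → ℂ), Measurable f → ∀ (s : Set ℂ), MeasurableSet s → ∀ (c : ℂ) (R K : ℝ), 0 < R → 0 ≤ K →
    s ⊆ ball c R → (∀ v ∈ s, ‖f v‖ ≤ K * ‖v - c‖ ^ (-b)) →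
    IntegrableOn f s ∧ ‖∫ v in s, f v‖ ≤ K * (C * R ^ (2 - b)) := by
  obtain ⟨C, hC, h⟩ := inner_vol b hb hab
  refine ⟨C, hC, fun f hf s hs c R K hR hK hsT hfb => ?_⟩
  obtain ⟨h1, h2⟩ := h c R hR
  obtain ⟨h3, h4⟩ := set_bd volume f hf s _ hs hsT (fun v => K * ‖v - c‖ ^ (-b)) (h1.const_mul K)
    (fun v => by positivity) hfb
  refine ⟨h3, h4.trans ?_⟩
  rw [integral_const_mul]
  gcongr

lemma out_bd (b : ℝ) (hab : 2 < b) : ∃ C : ℝ, 0 < C ∧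
    ∀ (f : ℂ → ℂ), Measurable f → ∀ (s : Set ℂ), MeasurableSet s → ∀ (c : ℂ) (R K : ℝ), 0 < R → 0 ≤ K →
    s ⊆ (ball c R)ᶜ → (∀ v ∈ s, ‖f v‖ ≤ K * ‖v - c‖ ^ (-b)) →
    IntegrableOn f s ∧ ‖∫ v in s, f v‖ ≤ K * (C * R ^ (2 - b)) := by
  obtain ⟨C, hC, h⟩ := outer_vol b hab
  refine ⟨C, hC, fun f hf s hs c R K hR hK hsT hfb => ?_⟩
  obtain ⟨h1, h2⟩ := h c R hR
  obtain ⟨h3, h4⟩ := set_bd volume f hf s _ hs hsT (fun v => K * ‖v - c‖ ^ (-b)) (h1.const_mul K)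
    (fun v => by positivity) hfb
  refine ⟨h3, h4.trans ?_⟩
  rw [integral_const_mul]
  gcongr

lemma hp_meas (ρ : ℝ) : MeasurableSet {v : ℂ | ρ < v.im} :=
  measurableSet_lt measurable_const Complex.measurable_im

/-- uniform bound for truncated half-plane integral of `f0` -/
lemma f0_half (n : ℕ) (hn : 1 ≤ n) : ∃ C : ℝ, 0 < C ∧ ∀ t R : ℝ, 0 < t → 0 < R →
    ‖∫ v in {v : ℂ | t < v.im} ∩ ball 0 R, f0 n v‖ ≤ C := by
  obtain ⟨C1, hC1, h1⟩ := f0_lip n hn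
  obtain ⟨C2, hC2, h2⟩ := out_bd 3 (by norm_num)
  refine ⟨n * Real.pi + (C1 + 4 * n) * C2, by positivity, fun t R ht hR => ?_⟩
  set S := {v : ℂ | t < v.im} with hS
  have hSm : MeasurableSet S := hp_meas t
  have hBm : MeasurableSet (ball (0:ℂ) R) := measurableSet_ball
  have fm := f0_meas n
  have fm2 : Measurable fun v => f0 n (v - (-(R * I))) := fm.comp (measurable_id.sub_const _)
  have nv : ∀ v ∈ S, ‖v‖ ≤ ‖v + R * I‖ := by
    intro v hv
    have hv' : t < v.im := hv
    rw [← sq_le_sq₀ (norm_nonneg _) (norm_nonneg _), ← Complex.normSq_eq_norm_sq,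
      ← Complex.normSq_eq_norm_sq, Complex.normSq_apply, Complex.normSq_apply]
    simp; nlinarith
  have nR : ∀ v ∈ S, R ≤ ‖v + R * I‖ := by
    intro v hv
    have hv' : t < v.im := hv
    refine le_trans ?_ (Complex.abs_im_le_norm _)
    refine le_trans ?_ (le_abs_self _)
    simp; linarith
  have nt : ∀ v ∈ S, t ≤ ‖v‖ := by
    intro v hv
    have hv' : t < v.im := hv
    exact hv'.le.trans ((le_abs_self _).trans (Complex.abs_im_le_norm _))
  have a1 := const_bd (f0 n) fm (S ∩ ball 0 R) (hSm.inter hBm) 0 R (n / t ^ 2) hR (by positivity)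
    inter_subset_right (fun v hv => by rw [f0_norm n hn]; gcongr; exact nt v hv.1)
  have a2 := const_bd _ fm2 (S ∩ ball 0 R) (hSm.inter hBm) 0 R (n / R ^ 2) hR (by positivity)
    inter_subset_right (fun v hv => by
      rw [f0_norm n hn, sub_neg_eq_add]; gcongr; exact nR v hv.1)
  have a3 := h2 (fun v => f0 n v - f0 n (v - (-(R * I)))) (fm.sub fm2) (S \ ball 0 R) (hSm.diff hBm) 0 R
    ((C1 + 4 * n) * R) hR (by positivity) (fun v hv => hv.2) (fun v hv => by
      have hv2 : R ≤ ‖v‖ := by simpa using hv.2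
      have hv0 : 0 < ‖v‖ := hR.trans_le hv2
      have e : ‖v - 0‖ ^ (-3 : ℝ) = 1 / ‖v‖ ^ 3 := by
        rw [sub_zero, Real.rpow_neg (norm_nonneg _)]; norm_num
      rw [e, sub_neg_eq_add]
      by_cases h2R : R ≤ ‖v‖ / 2
      · rw [norm_sub_rev]
        have hn : ‖(R : ℂ) * I‖ = R := by simp [abs_of_pos hR]
        refine (h1 v (R * I) (by rw [hn]; exact h2R)).trans ?_
        rw [hn, ← mul_div_assoc, mul_one]
        gcongr
        have : (0:ℝ) ≤ n := by positivity
        linarith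
      · refine (norm_sub_le _ _).trans ?_
        rw [f0_norm n hn, f0_norm n hn]
        calc (n:ℝ) / ‖v‖ ^ 2 + n / ‖v + R * I‖ ^ 2 ≤ n / ‖v‖ ^ 2 + n / ‖v‖ ^ 2 := by
              gcongr; exact nv v hv.1
          _ = (2 * n * ‖v‖) / ‖v‖ ^ 3 := by field_simp; ring
          _ ≤ (2 * n * (2 * R)) / ‖v‖ ^ 3 := by gcongr; linarith
          _ ≤ (C1 + 4 * n) * R * (1 / ‖v‖ ^ 3) := by
              rw [← mul_div_assoc, mul_one]
              refine div_le_div_of_nonneg_right ?_ (by positivity); nlinarith)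
  have z := hp_zero_f0 n hn 0 (-(R * I)) t (by simpa using ht.le) (by simp; linarith)
  simp only [sub_zero] at z
  have hi : IntegrableOn (fun v => f0 n v - f0 n (v - (-(R * I)))) (S ∩ ball 0 R) := a1.1.sub a2.1
  have hi2 : IntegrableOn (fun v => f0 n v - f0 n (v - (-(R * I)))) S := by
    rw [← inter_union_sdiff S (ball 0 R)]
    exact hi.union a3.1
  have sp := integral_inter_add_sdiff hBm hi2
  rw [z, integral_sub a1.1 a2.1] at sp
  have e : ∫ v in S ∩ ball 0 R, f0 n v = (∫ v in S ∩ ball 0 R, f0 n (v - (-(R * I)))) -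
      ∫ v in S \ ball 0 R, (f0 n v - f0 n (v - (-(R * I)))) := by
    linear_combination sp
  rw [e]
  refine (norm_sub_le _ _).trans (add_le_add (a2.2.trans_eq ?_) (a3.2.trans_eq ?_))
  · field_simp
  · rw [show (2:ℝ) - 3 = -1 by norm_num, Real.rpow_neg_one]; field_simp

lemma f0_holo (n : ℕ) (hn : 1 ≤ n) : ∃ C : ℝ, 0 < C ∧ ∀ (t R m : ℝ) (k : ℂ → ℂ), 0 < t → 0 < R → 0 ≤ m →
    Measurable k → DifferentiableOn ℂ k (ball 0 (2 * R)) → (∀ v ∈ ball (0:ℂ) (2 * R), ‖k v‖ ≤ m) →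
    ‖∫ v in {v : ℂ | t < v.im} ∩ ball 0 R, k v * f0 n v‖ ≤ C * m := by
  obtain ⟨C1, hC1, h1⟩ := f0_half n hn
  obtain ⟨C2, hC2, h2⟩ := in_bd 1 (by norm_num) (by norm_num)
  refine ⟨C1 + n * C2, by positivity, fun t R m k ht hR hm km kd kb => ?_⟩
  set S := {v : ℂ | t < v.im} with hS
  have hSm : MeasurableSet S := hp_meas t
  have hBm : MeasurableSet (ball (0:ℂ) R) := measurableSet_ball
  have fm := f0_meas n
  have nt : ∀ v ∈ S, t ≤ ‖v‖ := by
    intro v hv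
    have hv' : t < v.im := hv
    exact hv'.le.trans ((le_abs_self _).trans (Complex.abs_im_le_norm _))
  have a1 := const_bd (f0 n) fm (S ∩ ball 0 R) (hSm.inter hBm) 0 R (n / t ^ 2) hR (by positivity)
    inter_subset_right (fun v hv => by rw [f0_norm n hn]; gcongr; exact nt v hv.1)
  have k0 : ‖k 0‖ ≤ m := kb 0 (by simp [hR])
  have lip : ∀ v ∈ ball (0:ℂ) (2 * R), ‖k v - k 0‖ ≤ m / R * ‖v‖ := by
    intro v hv
    have := Complex.dist_le_div_mul_dist_of_mapsTo_ball (R₂ := 2 * m) kd (fun w hw => by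
      rw [mem_closedBall, dist_eq_norm]
      refine (norm_sub_le _ _).trans ?_
      linarith [kb w hw]) hv
    rw [dist_eq_norm, dist_eq_norm, sub_zero] at this
    rwa [mul_div_mul_left _ _ (by norm_num : (2:ℝ) ≠ 0)] at this
  have a2 := h2 (fun v => (k v - k 0) * f0 n v) ((km.sub_const _).mul fm) (S ∩ ball 0 R) (hSm.inter hBm) 0 R
    (m / R * n) hR (by positivity) inter_subset_right (fun v hv => by
      have hv0 : 0 < ‖v‖ := ht.trans_le (nt v hv.1)
      rw [norm_mul, f0_norm n hn, sub_zero, Real.rpow_neg_one]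
      have := lip v (ball_subset_ball (by linarith) hv.2)
      calc _ ≤ (m / R * ‖v‖) * (n / ‖v‖ ^ 2) := by gcongr
        _ = _ := by field_simp)
  have e : ∫ v in S ∩ ball 0 R, k v * f0 n v = (∫ v in S ∩ ball 0 R, (k v - k 0) * f0 n v) +
      k 0 * ∫ v in S ∩ ball 0 R, f0 n v := by
    rw [← integral_const_mul, ← integral_add a2.1 (a1.1.const_mul _)]
    congr 1; ext v; ring
  rw [e]
  refine (norm_add_le _ _).trans ?_
  have b2 : ‖k 0 * ∫ v in S ∩ ball 0 R, f0 n v‖ ≤ m * C1 := by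
    rw [norm_mul]; gcongr; exact h1 t R ht hR
  have b1 := a2.2
  rw [show (2:ℝ) - 1 = 1 by norm_num, Real.rpow_one] at b1
  have e3 : m / R * n * (C2 * R) = m * n * C2 := by field_simp
  rw [e3] at b1
  linarith

/-- rigid motion -/
def rig (c u v : ℂ) : ℂ := c + u * v

lemma conj_mul_self' (u : ℂ) (hu : ‖u‖ = 1) : (starRingEnd ℂ) u * u = 1 := by
  rw [mul_comm, Complex.mul_conj, Complex.normSq_eq_norm_sq, hu]; simp

lemma rig_mp (c u : ℂ) (hu : ‖u‖ = 1) : MeasurePreserving (rig c u) volume volume := by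
  have h1 : MeasurePreserving (fun v : ℂ => u * v) volume volume := by
    have := (rotation (⟨u, mem_sphere_zero_iff_norm.2 hu⟩ : Circle)).measurePreserving
    exact this
  exact (measurePreserving_add_left volume c).comp h1

lemma rig_inv (c u : ℂ) (hu : ‖u‖ = 1) (w : ℂ) : rig c u ((starRingEnd ℂ) u * (w - c)) = w := by
  have := conj_mul_self' u hu
  simp only [rig]; linear_combination (w - c) * this

lemma rig_inv' (c u : ℂ) (hu : ‖u‖ = 1) (v : ℂ) : (starRingEnd ℂ) u * (rig c u v - c) = v := by
  have := conj_mul_self' u hu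
  simp only [rig]; linear_combination v * this

lemma rig_emb (c u : ℂ) (hu : ‖u‖ = 1) : MeasurableEmbedding (rig c u) := by
  have hm : Measurable (rig c u) := (rig_mp c u hu).measurable
  let e : ℂ ≃ᵐ ℂ := {
    toFun := rig c u
    invFun := fun w => (starRingEnd ℂ) u * (w - c)
    left_inv := rig_inv' c u hu
    right_inv := rig_inv c u hu
    measurable_toFun := hm
    measurable_invFun := by
      show Measurable fun w => (starRingEnd ℂ) u * (w - c)
      fun_prop }
  exact e.measurableEmbedding

/-- change of variables -/
lemma rig_cov (c u : ℂ) (hu : ‖u‖ = 1) (S : Set ℂ) (f : ℂ → ℂ) :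
    ∫ w in S, f w = ∫ v in rig c u ⁻¹' S, f (rig c u v) :=
  ((rig_mp c u hu).setIntegral_preimage_emb (rig_emb c u hu) f S).symm

def halfp (c u : ℂ) (ρ : ℝ) : Set ℂ := {w | ρ < ((starRingEnd ℂ) u * (w - c)).im}

def strip (M ε : ℝ) (c u : ℂ) (ρ : ℝ) : Set ℂ :=
  {w | |((starRingEnd ℂ) u * (w - c)).im - ρ| ≤ M * ‖w - c‖ ^ (1 + ε)}

lemma halfp_meas (c u : ℂ) (ρ : ℝ) : MeasurableSet (halfp c u ρ) :=
  measurableSet_lt measurable_const (by fun_prop)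

lemma halfp_norm (c u : ℂ) (hu : ‖u‖ = 1) (ρ : ℝ) (w : ℂ) (hw : w ∈ halfp c u ρ) : ρ < ‖w - c‖ := by
  have h : ρ < ((starRingEnd ℂ) u * (w - c)).im := hw
  refine h.trans_le ((le_abs_self _).trans ((Complex.abs_im_le_norm _).trans_eq ?_))
  rw [norm_mul, RCLike.norm_conj, hu, one_mul]

lemma halfp01 (ρ : ℝ) : halfp 0 1 ρ = {v : ℂ | ρ < v.im} := by
  simp [halfp]

lemma strip_area (M ε : ℝ) (hM : 0 ≤ M) (hε : 0 < ε) (c u : ℂ) (hu : ‖u‖ = 1) (ρ S : ℝ) (hS : 0 < S) :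
    volume.restrict (strip M ε c u ρ) (ball c S) ≤ ENNReal.ofReal (4 * M * S ^ (2 + ε)) := by
  rw [Measure.restrict_apply measurableSet_ball]
  rw [← (rig_mp c u hu).measure_preimage_emb (rig_emb c u hu)]
  set h := M * S ^ (1 + ε) with hh
  have hh0 : 0 ≤ h := by positivity
  have sub : rig c u ⁻¹' (ball c S ∩ strip M ε c u ρ) ⊆
      Complex.measurableEquivRealProd ⁻¹' (Icc (-S) S ×ˢ Icc (ρ - h) (ρ + h)) := by
    intro v hv
    have hv1 : ‖v‖ < S := by
      have := hv.1
      rw [mem_ball, dist_eq_norm, rig, add_sub_cancel_left, norm_mul, hu, one_mul] at this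
      exact this
    have hv2 := hv.2
    simp only [strip, mem_ofPred_eq, rig_inv' c u hu] at hv2
    rw [rig, add_sub_cancel_left, norm_mul, hu, one_mul] at hv2
    have h3 : |v.im - ρ| ≤ h := hv2.trans (by rw [hh]; gcongr)
    have h4 := abs_le.1 ((Complex.abs_re_le_norm v).trans hv1.le)
    have h5 := abs_le.1 h3
    simp only [mem_preimage, mem_prod, Complex.measurableEquivRealProd_apply, mem_Icc]
    exact ⟨⟨h4.1, h4.2⟩, by linarith, by linarith⟩
  refine (measure_mono sub).trans ?_
  rw [Complex.volume_preserving_equiv_real_prod.measure_preimage_emb (MeasurableEquiv.measurableEmbedding _),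
    Measure.volume_eq_prod, Measure.prod_prod, Real.volume_Icc, Real.volume_Icc,
    ← ENNReal.ofReal_mul (by linarith)]
  apply ENNReal.ofReal_le_ofReal
  apply le_of_eq
  have e : S ^ (2 + ε) = S * S ^ (1 + ε) := by
    rw [show (2:ℝ) + ε = 1 + (1 + ε) by ring, Real.rpow_add hS 1, Real.rpow_one]
  rw [hh, e]; ring

lemma strip_out (ε b : ℝ) (hε : 0 < ε) (hb : 2 + ε < b) : ∃ C : ℝ, 0 < C ∧
    ∀ (f : ℂ → ℂ), Measurable f → ∀ (s : Set ℂ), MeasurableSet s → ∀ (M : ℝ) (c u : ℂ) (ρ R K : ℝ),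
    0 ≤ M → ‖u‖ = 1 → 0 < R → 0 ≤ K →
    s ⊆ strip M ε c u ρ → s ⊆ (ball c R)ᶜ → (∀ v ∈ s, ‖f v‖ ≤ K * ‖v - c‖ ^ (-b)) →
    ‖∫ v in s, f v‖ ≤ C * (K * M * R ^ (2 + ε - b)) := by
  obtain ⟨C, hC, h⟩ := outer_shell (2 + ε) b (by linarith) (by linarith) hb
  refine ⟨4 * C, by positivity, fun f hf s hs M c u ρ R K hM hu hR hK hs1 hs2 hfb => ?_⟩
  obtain ⟨h1, h2⟩ := h (volume.restrict (strip M ε c u ρ)) c (4 * M) R (by positivity) hR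
    (fun S hS => strip_area M ε hM hε c u hu ρ S hS)
  obtain ⟨h3, h4⟩ := set_bd (volume.restrict (strip M ε c u ρ)) f hf s _ hs hs2
    (fun v => K * ‖v - c‖ ^ (-b)) (h1.const_mul K) (fun v => by positivity) hfb
  rw [Measure.restrict_restrict hs, inter_eq_self_of_subset_left hs1] at h4
  refine h4.trans ?_
  rw [integral_const_mul]
  calc _ ≤ K * (C * (4 * M) * R ^ (2 + ε - b)) := by gcongr
    _ = _ := by ring

lemma strip_in (ε b : ℝ) (hε : 0 < ε) (hb0 : 0 < b) (hb : b < 2 + ε) : ∃ C : ℝ, 0 < C ∧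
    ∀ (f : ℂ → ℂ), Measurable f → ∀ (s : Set ℂ), MeasurableSet s → ∀ (M : ℝ) (c u : ℂ) (ρ R K : ℝ),
    0 ≤ M → ‖u‖ = 1 → 0 < R → 0 ≤ K →
    s ⊆ strip M ε c u ρ → s ⊆ ball c R → (∀ v ∈ s, ‖f v‖ ≤ K * ‖v - c‖ ^ (-b)) →
    ‖∫ v in s, f v‖ ≤ C * (K * M * R ^ (2 + ε - b)) := by
  obtain ⟨C, hC, h⟩ := inner_shell (2 + ε) b hb0 hb
  refine ⟨4 * C, by positivity, fun f hf s hs M c u ρ R K hM hu hR hK hs1 hs2 hfb => ?_⟩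
  obtain ⟨h1, h2⟩ := h (volume.restrict (strip M ε c u ρ)) c (4 * M) R (by positivity) hR
    (fun S hS => strip_area M ε hM hε c u hu ρ S hS)
  obtain ⟨h3, h4⟩ := set_bd (volume.restrict (strip M ε c u ρ)) f hf s _ hs hs2
    (fun v => K * ‖v - c‖ ^ (-b)) (h1.const_mul K) (fun v => by positivity) hfb
  rw [Measure.restrict_restrict hs, inter_eq_self_of_subset_left hs1] at h4
  refine h4.trans ?_
  rw [integral_const_mul]
  calc _ ≤ K * (C * (4 * M) * R ^ (2 + ε - b)) := by gcongr
    _ = _ := by ring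

lemma sd_bd (G : ℂ → ℂ) (E H : Set ℂ) (hE : MeasurableSet E) (hH : MeasurableSet H)
    (iE : IntegrableOn G E) (iH : IntegrableOn G H) (X : ℝ)
    (h : ∀ s, MeasurableSet s → (∀ v ∈ s, ¬ (v ∈ E ↔ v ∈ H)) → s ⊆ E ∪ H → ‖∫ v in s, G v‖ ≤ X) :
    ‖(∫ v in E, G v) - ∫ v in H, G v‖ ≤ 2 * X := by
  have e1 := integral_inter_add_sdiff hH iE
  have e2 := integral_inter_add_sdiff hE iH
  rw [inter_comm] at e2
  have : (∫ v in E, G v) - ∫ v in H, G v = (∫ v in E \ H, G v) - ∫ v in H \ E, G v := by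
    linear_combination e2 - e1
  rw [this, two_mul]
  refine (norm_sub_le _ _).trans (add_le_add (h _ (hE.diff hH) ?_ ?_) (h _ (hH.diff hE) ?_ ?_))
  · intro v hv; have := hv.1; have := hv.2; tauto
  · intro v hv; exact Or.inl hv.1
  · intro v hv; have := hv.1; have := hv.2; tauto
  · intro v hv; exact Or.inr hv.1

structure Flat (E : Set ℂ) (ε M r : ℝ) (c u : ℂ) (ρ : ℝ) : Prop where
  hu : ‖u‖ = 1
  pos : 0 < ρ
  emp : ∀ w ∈ E, ρ ≤ ‖w - c‖
  flat : ρ < r → ∀ w, ‖w - c‖ < r → ¬ (w ∈ E ↔ w ∈ halfp c u ρ) → w ∈ strip M ε c u ρ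

structure Gk (n : ℕ) (g : ℂ → ℂ) (t d ρ B : ℝ) : Prop where
  meas : Measurable g
  diff : ∀ v, v ≠ 0 → DifferentiableAt ℂ g v
  bd : ∀ v, v ≠ 0 → ‖g v‖ ≤ t / ‖v‖ ^ 3 + t / d / ‖v‖ ^ 2
  canc1 : ∀ R, 0 < R → R ≤ d → ‖∫ v in halfp 0 1 ρ ∩ ball 0 R, g v‖ ≤ B * t / R
  canc2 : ∀ ξ' : ℂ, ξ'.im ≤ ρ → ∫ v in halfp 0 1 ρ, g v * f0 n (v - ξ') = 0

lemma G_meas (n : ℕ) (g : ℂ → ℂ) (hg : Measurable g) (ξ : ℂ) : Measurable fun v => g v * f0 n (v - ξ) :=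
  hg.mul ((f0_meas n).comp (measurable_id.sub_const ξ))

lemma G_pt (n : ℕ) (hn : 1 ≤ n) (g : ℂ → ℂ) (t d R κ : ℝ) (ξ v : ℂ) (hd : 0 < d) (ht : 0 < t) (hξ : ‖ξ‖ ≤ d)
    (hg : ‖g v‖ ≤ t / ‖v‖ ^ 3 + t / d / ‖v‖ ^ 2) (hR : 0 < R) (hκ : 0 < κ) (hv : R ≤ ‖v‖) (hvξ : κ ≤ ‖v - ξ‖) :
    ‖g v * f0 n (v - ξ)‖ ≤ (n * (t / R + t / d) * (1 + d / κ) ^ 2) * ‖v‖ ^ (-4 : ℝ) := by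
  have hv0 : 0 < ‖v‖ := hR.trans_le hv
  have hx0 : 0 < ‖v - ξ‖ := hκ.trans_le hvξ
  rw [Real.rpow_neg hv0.le, show (4:ℝ) = (4:ℕ) by norm_num, Real.rpow_natCast, norm_mul, f0_norm n hn]
  have h1 : t / ‖v‖ ^ 3 + t / d / ‖v‖ ^ 2 ≤ (t / R + t / d) / ‖v‖ ^ 2 := by
    rw [add_div]
    gcongr ?_ + _
    rw [div_div]
    refine div_le_div_of_nonneg_left ht.le (by positivity) ?_
    rw [pow_succ, mul_comm]; exact mul_le_mul_of_nonneg_left hv (by positivity)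
  have h2 : ‖v‖ ≤ (1 + d / κ) * ‖v - ξ‖ := by
    have a := norm_add_le (v - ξ) ξ
    rw [sub_add_cancel] at a
    have b : d ≤ d / κ * ‖v - ξ‖ := by
      rw [div_mul_eq_mul_div, le_div_iff₀ hκ]; gcongr
    linarith
  have h3 : (n:ℝ) / ‖v - ξ‖ ^ 2 ≤ n * (1 + d / κ) ^ 2 / ‖v‖ ^ 2 := by
    rw [div_le_div_iff₀ (by positivity) (by positivity), mul_assoc, ← mul_pow]
    gcongr
  calc _ ≤ ((t / R + t / d) / ‖v‖ ^ 2) * (n * (1 + d / κ) ^ 2 / ‖v‖ ^ 2) := by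
        gcongr; exact hg.trans h1
    _ = _ := by field_simp

lemma G_int (n : ℕ) (hn : 1 ≤ n) (g : ℂ → ℂ) (t d R κ : ℝ) (ξ : ℂ) (hd : 0 < d) (ht : 0 < t) (hξ : ‖ξ‖ ≤ d)
    (hm : Measurable g)
    (hg : ∀ v, v ≠ 0 → ‖g v‖ ≤ t / ‖v‖ ^ 3 + t / d / ‖v‖ ^ 2) (hR : 0 < R) (hκ : 0 < κ) (S : Set ℂ)
    (hS : MeasurableSet S) (hv : ∀ v ∈ S, R ≤ ‖v‖) (hvξ : ∀ v ∈ S, κ ≤ ‖v - ξ‖) :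
    IntegrableOn (fun v => g v * f0 n (v - ξ)) S := by
  obtain ⟨C, hC, h⟩ := out_bd 4 (by norm_num)
  refine (h _ (G_meas n g hm ξ) S hS 0 R (n * (t / R + t / d) * (1 + d / κ) ^ 2) hR (by positivity)
    (fun v hv' => by simpa using hv v hv') (fun v hv' => ?_)).1
  rw [sub_zero]
  have := hv v hv'
  exact G_pt n hn g t d R κ ξ v hd ht hξ (hg v (norm_pos_iff.1 (by linarith))) hR hκ this (hvξ v hv')

lemma tpow (ε t x : ℝ) (hε : ε < 1) (ht : 0 < t) (hx : t ≤ x) : t * x ^ (ε - 1) ≤ t ^ ε := by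
  have : x ^ (ε - 1) ≤ t ^ (ε - 1) := Real.rpow_le_rpow_of_nonpos ht hx (by linarith)
  calc t * x ^ (ε - 1) ≤ t * t ^ (ε - 1) := by gcongr
    _ = t ^ ε := by
      nth_rewrite 1 [← Real.rpow_one t]
      rw [← Real.rpow_add ht]; congr 1; ring

lemma tpow3 (ε t d : ℝ) (hε : ε < 1) (ht : 0 < t) (hd : t ≤ d) : t / d ^ 3 * d ^ ε ≤ t ^ ε / d ^ 2 := by
  have hd0 : 0 < d := ht.trans_le hd
  have := tpow ε t d hε ht hd
  rw [Real.rpow_sub hd0, Real.rpow_one] at this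
  calc t / d ^ 3 * d ^ ε = (t * (d ^ ε / d)) / d ^ 2 := by field_simp
    _ ≤ _ := by gcongr

lemma N0 (n : ℕ) (hn : 1 ≤ n) (ε : ℝ) (hε0 : 0 < ε) (hε1 : ε < 1) : ∃ C : ℝ, 0 < C ∧
    ∀ (E : Set ℂ) (M r ρ t d R B : ℝ) (g : ℂ → ℂ) (ξ : ℂ), MeasurableSet E → 0 ≤ M →
      Flat E ε M r 0 1 ρ → Gk n g t d ρ B → ‖ξ‖ = d → 0 < t → t ≤ ρ → t ≤ d → 0 < R → R ≤ d / 2 → R ≤ r →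
      ‖(∫ v in E ∩ ball 0 R, g v * f0 n (v - ξ)) - ∫ v in halfp 0 1 ρ ∩ ball 0 R, g v * f0 n (v - ξ)‖
        ≤ C * M * (t ^ ε / d ^ 2) := by
  obtain ⟨C, hC, h⟩ := strip_out ε 3 hε0 (by linarith)
  refine ⟨2 * (C * (8 * n)), by positivity, fun E M r ρ t d R B g ξ hE hM hF hG hξ ht htρ htd hR hRd hRr => ?_⟩
  have hd : 0 < d := by linarith
  have hρ := hF.pos
  have e1 : ∀ v ∈ E ∩ ball 0 R, ρ ≤ ‖v‖ := fun v hv => by simpa using hF.emp v hv.1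
  have e2 : ∀ v ∈ halfp 0 1 ρ ∩ ball 0 R, ρ ≤ ‖v‖ := fun v hv => by
    simpa using (halfp_norm 0 1 (by simp) ρ v hv.1).le
  have rhs0 : 0 ≤ 2 * (C * (8 * n)) * M * (t ^ ε / d ^ 2) := by positivity
  by_cases hρr : R ≤ ρ
  · have z1 : E ∩ ball 0 R = ∅ := by
      ext v; simp only [mem_empty_iff_false, iff_false]; intro hv
      have := e1 v hv; have h3 : ‖v‖ < R := by simpa using hv.2
      linarith
    have z2 : halfp 0 1 ρ ∩ ball 0 R = ∅ := by
      ext v; simp only [mem_empty_iff_false, iff_false]; intro hv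
      have := e2 v hv; have h3 : ‖v‖ < R := by simpa using hv.2
      linarith
    rw [z1, z2]; simpa using rhs0
  push Not at hρr
  have ex : ∀ v ∈ ball (0:ℂ) R, d / 2 ≤ ‖v - ξ‖ := fun v hv => by
    have h3 : ‖v‖ < R := by simpa using hv
    have := norm_sub_norm_le ξ v
    rw [norm_sub_rev] at this; linarith
  have m1 : MeasurableSet (E ∩ ball 0 R) := hE.inter measurableSet_ball
  have m2 : MeasurableSet (halfp 0 1 ρ ∩ ball 0 R) := (halfp_meas _ _ _).inter measurableSet_ball
  have gm := G_meas n g hG.meas ξ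
  refine (sd_bd _ _ _ m1 m2
    (G_int n hn g t d ρ (d/2) ξ hd ht hξ.le hG.meas hG.bd hρ (by positivity) _ m1 e1 (fun v hv => ex v hv.2))
    (G_int n hn g t d ρ (d/2) ξ hd ht hξ.le hG.meas hG.bd hρ (by positivity) _ m2 e2 (fun v hv => ex v hv.2))
    (C * ((8 * n * t / d ^ 2) * M * ρ ^ (2 + ε - 3))) (fun s hs hs1 hs2 => ?_)).trans ?_
  · have sR : ∀ v ∈ s, v ∈ ball (0:ℂ) R := fun v hv => (hs2 hv).elim (fun h => h.2) (fun h => h.2)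
    have sρ : ∀ v ∈ s, ρ ≤ ‖v‖ := fun v hv => (hs2 hv).elim (e1 v) (e2 v)
    refine h _ gm s hs M 0 1 ρ ρ _ hM (by simp) hρ (by positivity) (fun v hv => ?_) (fun v hv => ?_) (fun v hv => ?_)
    · have h3 : ‖v‖ < R := by simpa using sR v hv
      refine hF.flat (by linarith) v (by simpa using h3.trans_le hRr) ?_
      have := hs1 v hv
      have := sR v hv
      simp only [mem_inter_iff] at *
      tauto
    · simpa using sρ v hv
    · have h1 := sρ v hv
      have h3 : ‖v‖ < R := by simpa using sR v hv
      have hv0 : 0 < ‖v‖ := by linarith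
      have hg := hG.bd v (norm_pos_iff.1 hv0)
      rw [sub_zero, Real.rpow_neg hv0.le, show (3:ℝ) = (3:ℕ) by norm_num, Real.rpow_natCast, norm_mul, f0_norm n hn]
      have g2 : ‖g v‖ ≤ 2 * t / ‖v‖ ^ 3 := by
        refine hg.trans ?_
        have : t / d / ‖v‖ ^ 2 ≤ t / ‖v‖ ^ 3 := by
          rw [div_div]; gcongr
          rw [pow_succ, mul_comm]; gcongr; linarith
        rw [mul_div_assoc]; linarith
      have g3 : (n:ℝ) / ‖v - ξ‖ ^ 2 ≤ n / (d / 2) ^ 2 := by gcongr; exact ex v (sR v hv)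
      calc _ ≤ (2 * t / ‖v‖ ^ 3) * (n / (d / 2) ^ 2) := by gcongr
        _ = _ := by field_simp; ring
  · have := tpow ε t ρ hε1 ht htρ
    rw [show 2 + ε - 3 = ε - 1 by ring]
    calc _ = 2 * (C * (8 * n)) * M * ((t * ρ ^ (ε - 1)) / d ^ 2) := by field_simp
      _ ≤ _ := by gcongr

lemma NX (n : ℕ) (hn : 1 ≤ n) (ε : ℝ) (hε0 : 0 < ε) : ∃ C : ℝ, 0 < C ∧
    ∀ (E : Set ℂ) (M r ρ ρ' t d R B : ℝ) (g : ℂ → ℂ) (ξ a : ℂ), MeasurableSet E → 0 ≤ M →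
      Flat E ε M r ξ a ρ' → Gk n g t d ρ B → ‖ξ‖ = d → 0 < t → 0 < d → 0 < R → R ≤ d / 2 → R ≤ r →
      ‖(∫ v in E ∩ ball ξ R, g v * f0 n (v - ξ)) - ∫ v in halfp ξ a ρ' ∩ ball ξ R, g v * f0 n (v - ξ)‖
        ≤ C * M * (t / d ^ 3 * R ^ ε) := by
  obtain ⟨C, hC, h⟩ := strip_in ε 2 hε0 (by norm_num) (by linarith)
  refine ⟨2 * (C * (12 * n)), by positivity, fun E M r ρ ρ' t d R B g ξ a hE hM hF hG hξ ht hd hR hRd hRr => ?_⟩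
  have hρ := hF.pos
  have e1 : ∀ v ∈ E ∩ ball ξ R, ρ' ≤ ‖v - ξ‖ := fun v hv => hF.emp v hv.1
  have e2 : ∀ v ∈ halfp ξ a ρ' ∩ ball ξ R, ρ' ≤ ‖v - ξ‖ := fun v hv =>
    (halfp_norm ξ a hF.hu ρ' v hv.1).le
  have rhs0 : 0 ≤ 2 * (C * (12 * n)) * M * (t / d ^ 3 * R ^ ε) := by positivity
  by_cases hρr : R ≤ ρ'
  · have z1 : E ∩ ball ξ R = ∅ := by
      ext v; simp only [mem_empty_iff_false, iff_false]; intro hv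
      have := e1 v hv; have h3 : ‖v - ξ‖ < R := by simpa [dist_eq_norm] using hv.2
      linarith
    have z2 : halfp ξ a ρ' ∩ ball ξ R = ∅ := by
      ext v; simp only [mem_empty_iff_false, iff_false]; intro hv
      have := e2 v hv; have h3 : ‖v - ξ‖ < R := by simpa [dist_eq_norm] using hv.2
      linarith
    rw [z1, z2]; simpa using rhs0
  push Not at hρr
  have ex : ∀ v ∈ ball ξ R, d / 2 ≤ ‖v‖ := fun v hv => by
    have h3 : ‖v - ξ‖ < R := by simpa [dist_eq_norm] using hv
    have := norm_sub_norm_le ξ v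
    rw [norm_sub_rev] at this; linarith
  have m1 : MeasurableSet (E ∩ ball ξ R) := hE.inter measurableSet_ball
  have m2 : MeasurableSet (halfp ξ a ρ' ∩ ball ξ R) := (halfp_meas _ _ _).inter measurableSet_ball
  have gm := G_meas n g hG.meas ξ
  refine (sd_bd _ _ _ m1 m2
    (G_int n hn g t d (d/2) ρ' ξ hd ht hξ.le hG.meas hG.bd (by positivity) hρ _ m1 (fun v hv => ex v hv.2) e1)
    (G_int n hn g t d (d/2) ρ' ξ hd ht hξ.le hG.meas hG.bd (by positivity) hρ _ m2 (fun v hv => ex v hv.2) e2)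
    (C * ((12 * n * t / d ^ 3) * M * R ^ (2 + ε - 2))) (fun s hs hs1 hs2 => ?_)).trans ?_
  · have sR : ∀ v ∈ s, v ∈ ball ξ R := fun v hv => (hs2 hv).elim (fun h => h.2) (fun h => h.2)
    have sρ : ∀ v ∈ s, ρ' ≤ ‖v - ξ‖ := fun v hv => (hs2 hv).elim (e1 v) (e2 v)
    refine h _ gm s hs M ξ a ρ' R _ hM hF.hu hR (by positivity) (fun v hv => ?_) sR (fun v hv => ?_)
    · have h3 : ‖v - ξ‖ < R := by simpa [dist_eq_norm] using sR v hv
      refine hF.flat (by linarith) v (h3.trans_le hRr) ?_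
      have := hs1 v hv
      have := sR v hv
      simp only [mem_inter_iff] at *
      tauto
    · have h1 := sρ v hv
      have h3 := ex v (sR v hv)
      have hv0 : 0 < ‖v‖ := by linarith
      have hx0 : 0 < ‖v - ξ‖ := by linarith
      have hg := hG.bd v (norm_pos_iff.1 hv0)
      rw [Real.rpow_neg hx0.le, show (2:ℝ) = (2:ℕ) by norm_num, Real.rpow_natCast, norm_mul, f0_norm n hn]
      have g2 : ‖g v‖ ≤ 12 * t / d ^ 3 := by
        refine hg.trans ?_
        calc _ ≤ t / (d / 2) ^ 3 + t / d / (d / 2) ^ 2 := by gcongr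
          _ = _ := by field_simp; norm_num
      calc _ ≤ (12 * t / d ^ 3) * (n / ‖v - ξ‖ ^ 2) := by gcongr
        _ = _ := by field_simp
  · rw [show 2 + ε - 2 = ε by ring]
    apply le_of_eq
    field_simp

lemma consist_real (x y d τ : ℝ) (hd : 0 < d) (hτ : 0 ≤ τ) (hτd : 40 * τ ≤ d) (h1 : x ^ 2 + y ^ 2 = 1)
    (h2 : d * |y| ≤ 3 * τ) (h3 : -(4 * τ) ≤ x * d) : 9/10 ≤ x ∧ 1 - x ≤ |y| := by
  have hy0 := abs_nonneg y
  have hy : |y| ≤ 1/10 := by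
    by_contra hc
    push Not at hc
    have : d * (1/10) < d * |y| := by gcongr
    linarith
  have hx : -(1/10) ≤ x := by
    by_contra hc
    push Not at hc
    have : x * d < -(1/10) * d := by gcongr
    linarith
  have hy2 : y ^ 2 ≤ 1/100 := by
    rw [← sq_abs]
    have := pow_le_pow_left₀ hy0 hy 2
    linarith
  have hx2 : 9/10 ≤ x := by
    by_contra hc
    push Not at hc
    have : x ^ 2 ≤ (9/10) ^ 2 := sq_le_sq' (by linarith) hc.le
    linarith
  refine ⟨hx2, ?_⟩
  have e : (1 - x) * (1 + x) = |y| * |y| := by rw [abs_mul_abs_self]; linarith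
  have hx1 : x ≤ 1 := by
    by_contra hc
    push Not at hc
    have : 1 < x ^ 2 := one_lt_pow₀ hc (by norm_num)
    have := sq_nonneg y
    linarith
  have q : (1 - x) * 1 ≤ (1 - x) * (1 + x) := mul_le_mul_of_nonneg_left (by linarith) (by linarith)
  have q2 : |y| * |y| ≤ |y| * 1 := mul_le_mul_of_nonneg_left (by linarith) hy0
  linarith

set_option maxHeartbeats 1000000 in
lemma consist (E : Set ℂ) (ε M r d τ ρ ρ' : ℝ) (ξ a : ℂ) (hε : 0 < ε) (hM : 0 ≤ M)
    (F0 : Flat E ε M r 0 1 ρ) (FX : Flat E ε M r ξ a ρ') (hd : 0 < d) (hξ : ‖ξ‖ ≤ d)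
    (hρ : ρ < 2 * d) (hρ' : ρ' < 3 * d) (hr : 10 * d < r) (hτ : τ = M * (10 * d) ^ (1 + ε))
    (hτd : 40 * τ ≤ d) :
    ‖a - 1‖ ≤ 6 * τ / d ∧ |ξ.im - (ρ - ρ')| ≤ 12 * τ := by
  have hτ0 : 0 ≤ τ := by rw [hτ]; positivity
  have hρ0 := F0.pos
  have hρ0' := FX.pos
  have ha := FX.hu
  have norms : ∀ y : ℂ, ‖y‖ ≤ 5 * d → ‖rig ξ a (ρ' * I + y) - ξ‖ < 10 * d ∧ ‖rig ξ a (ρ' * I + y)‖ < 10 * d := by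
    intro y hy
    have h1 : ‖(ρ' : ℂ) * I + y‖ ≤ ρ' + ‖y‖ := by
      refine (norm_add_le _ _).trans ?_
      simp [abs_of_pos hρ0']
    have h2 : ‖rig ξ a (ρ' * I + y) - ξ‖ = ‖(ρ' : ℂ) * I + y‖ := by
      rw [rig, add_sub_cancel_left, norm_mul, ha, one_mul]
    have h3 := norm_add_le (rig ξ a (ρ' * I + y) - ξ) ξ
    rw [sub_add_cancel] at h3
    constructor <;> linarith
  have st : ∀ c u : ℂ, ∀ q : ℝ, ∀ w : ℂ, ‖w - c‖ < 10 * d → w ∈ strip M ε c u q →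
      |((starRingEnd ℂ) u * (w - c)).im - q| ≤ τ := by
    intro c u q w hw hs
    refine le_trans (show |((starRingEnd ℂ) u * (w - c)).im - q| ≤ M * ‖w - c‖ ^ (1 + ε) from hs) ?_
    rw [hτ]; gcongr
  have im0 : ∀ y : ℂ, ((starRingEnd ℂ) 1 * (rig ξ a (ρ' * I + y) - 0)).im - ρ =
      (ξ.im + ρ' * a.re - ρ) + (a * y).im := by
    intro y; simp [rig, mul_add]; ring
  have imX : ∀ y : ℂ, ((starRingEnd ℂ) a * (rig ξ a (ρ' * I + y) - ξ)).im - ρ' = y.im := by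
    intro y; rw [rig_inv' ξ a ha]; simp
  set c0 := ξ.im + ρ' * a.re - ρ with hc0
  have up : ∀ y : ℂ, ‖y‖ ≤ 5 * d → y.im < -τ → c0 + (a * y).im ≤ τ := by
    intro y hy hy2
    by_contra hcon
    push Not at hcon
    obtain ⟨n1, n2⟩ := norms y hy
    set w := rig ξ a (ρ' * I + y) with hw
    have w1 : w ∈ E := by
      by_contra hne
      have hH : w ∈ halfp 0 1 ρ := by
        have := im0 y
        show ρ < _
        linarith
      have := st 0 1 ρ w (by simpa using n2) (F0.flat (by linarith) w (by simp; linarith) (by tauto))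
      rw [im0 y] at this
      linarith [(abs_le.1 this).2]
    have hH' : w ∉ halfp ξ a ρ' := by
      have := imX y
      show ¬ (ρ' < _)
      linarith
    have := st ξ a ρ' w n1 (FX.flat (by linarith) w (by linarith) (by tauto))
    rw [imX y] at this
    linarith [(abs_le.1 this).1]
  have dn : ∀ y : ℂ, ‖y‖ ≤ 5 * d → τ < y.im → -τ ≤ c0 + (a * y).im := by
    intro y hy hy2
    by_contra hcon
    push Not at hcon
    obtain ⟨n1, n2⟩ := norms y hy
    set w := rig ξ a (ρ' * I + y) with hw
    have w1 : w ∉ E := by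
      intro hne
      have hH : w ∉ halfp 0 1 ρ := by
        have := im0 y
        show ¬ (ρ < _)
        linarith
      have := st 0 1 ρ w (by simpa using n2) (F0.flat (by linarith) w (by simp; linarith) (by tauto))
      rw [im0 y] at this
      linarith [(abs_le.1 this).1]
    have hH' : w ∈ halfp ξ a ρ' := by
      have := imX y
      show ρ' < _
      linarith
    have := st ξ a ρ' w n1 (FX.flat (by linarith) w (by linarith) (by tauto))
    rw [imX y] at this
    linarith [(abs_le.1 this).2]
  have are : |a.re| ≤ 1 := ha ▸ Complex.abs_re_le_norm a
  have are' := abs_le.1 are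
  have asq : a.re ^ 2 + a.im ^ 2 = 1 := by
    have := Complex.sq_norm a
    rw [ha, Complex.normSq_apply] at this; nlinarith
  -- slightly larger vertical offsets to get strict inequalities
  have key : ∀ θ : ℝ, 0 < θ → θ ≤ d → |c0| + d * |a.im| ≤ 3 * τ + θ := by
    intro θ hθ hθd
    have nb : ∀ s q : ℝ, |s| ≤ d → |q| ≤ 4 * d → ‖(s + q * I : ℂ)‖ ≤ 5 * d := by
      intro s q hs hq
      refine (norm_add_le _ _).trans ?_
      rw [norm_mul, Complex.norm_real, Complex.norm_real, norm_I, mul_one, Real.norm_eq_abs, Real.norm_eq_abs]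
      linarith
    have q1 : |2 * τ + θ| ≤ 4 * d := by rw [abs_of_pos] <;> linarith
    have dd : |d| ≤ d := by rw [abs_of_pos hd]
    have dd' : |(-d)| ≤ d := by rw [abs_neg, abs_of_pos hd]
    have i1 := up _ (nb d (-(2 * τ + θ)) dd (by rwa [abs_neg])) (by simp; linarith)
    have i2 := up _ (nb (-d) (-(2 * τ + θ)) dd' (by rwa [abs_neg])) (by simp; linarith)
    have i3 := dn _ (nb d (2 * τ + θ) dd q1) (by simp; linarith)
    have i4 := dn _ (nb (-d) (2 * τ + θ) dd' q1) (by simp; linarith)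
    simp only [mul_im, add_re, add_im, ofReal_re, ofReal_im, mul_re, I_re, I_im, mul_zero, mul_one, sub_zero,
      zero_add, add_zero, zero_mul] at i1 i2 i3 i4
    have e : a.re * (2 * τ + θ) ≤ 2 * τ + θ := by nlinarith
    rcases abs_cases c0 with ⟨h, _⟩ | ⟨h, _⟩ <;> rcases abs_cases a.im with ⟨h', _⟩ | ⟨h', _⟩ <;>
      rw [h, h'] <;> nlinarith
  have key2 : |c0| + d * |a.im| ≤ 3 * τ := by
    by_contra hcon
    push Not at hcon
    have := key (min d ((|c0| + d * |a.im| - 3 * τ) / 2)) (lt_min hd (by linarith)) (min_le_left _ _)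
    have h2 := min_le_right d ((|c0| + d * |a.im| - 3 * τ) / 2)
    linarith
  have i5 := dn (d * I) (by simp [abs_of_pos hd]; linarith) (by simp; linarith)
  simp only [mul_im, ofReal_re, ofReal_im, mul_re, I_re, I_im, mul_zero, mul_one, sub_zero,
      zero_add, add_zero, zero_mul] at i5
  have hc0' : |c0| ≤ 3 * τ := by
    have : 0 ≤ d * |a.im| := by positivity
    linarith
  have him : d * |a.im| ≤ 3 * τ := by linarith [abs_nonneg c0]
  obtain ⟨hre2, hre3⟩ := consist_real a.re a.im d τ hd hτ0 hτd asq him (by linarith [(abs_le.1 hc0').2])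
  constructor
  · have : ‖a - 1‖ ≤ |(a - 1).re| + |(a - 1).im| := Complex.norm_le_abs_re_add_abs_im _
    simp only [sub_re, one_re, sub_im, one_im, sub_zero] at this
    rw [abs_of_nonpos (by linarith : a.re - 1 ≤ 0)] at this
    rw [le_div_iff₀ hd]
    nlinarith
  · have e : ξ.im - (ρ - ρ') = c0 + ρ' * (1 - a.re) := by rw [hc0]; ring
    rw [e]
    refine (abs_add_le _ _).trans ?_
    rw [abs_of_nonneg (mul_nonneg hρ0'.le (by linarith) : 0 ≤ ρ' * (1 - a.re))]
    have : ρ' * (1 - a.re) ≤ 3 * d * |a.im| := by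
      apply mul_le_mul <;> linarith
    linarith

structure Cfg (n : ℕ) (ε M r D B : ℝ) (E : Set ℂ) (ξ a : ℂ) (ρ ρ' t d : ℝ) (g : ℂ → ℂ) : Prop where
  hE : MeasurableSet E
  F0 : Flat E ε M r 0 1 ρ
  FX : Flat E ε M r ξ a ρ'
  G : Gk n g t d ρ B
  hξ : ‖ξ‖ = d
  ht : 0 < t
  htρ : t ≤ ρ
  htd : t ≤ d
  hdD : d ≤ D
  hρρ' : |ρ - ρ'| ≤ d

lemma FAR (n : ℕ) (hn : 1 ≤ n) (ε : ℝ) (hε0 : 0 < ε) (hε1 : ε < 1) : ∃ C : ℝ, 0 < C ∧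
    ∀ (E : Set ℂ) (M r ρ t d R κ B : ℝ) (g : ℂ → ℂ) (ξ : ℂ) (S : Set ℂ), MeasurableSet E → 0 ≤ M →
      Flat E ε M r 0 1 ρ → Gk n g t d ρ B → ‖ξ‖ = d → 0 < t → t ≤ d → 0 < R → 0 < κ → 0 < r → ρ < r →
      MeasurableSet S → (∀ v ∈ S, R ≤ ‖v‖) → (∀ v ∈ S, κ ≤ ‖v - ξ‖) →
      ‖(∫ v in E ∩ S, g v * f0 n (v - ξ)) - ∫ v in halfp 0 1 ρ ∩ S, g v * f0 n (v - ξ)‖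
        ≤ C * ((n * (t / R + t / d) * (1 + d / κ) ^ 2) * (M * R ^ (ε - 2) + r ^ (-2 : ℝ))) := by
  obtain ⟨C, hC, h⟩ := strip_out ε 4 hε0 (by linarith)
  obtain ⟨C2, hC2, h2⟩ := out_bd 4 (by norm_num)
  refine ⟨2 * (C + C2), by positivity, fun E M r ρ t d R κ B g ξ S hE hM hF hG hξ ht htd hR hκ hr hρr hS hS1 hS2 => ?_⟩
  have hd : 0 < d := by linarith
  have m1 : MeasurableSet (E ∩ S) := hE.inter hS
  have m2 : MeasurableSet (halfp 0 1 ρ ∩ S) := (halfp_meas _ _ _).inter hS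
  have gm := G_meas n g hG.meas ξ
  set K := (n * (t / R + t / d) * (1 + d / κ) ^ 2) with hK
  have hK0 : 0 ≤ K := by positivity
  have pt : ∀ v ∈ S, ‖g v * f0 n (v - ξ)‖ ≤ K * ‖v - 0‖ ^ (-4 : ℝ) := fun v hv => by
    have hv0 := hS1 v hv
    rw [sub_zero]
    exact G_pt n hn g t d R κ ξ v hd ht hξ.le (hG.bd v (norm_pos_iff.1 (by linarith))) hR hκ hv0 (hS2 v hv)
  refine (sd_bd _ _ _ m1 m2
    (G_int n hn g t d R κ ξ hd ht hξ.le hG.meas hG.bd hR hκ _ m1 (fun v hv => hS1 v hv.2) (fun v hv => hS2 v hv.2))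
    (G_int n hn g t d R κ ξ hd ht hξ.le hG.meas hG.bd hR hκ _ m2 (fun v hv => hS1 v hv.2) (fun v hv => hS2 v hv.2))
    (C * (K * M * R ^ (2 + ε - 4)) + K * (C2 * r ^ ((2:ℝ) - 4))) (fun s hs hs1 hs2 => ?_)).trans ?_
  · have sS : ∀ v ∈ s, v ∈ S := fun v hv => (hs2 hv).elim (fun h => h.2) (fun h => h.2)
    have iG := G_int n hn g t d R κ ξ hd ht hξ.le hG.meas hG.bd hR hκ _ hs (fun v hv => hS1 v (sS v hv))
      (fun v hv => hS2 v (sS v hv))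
    rw [← integral_inter_add_sdiff (measurableSet_ball (x := (0:ℂ)) (ε := r)) iG]
    refine (norm_add_le _ _).trans (add_le_add ?_ ?_)
    · refine h _ gm (s ∩ ball 0 r) (hs.inter measurableSet_ball) M 0 1 ρ R K hM (by simp) hR hK0
        (fun v hv => ?_) (fun v hv => ?_) (fun v hv => pt v (sS v hv.1))
      · refine hF.flat hρr v (by simpa using hv.2) ?_
        have := hs1 v hv.1
        have := sS v hv.1
        simp only [mem_inter_iff] at *
        tauto
      · simpa using hS1 v (sS v hv.1)
    · exact (h2 _ gm (s \ ball 0 r) (hs.diff measurableSet_ball) 0 r K hr hK0 (fun v hv => hv.2)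
        (fun v hv => pt v (sS v hv.1))).2
  · rw [show 2 + ε - 4 = ε - 2 by ring, show (2:ℝ) - 4 = -2 by norm_num]
    have a1 : 0 ≤ K * M * R ^ (ε - 2) := by positivity
    have a2 : 0 ≤ K * r ^ (-2 : ℝ) := by positivity
    nlinarith

/-- far constant comparisons -/
lemma farD (ε t d D : ℝ) (hε1 : ε < 1) (ht : 0 < t) (htd : t ≤ d) (hdD : d ≤ D) :
    t / d ≤ D ^ (2 - ε) * (t ^ ε / d ^ 2) := by
  have hd : 0 < d := by linarith
  have h1 := tpow3 ε t d hε1 ht htd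
  have h2 : d ^ (2 - ε) ≤ D ^ (2 - ε) := by gcongr; linarith
  have h3 : d ^ ε * d ^ (2 - ε) = d ^ 2 := by
    rw [← Real.rpow_add hd, show ε + (2 - ε) = (2:ℕ) by norm_num, Real.rpow_natCast]
  have h4 : 0 < D ^ (2 - ε) := Real.rpow_pos_of_pos (by linarith) _
  calc t / d = t / d ^ 3 * (d ^ ε * d ^ (2 - ε)) := by rw [h3]; field_simp
    _ = (t / d ^ 3 * d ^ ε) * d ^ (2 - ε) := by ring
    _ ≤ (t ^ ε / d ^ 2) * D ^ (2 - ε) := by gcongr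
    _ = _ := by ring

lemma farE (ε t d : ℝ) (hε1 : ε < 1) (ht : 0 < t) (htd : t ≤ d) :
    t / d * d ^ (ε - 2) ≤ t ^ ε / d ^ 2 := by
  have hd : 0 < d := by linarith
  refine le_trans (le_of_eq ?_) (tpow3 ε t d hε1 ht htd)
  rw [Real.rpow_sub hd, show (2:ℝ) = (2:ℕ) by norm_num, Real.rpow_natCast]
  field_simp

lemma caseA (n : ℕ) (hn : 1 ≤ n) (ε M r D B : ℝ) (hε0 : 0 < ε) (hε1 : ε < 1) (hM : 0 ≤ M) (hr : 0 < r)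
    (hD : 0 < D) :
    ∃ C : ℝ, 0 < C ∧ ∀ E ξ a ρ ρ' t d g, Cfg n ε M r D B E ξ a ρ ρ' t d g → 2 * d ≤ ρ →
      ‖∫ v in E, g v * f0 n (v - ξ)‖ ≤ C * (t ^ ε / d ^ 2) := by
  obtain ⟨C, hC, h⟩ := FAR n hn ε hε0 hε1
  obtain ⟨C2, hC2, h2⟩ := out_bd 4 (by norm_num)
  refine ⟨C * (8 * n * (M + D ^ (2 - ε) * r ^ (-2 : ℝ))) + C2 * (8 * n * (D ^ (2 - ε) * r ^ (-2 : ℝ))) + 1, by positivity,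
    fun E ξ a ρ ρ' t d g hc hρ => ?_⟩
  have ht := hc.ht
  have htd := hc.htd
  have hd : 0 < d := by linarith
  have hρ0 : 0 < ρ := by linarith
  have x1 := farD ε t d D hε1 ht htd hc.hdD
  have x2 := farE ε t d hε1 ht htd
  have p0 : 0 ≤ t ^ ε / d ^ 2 := by positivity
  have kx : ∀ v : ℂ, ρ ≤ ‖v‖ → d ≤ ‖v - ξ‖ := fun v hv => by
    have := norm_sub_norm_le v ξ
    rw [hc.hξ] at this; linarith
  have eE : ∀ v ∈ E, ρ ≤ ‖v‖ := fun v hv => by simpa using hc.F0.emp v hv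
  have eH : ∀ v ∈ halfp 0 1 ρ, ρ ≤ ‖v‖ := fun v hv => by
    simpa using (halfp_norm 0 1 (by simp) ρ v hv).le
  have Kb : (n * (t / ρ + t / d) * (1 + d / d) ^ 2) ≤ 8 * n * (t / d) := by
    have : t / ρ ≤ t / d := by gcongr; linarith
    rw [div_self hd.ne']
    calc _ ≤ (n * (t / d + t / d) * (1 + 1) ^ 2) := by gcongr
      _ = _ := by ring
  by_cases hρr : ρ < r
  · have mS : MeasurableSet ((ball (0:ℂ) ρ)ᶜ) := measurableSet_ball.compl
    have := h E M r ρ t d ρ d B g ξ (ball 0 ρ)ᶜ hc.hE hM hc.F0 hc.G hc.hξ ht htd hρ0 hd hr hρr mS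
      (fun v hv => by simpa using hv) (fun v hv => kx v (by simpa using hv))
    rw [inter_eq_self_of_subset_left (fun v hv => by simpa using eE v hv),
      inter_eq_self_of_subset_left (fun v hv => by simpa using eH v hv), hc.G.canc2 ξ (by
        have := (le_abs_self _).trans (Complex.abs_im_le_norm ξ)
        rw [hc.hξ] at this; linarith), sub_zero] at this
    refine this.trans ?_
    have r1 : ρ ^ (ε - 2) ≤ d ^ (ε - 2) := Real.rpow_le_rpow_of_nonpos hd (by linarith) (by linarith)
    calc _ ≤ C * (8 * n * (t / d) * (M * d ^ (ε - 2) + r ^ (-2 : ℝ))) := by gcongr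
      _ = C * (8 * n * (M * (t / d * d ^ (ε - 2)) + (t / d) * r ^ (-2 : ℝ))) := by ring
      _ ≤ C * (8 * n * (M * (t ^ ε / d ^ 2) + (D ^ (2 - ε) * (t ^ ε / d ^ 2)) * r ^ (-2 : ℝ))) := by gcongr
      _ = C * (8 * n * (M + D ^ (2 - ε) * r ^ (-2 : ℝ))) * (t ^ ε / d ^ 2) := by ring
      _ ≤ _ := by
        gcongr
        have : 0 ≤ C2 * (8 * n * (D ^ (2 - ε) * r ^ (-2 : ℝ))) := by positivity
        linarith
  · push Not at hρr
    have := (h2 _ (G_meas n g hc.G.meas ξ) E hc.hE 0 ρ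
      (n * (t / ρ + t / d) * (1 + d / d) ^ 2) hρ0 (by positivity) (fun v hv => by simpa using eE v hv)
      (fun v hv => by
        rw [sub_zero]
        exact G_pt n hn g t d ρ d ξ v hd ht hc.hξ.le (hc.G.bd v (norm_pos_iff.1 (by linarith [eE v hv]))) hρ0 hd
          (eE v hv) (kx v (eE v hv)))).2
    refine this.trans ?_
    rw [show (2:ℝ) - 4 = -2 by norm_num]
    have r1 : ρ ^ (-2 : ℝ) ≤ r ^ (-2 : ℝ) := Real.rpow_le_rpow_of_nonpos hr hρr (by norm_num)
    calc _ ≤ 8 * n * (t / d) * (C2 * r ^ (-2 : ℝ)) := by gcongr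
      _ ≤ 8 * n * (D ^ (2 - ε) * (t ^ ε / d ^ 2)) * (C2 * r ^ (-2 : ℝ)) := by gcongr
      _ = C2 * (8 * n * (D ^ (2 - ε) * r ^ (-2 : ℝ))) * (t ^ ε / d ^ 2) := by ring
      _ ≤ _ := by
        gcongr
        have : 0 ≤ C * (8 * n * (M + D ^ (2 - ε) * r ^ (-2 : ℝ))) := by positivity
        linarith

lemma split3 (f : ℂ → ℂ) (S A B : Set ℂ) (hA : MeasurableSet A) (hB : MeasurableSet B) (hAB : Disjoint A B)
    (hf : IntegrableOn f S) :
    ∫ v in S, f v = (∫ v in S ∩ A, f v) + (∫ v in S ∩ B, f v) + ∫ v in S ∩ (A ∪ B)ᶜ, f v := by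
  have h1 := integral_inter_add_sdiff hA hf
  have h2 := integral_inter_add_sdiff hB (hf.mono_set (sdiff_subset : S \ A ⊆ S))
  have e1 : (S \ A) ∩ B = S ∩ B := by
    ext v
    have : v ∈ B → v ∉ A := fun hb ha => (Set.disjoint_left.1 hAB ha) hb
    simp only [mem_inter_iff, Set.mem_sdiff]; tauto
  have e2 : (S \ A) \ B = S ∩ (A ∪ B)ᶜ := by
    ext v; simp only [mem_inter_iff, Set.mem_sdiff, mem_compl_iff, mem_union]; tauto
  rw [e1, e2] at h2
  rw [← h1, ← h2]; ring

lemma A0 (ε : ℝ) (hε0 : 0 < ε) (hε1 : ε < 1) : ∃ C : ℝ, 0 < C ∧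
    ∀ (n : ℕ) (g F : ℂ → ℂ) (t d ρ B R K0 K1 : ℝ), Gk n g t d ρ B → 0 < t → t ≤ ρ → t ≤ d → 0 < R → R ≤ d →
      Measurable F → 0 ≤ B → 0 ≤ K1 → ‖F 0‖ ≤ K0 → (∀ v ∈ ball (0:ℂ) R, ‖F v - F 0‖ ≤ K1 * ‖v‖) →
      ‖∫ v in halfp 0 1 ρ ∩ ball 0 R, g v * F v‖ ≤ K0 * (B * t / R) + C * K1 * t ^ ε * R ^ (1 - ε) := by
  obtain ⟨C, hC, h⟩ := in_bd (1 + ε) (by linarith) (by linarith)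
  refine ⟨2 * C, by positivity, fun n g F t d ρ B R K0 K1 hG ht htρ htd hR hRd hF hB hK1 hF0 hF1 => ?_⟩
  have hd : 0 < d := by linarith
  have hρ : 0 < ρ := by linarith
  set S := halfp 0 1 ρ ∩ ball 0 R with hS
  have mS : MeasurableSet S := (halfp_meas _ _ _).inter measurableSet_ball
  have e2 : ∀ v ∈ S, ρ ≤ ‖v‖ := fun v hv => by
    simpa using (halfp_norm 0 1 (by simp) ρ v hv.1).le
  have e3 : ∀ v ∈ S, ‖v‖ < R := fun v hv => by simpa using hv.2
  have g2 : ∀ v ∈ S, ‖g v‖ ≤ 2 * t / ‖v‖ ^ 3 := fun v hv => by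
    have hv0 : 0 < ‖v‖ := by linarith [e2 v hv]
    have hvR := e3 v hv
    refine (hG.bd v (norm_pos_iff.1 hv0)).trans ?_
    have : t / d / ‖v‖ ^ 2 ≤ t / ‖v‖ ^ 3 := by
      rw [div_div]; gcongr
      rw [pow_succ, mul_comm]; gcongr; linarith
    rw [mul_div_assoc]; linarith
  have ig : IntegrableOn g S := (const_bd g hG.meas S mS 0 R (2 * t / ρ ^ 3) hR (by positivity)
    inter_subset_right (fun v hv => (g2 v hv).trans (by gcongr; exact e2 v hv))).1
  have b2 := h (fun v => g v * (F v - F 0)) (hG.meas.mul (hF.sub_const _)) S mS 0 R (2 * K1 * t ^ ε) hR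
    (by positivity) inter_subset_right (fun v hv => by
      have hv0 : 0 < ‖v‖ := by linarith [e2 v hv]
      have q := tpow ε t ‖v‖ hε1 ht (htρ.trans (e2 v hv))
      rw [norm_mul, sub_zero]
      calc ‖g v‖ * ‖F v - F 0‖ ≤ (2 * t / ‖v‖ ^ 3) * (K1 * ‖v‖) := by
            gcongr
            · exact g2 v hv
            · exact hF1 v hv.2
        _ = 2 * K1 * (t / ‖v‖ ^ 2) := by field_simp
        _ = 2 * K1 * ((t * ‖v‖ ^ (ε - 1)) * ‖v‖ ^ (-(1 + ε))) := by
            rw [mul_assoc t, ← Real.rpow_add hv0, show ε - 1 + -(1 + ε) = -(2:ℕ) by norm_num; ring,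
              Real.rpow_neg hv0.le, Real.rpow_natCast]; rfl
        _ ≤ 2 * K1 * (t ^ ε * ‖v‖ ^ (-(1 + ε))) := by gcongr
        _ = _ := by ring)
  have e : ∫ v in S, g v * F v = F 0 * (∫ v in S, g v) + ∫ v in S, g v * (F v - F 0) := by
    rw [← integral_const_mul, ← integral_add (ig.const_mul _) b2.1]
    congr 1; ext v; ring
  rw [e]
  refine (norm_add_le _ _).trans (add_le_add ?_ ?_)
  · rw [norm_mul]
    have := hG.canc1 R hR hRd
    have := (norm_nonneg _).trans hF0
    gcongr
  · refine b2.2.trans (le_of_eq ?_)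
    rw [show 2 - (1 + ε) = 1 - ε by ring]; ring

lemma kap_norm (n : ℕ) (a : ℂ) (ha : ‖a‖ = 1) : ‖(starRingEnd ℂ) a ^ (n-1) / a ^ (n+1)‖ = 1 := by
  rw [norm_div, norm_pow, norm_pow, RCLike.norm_conj, ha]; simp

lemma X_cov (n : ℕ) (g : ℂ → ℂ) (ξ a : ℂ) (ha : ‖a‖ = 1) (ρ R : ℝ) :
    ∫ v in halfp ξ a ρ ∩ ball ξ R, g v * f0 n (v - ξ) =
    ∫ v in {v : ℂ | ρ < v.im} ∩ ball 0 R, ((starRingEnd ℂ) a ^ (n-1) / a ^ (n+1) * g (rig ξ a v)) * f0 n v := by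
  rw [rig_cov ξ a ha]
  have : rig ξ a ⁻¹' (halfp ξ a ρ ∩ ball ξ R) = {v : ℂ | ρ < v.im} ∩ ball 0 R := by
    ext v
    simp only [mem_preimage, mem_inter_iff, halfp, mem_ofPred_eq, rig_inv' ξ a ha, mem_ball, dist_eq_norm, sub_zero]
    rw [show rig ξ a v - ξ = a * v by simp [rig], norm_mul, ha, one_mul]
  rw [this]
  congr 1; ext v
  rw [show rig ξ a v - ξ = a * v by simp [rig], f0_rot]; ring

lemma g12 (n : ℕ) (g : ℂ → ℂ) (t d ρ B : ℝ) (hG : Gk n g t d ρ B) (ht : 0 < t) (hd : 0 < d) (v : ℂ)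
    (hv : d / 2 ≤ ‖v‖) : ‖g v‖ ≤ 12 * t / d ^ 3 := by
  have hv0 : 0 < ‖v‖ := by linarith
  refine (hG.bd v (norm_pos_iff.1 hv0)).trans ?_
  calc _ ≤ t / (d / 2) ^ 3 + t / d / (d / 2) ^ 2 := by gcongr
    _ = _ := by field_simp; norm_num

lemma rig_far (ξ a v : ℂ) (d : ℝ) (ha : ‖a‖ = 1) (hξ : ‖ξ‖ = d) (hv : ‖v‖ < d / 2) : d / 2 ≤ ‖rig ξ a v‖ := by
  have := norm_sub_norm_le ξ (-(a * v))
  rw [norm_neg, norm_mul, ha, one_mul, sub_neg_eq_add, hξ] at this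
  rw [rig]; linarith

lemma rig_diff (ξ a : ℂ) : Differentiable ℂ (rig ξ a) := by
  unfold rig; fun_prop

lemma rig_measurable (ξ a : ℂ) : Measurable (rig ξ a) := (rig_diff ξ a).continuous.measurable

lemma caseC (n : ℕ) (hn : 1 ≤ n) (ε M r D B r1 : ℝ) (hε0 : 0 < ε) (hε1 : ε < 1) (hM : 0 ≤ M) (hr : 0 < r)
    (hD : 0 < D) (hB : 0 ≤ B) (hr1 : 0 < r1) (hr1r : r1 ≤ r) :
    ∃ C : ℝ, 0 < C ∧ ∀ E ξ a ρ ρ' t d g, Cfg n ε M r D B E ξ a ρ ρ' t d g → r1 ≤ d →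
      ‖∫ v in E, g v * f0 n (v - ξ)‖ ≤ C * (t ^ ε / d ^ 2) := by
  obtain ⟨C1, hC1, h1⟩ := N0 n hn ε hε0 hε1
  obtain ⟨C2, hC2, h2⟩ := A0 ε hε0 hε1
  obtain ⟨C3, hC3, h3⟩ := NX n hn ε hε0
  obtain ⟨C4, hC4, h4⟩ := f0_holo n hn
  obtain ⟨C5, hC5, h5⟩ := out_bd 4 (by norm_num)
  obtain ⟨C6, hC6, h6⟩ := f0_lip n hn
  set R := r1 / 8 with hR
  have hR0 : 0 < R := by positivity
  set X := C1 * M + (n * (B * (D ^ (1 - ε) / R)) + C2 * C6 / r1 * R ^ (1 - ε)) + C3 * M + C4 * 12 * r1 ^ (-ε) +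
    n * (D / R + 1) * (1 + D / R) ^ 2 * C5 * R ^ (-2 : ℝ) * D ^ (2 - ε) with hX
  have hX0 : 0 ≤ X := by positivity
  refine ⟨X + 1, by positivity, fun E ξ a ρ ρ' t d g hc hd1 => ?_⟩
  have ht := hc.ht
  have htd := hc.htd
  have htρ := hc.htρ
  have hdD := hc.hdD
  have hξ := hc.hξ
  have hd : 0 < d := by linarith
  have ha := hc.FX.hu
  set Y := t ^ ε / d ^ 2 with hY
  have hY0 : 0 ≤ Y := by positivity
  have x0 := tpow3 ε t d hε1 ht htd
  rw [← hY] at x0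
  have x1 := farD ε t d D hε1 ht htd hdD
  rw [← hY] at x1
  have x2 : t ≤ D ^ (1 - ε) * t ^ ε := by
    have : t ^ (1 - ε) ≤ D ^ (1 - ε) := by gcongr <;> linarith
    calc t = t ^ (1 - ε) * t ^ ε := by rw [← Real.rpow_add ht]; simp
      _ ≤ _ := by gcongr
  have x3 : t / d ^ 3 ≤ r1 ^ (-ε) * Y := by
    have : d ^ (-ε) ≤ r1 ^ (-ε) := Real.rpow_le_rpow_of_nonpos hr1 hd1 (by linarith)
    calc t / d ^ 3 = d ^ (-ε) * (t / d ^ 3 * d ^ ε) := by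
          rw [mul_left_comm, ← Real.rpow_add hd]; simp
      _ ≤ _ := by gcongr
  have iE := G_int n hn g t d ρ ρ' ξ hd ht hξ.le hc.G.meas hc.G.bd hc.F0.pos hc.FX.pos E hc.hE
    (fun v hv => by simpa using hc.F0.emp v hv) (fun v hv => hc.FX.emp v hv)
  have dis : Disjoint (ball (0:ℂ) R) (ball ξ R) := by
    apply ball_disjoint_ball
    rw [dist_comm, dist_zero_right, hξ]; linarith
  rw [split3 _ E _ _ measurableSet_ball measurableSet_ball dis iE]
  have n1 := h1 E M r ρ t d R B g ξ hc.hE hM hc.F0 hc.G hξ ht htρ htd hR0 (by linarith) (by linarith)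
  have n2 := h2 n g (fun v => f0 n (v - ξ)) t d ρ B R (n / d ^ 2) (C6 / d ^ 3) hc.G ht htρ htd hR0 (by linarith)
    ((f0_meas n).comp (measurable_id.sub_const ξ)) hB (by positivity)
    (by rw [f0_norm n hn]; simp [hξ])
    (fun v hv => by
      have hv : ‖v‖ < R := by simpa using hv
      have := h6 (-ξ) v (by rw [norm_neg, hξ]; linarith)
      rw [norm_neg, hξ, neg_add_eq_sub] at this
      rw [zero_sub]
      refine this.trans (le_of_eq (by ring)))
  have n3 := h3 E M r ρ ρ' t d R B g ξ a hc.hE hM hc.FX hc.G hξ ht hd hR0 (by linarith) (by linarith)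
  have n4 := h4 ρ' R (12 * t / d ^ 3) (fun v => (starRingEnd ℂ) a ^ (n-1) / a ^ (n+1) * g (rig ξ a v)) hc.FX.pos hR0
    (by positivity) (measurable_const.mul (hc.G.meas.comp (rig_measurable ξ a)))
    (fun v hv => by
      have hv : ‖v‖ < 2 * R := by simpa using hv
      have := rig_far ξ a v d ha hξ (by linarith)
      refine DifferentiableAt.differentiableWithinAt ?_
      exact ((hc.G.diff _ (norm_pos_iff.1 (by linarith))).comp v (rig_diff ξ a v)).const_mul _)
    (fun v hv => by
      have hv : ‖v‖ < 2 * R := by simpa using hv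
      have := rig_far ξ a v d ha hξ (by linarith)
      rw [norm_mul, kap_norm n a ha, one_mul]
      exact g12 n g t d ρ B hc.G ht hd _ this)
  rw [← X_cov n g ξ a ha] at n4
  have n5 := (h5 _ (G_meas n g hc.G.meas ξ) (E ∩ (ball 0 R ∪ ball ξ R)ᶜ)
    (hc.hE.inter (measurableSet_ball.union measurableSet_ball).compl) 0 R
    (n * (t / R + t / d) * (1 + d / R) ^ 2) hR0 (by positivity) (fun v hv => fun h => hv.2 (Or.inl h))
    (fun v hv => by
      have k1 : R ≤ ‖v‖ := by
        have : v ∉ ball (0:ℂ) R := fun h => hv.2 (Or.inl h)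
        simpa using this
      have k2 : R ≤ ‖v - ξ‖ := by
        have : v ∉ ball ξ R := fun h => hv.2 (Or.inr h)
        simpa [dist_eq_norm] using this
      rw [sub_zero]
      exact G_pt n hn g t d R R ξ v hd ht hξ.le (hc.G.bd v (norm_pos_iff.1 (by linarith))) hR0 hR0 k1 k2)).2
  -- final bounds
  have m2 : n / d ^ 2 * (B * t / R) + C2 * (C6 / d ^ 3) * t ^ ε * R ^ (1 - ε) ≤
      (n * (B * (D ^ (1 - ε) / R)) + C2 * C6 / r1 * R ^ (1 - ε)) * Y := by
    have : (1:ℝ) / d ≤ 1 / r1 := by gcongr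
    calc _ = n / d ^ 2 * (B * t / R) + C2 * C6 * (1 / d) * R ^ (1 - ε) * Y := by
          rw [hY]; field_simp
      _ ≤ n / d ^ 2 * (B * (D ^ (1 - ε) * t ^ ε) / R) + C2 * C6 * (1 / r1) * R ^ (1 - ε) * Y := by gcongr
      _ = _ := by rw [hY]; field_simp
  have m3 : C3 * M * (t / d ^ 3 * R ^ ε) ≤ C3 * M * Y := by
    have : R ^ ε ≤ d ^ ε := by gcongr; linarith
    have : t / d ^ 3 * R ^ ε ≤ Y := le_trans (by gcongr) x0
    gcongr
  have m4 : C4 * (12 * t / d ^ 3) ≤ C4 * 12 * r1 ^ (-ε) * Y := by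
    calc _ = C4 * 12 * (t / d ^ 3) := by ring
      _ ≤ C4 * 12 * (r1 ^ (-ε) * Y) := by gcongr
      _ = _ := by ring
  have m5 : n * (t / R + t / d) * (1 + d / R) ^ 2 * (C5 * R ^ ((2:ℝ) - 4)) ≤
      n * (D / R + 1) * (1 + D / R) ^ 2 * C5 * R ^ (-2 : ℝ) * D ^ (2 - ε) * Y := by
    rw [show (2:ℝ) - 4 = -2 by norm_num]
    calc _ = n * (d / R + 1) * (1 + d / R) ^ 2 * C5 * R ^ (-2 : ℝ) * (t / d) := by field_simp
      _ ≤ n * (D / R + 1) * (1 + D / R) ^ 2 * C5 * R ^ (-2 : ℝ) * (D ^ (2 - ε) * Y) := by gcongr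
      _ = _ := by ring
  set IA := ∫ v in E ∩ ball 0 R, g v * f0 n (v - ξ)
  set HA := ∫ v in halfp 0 1 ρ ∩ ball 0 R, g v * f0 n (v - ξ)
  set IB := ∫ v in E ∩ ball ξ R, g v * f0 n (v - ξ)
  set HB := ∫ v in halfp ξ a ρ' ∩ ball ξ R, g v * f0 n (v - ξ)
  set IF := ∫ v in E ∩ (ball 0 R ∪ ball ξ R)ᶜ, g v * f0 n (v - ξ)
  calc ‖IA + IB + IF‖ = ‖(IA - HA) + HA + (IB - HB) + HB + IF‖ := by congr 1; ring
    _ ≤ ‖IA - HA‖ + ‖HA‖ + ‖IB - HB‖ + ‖HB‖ + ‖IF‖ := by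
        refine (norm_add_le _ _).trans (add_le_add_left ?_ _)
        refine (norm_add_le _ _).trans (add_le_add_left ?_ _)
        refine (norm_add_le _ _).trans (add_le_add_left ?_ _)
        exact norm_add_le _ _
    _ ≤ X * Y := by
        rw [hX, add_mul, add_mul, add_mul, add_mul]
        exact add_le_add (add_le_add (add_le_add (add_le_add n1 (n2.trans m2)) (n3.trans m3)) (n4.trans m4)) (n5.trans m5)
    _ ≤ _ := by gcongr; linarith

lemma powNd (ε d : ℝ) (hd : 0 < d) : d ^ (1 + ε) = d * d ^ ε := by
  rw [Real.rpow_add hd, Real.rpow_one]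

lemma S1 (n : ℕ) (hn : 1 ≤ n) (ε : ℝ) (hε0 : 0 < ε) (hε1 : ε < 1) : ∃ C : ℝ, 0 < C ∧
    ∀ (g : ℂ → ℂ) (ξ ξ' : ℂ) (t d ρ B N : ℝ), Gk n g t d ρ B → 0 < t → t ≤ ρ → t ≤ d → 0 ≤ B → 0 ≤ N → ‖ξ‖ = d →
      ‖ξ - ξ'‖ ≤ d / 16 → ‖ξ - ξ'‖ ≤ N * d ^ (1 + ε) →
      ‖∫ v in halfp 0 1 ρ ∩ ball 0 (d / 8), g v * (f0 n (v - ξ) - f0 n (v - ξ'))‖ ≤ C * (B + 1) * N * (t ^ ε / d ^ 2) := by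
  obtain ⟨C, hC, h⟩ := A0 ε hε0 hε1
  obtain ⟨C1, hC1, h1⟩ := f0_lip n hn
  obtain ⟨C2, hC2, h2⟩ := f0_lip2 n hn
  refine ⟨8 * C1 + C * C2, by positivity, fun g ξ ξ' t d ρ B N hG ht htρ htd hB hN hξ hη hηN => ?_⟩
  have hd : 0 < d := by linarith
  set η := ‖ξ - ξ'‖ with hηd
  have hη0 : 0 ≤ η := norm_nonneg _
  have key := h n g (fun v => f0 n (v - ξ) - f0 n (v - ξ')) t d ρ B (d / 8) (C1 * η / d ^ 3) (C2 * η / d ^ 4) hG ht htρ htd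
    (by positivity) (by linarith) (((f0_meas n).comp (measurable_id.sub_const ξ)).sub ((f0_meas n).comp (measurable_id.sub_const ξ')))
    hB (by positivity)
    (by
      have := h1 (-ξ) (ξ - ξ') (by rw [norm_neg, hξ]; linarith)
      rw [norm_neg, hξ, ← hηd, norm_sub_rev, show -ξ + (ξ - ξ') = -ξ' by ring] at this
      simpa using this)
    (fun v hv => by
      have hv : ‖v‖ < d / 8 := by simpa using hv
      have := h2 (-ξ) (ξ - ξ') v (by rw [norm_neg, hξ]; linarith) (by rw [norm_neg, hξ]; linarith)
      rw [norm_neg, hξ, ← hηd] at this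
      rw [show -ξ + v + (ξ - ξ') = v - ξ' by ring, show -ξ + v = v - ξ by ring,
        show -ξ + (ξ - ξ') = 0 - ξ' by ring, ← zero_sub ξ, ← norm_neg] at this
      refine le_trans (le_of_eq ?_) (this.trans (le_of_eq (by ring)))
      congr 1; ring)
  refine key.trans ?_
  have x0 := tpow3 ε t d hε1 ht htd
  set Y := t ^ ε / d ^ 2 with hY
  have hY0 : 0 ≤ Y := by positivity
  rw [powNd ε d hd] at hηN
  have a1 : C1 * η / d ^ 3 * (B * t / (d / 8)) ≤ 8 * C1 * B * N * Y := by
    calc C1 * η / d ^ 3 * (B * t / (d / 8)) = 8 * C1 * B * (η / d * (t / d ^ 3)) := by field_simp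
      _ ≤ 8 * C1 * B * ((N * (d * d ^ ε)) / d * (t / d ^ 3)) := by gcongr
      _ = 8 * C1 * B * N * (t / d ^ 3 * d ^ ε) := by field_simp
      _ ≤ _ := by gcongr
  have a2 : C * (C2 * η / d ^ 4) * t ^ ε * (d / 8) ^ (1 - ε) ≤ C * C2 * N * Y := by
    have q : (d / 8) ^ (1 - ε) ≤ d ^ (1 - ε) := by gcongr <;> linarith
    have q2 : d ^ ε * d ^ (1 - ε) = d := by rw [← Real.rpow_add hd]; simp
    calc C * (C2 * η / d ^ 4) * t ^ ε * (d / 8) ^ (1 - ε) ≤ C * (C2 * (N * (d * d ^ ε)) / d ^ 4) * t ^ ε * d ^ (1 - ε) := by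
          gcongr
      _ = C * C2 * N * d / d ^ 4 * t ^ ε * (d ^ ε * d ^ (1 - ε)) := by ring
      _ = C * C2 * N * Y := by rw [q2, hY]; field_simp
  have a3 : 0 ≤ C1 * N * Y := by positivity
  have a4 : 0 ≤ C * C2 * B * N * Y := by positivity
  calc _ ≤ 8 * C1 * B * N * Y + C * C2 * N * Y := add_le_add a1 a2
    _ ≤ _ := by linarith

lemma kap_sub (n : ℕ) (hn : 1 ≤ n) : ∃ C : ℝ, 0 < C ∧ ∀ a : ℂ, ‖a - 1‖ ≤ 1 / 2 →
    ‖(starRingEnd ℂ) a ^ (n-1) / a ^ (n+1) - 1‖ ≤ C * ‖a - 1‖ := by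
  obtain ⟨C1, hC1, h1⟩ := f0_lip n hn
  refine ⟨C1, hC1, fun a ha => ?_⟩
  have := h1 1 (a - 1) (by simpa using ha)
  have e1 : f0 n 1 = n := by simp [f0]
  have e2 := f0_rot n a 1
  rw [mul_one, e1] at e2
  rw [add_sub_cancel, e2, e1, ← sub_one_mul, norm_mul, norm_one, one_pow, div_one] at this
  refine le_trans ?_ this
  have : (1:ℝ) ≤ ‖(n:ℂ)‖ := by simpa using hn
  exact le_mul_of_one_le_right (norm_nonneg _) this

lemma g_lip (n : ℕ) (g : ℂ → ℂ) (t d ρ B : ℝ) (hG : Gk n g t d ρ B) (ht : 0 < t) (hd : 0 < d) (p q : ℂ)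
    (hp : 3 * d / 4 ≤ ‖p‖) (hq : ‖p - q‖ < d / 4) : ‖g p - g q‖ ≤ 96 * t / d ^ 4 * ‖p - q‖ := by
  have far : ∀ v ∈ ball p (d / 4), d / 2 ≤ ‖v‖ := fun v hv => by
    rw [mem_ball, dist_eq_norm] at hv
    have := norm_sub_norm_le p v
    rw [norm_sub_rev] at this; linarith
  have hp0 : p ∈ ball p (d / 4) := mem_ball_self (by positivity)
  have := Complex.dist_le_div_mul_dist_of_mapsTo_ball (f := g) (c := p) (R₁ := d / 4) (R₂ := 24 * t / d ^ 3) (z := q)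
    (fun v hv => (hG.diff v (norm_pos_iff.1 (by linarith [far v hv]))).differentiableWithinAt)
    (fun v hv => by
      rw [mem_closedBall, dist_eq_norm]
      refine (norm_sub_le _ _).trans ?_
      have a1 := g12 n g t d ρ B hG ht hd v (far v hv)
      have a2 := g12 n g t d ρ B hG ht hd p (far p hp0)
      calc _ ≤ _ := add_le_add a1 a2
        _ = _ := by ring) (by rw [mem_ball, dist_eq_norm, norm_sub_rev]; exact hq)
  rw [dist_eq_norm, dist_eq_norm, norm_sub_rev, norm_sub_rev q] at this
  refine this.trans (le_of_eq ?_)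
  field_simp; ring

lemma S2 (n : ℕ) (hn : 1 ≤ n) (ε : ℝ) (hε1 : ε < 1) : ∃ C : ℝ, 0 < C ∧
    ∀ (g : ℂ → ℂ) (ξ ξ' a : ℂ) (t d ρ ρ' B N : ℝ), Gk n g t d ρ B → 0 < t → 0 < ρ' → t ≤ d → 0 ≤ N → ‖ξ‖ = d →
      ‖a‖ = 1 → ‖a - 1‖ ≤ 1 / 8 → ‖a - 1‖ ≤ N * d ^ ε → ξ'.im = ρ - ρ' →
      ‖ξ - ξ'‖ ≤ d / 16 → ‖ξ - ξ'‖ ≤ N * d ^ (1 + ε) →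
      ‖(∫ v in halfp ξ a ρ' ∩ ball ξ (d / 8), g v * f0 n (v - ξ)) -
        ∫ v in halfp 0 1 ρ ∩ ball ξ' (d / 8), g v * f0 n (v - ξ')‖ ≤ C * N * (t ^ ε / d ^ 2) := by
  obtain ⟨C, hC, h⟩ := f0_holo n hn
  obtain ⟨C1, hC1, h1⟩ := kap_sub n hn
  refine ⟨C * (12 * C1 + 192), by positivity, fun g ξ ξ' a t d ρ ρ' B N hG ht hρ' htd hN hξ ha ha1 haN him hη hηN => ?_⟩
  have hd : 0 < d := by linarith
  have x0 := tpow3 ε t d hε1 ht htd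
  set Y := t ^ ε / d ^ 2 with hY
  rw [powNd ε d hd] at hηN
  have hh : halfp 0 1 ρ = halfp ξ' 1 ρ' := by
    ext v
    simp only [halfp, mem_ofPred_eq, map_one, one_mul, sub_zero, sub_im, him]
    constructor <;> intro h <;> linarith
  rw [hh, X_cov n g ξ a ha, X_cov n g ξ' 1 (by simp)]
  set κ := (starRingEnd ℂ) a ^ (n-1) / a ^ (n+1) with hκ
  simp only [map_one, one_pow, div_one, one_mul]
  set S := {v : ℂ | ρ' < v.im} ∩ ball 0 (d / 8) with hS
  have mS : MeasurableSet S := (hp_meas ρ').inter measurableSet_ball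
  have nξ : ∀ v : ℂ, ‖v‖ < 2 * (d / 8) → 3 * d / 4 ≤ ‖rig ξ a v‖ := fun v hv => by
    have := norm_sub_norm_le ξ (-(a * v))
    rw [norm_neg, norm_mul, ha, one_mul, sub_neg_eq_add, hξ] at this
    rw [rig]; linarith
  have pq : ∀ v : ℂ, ‖v‖ < 2 * (d / 8) → ‖rig ξ a v - rig ξ' 1 v‖ ≤ ‖ξ - ξ'‖ + ‖a - 1‖ * (d / 4) := fun v hv => by
    rw [show rig ξ a v - rig ξ' 1 v = (ξ - ξ') + (a - 1) * v by simp [rig]; ring]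
    refine (norm_add_le _ _).trans ?_
    rw [norm_mul]
    gcongr; linarith
  have pq2 : ∀ v : ℂ, ‖v‖ < 2 * (d / 8) → ‖rig ξ a v - rig ξ' 1 v‖ < d / 4 := fun v hv => by
    have : ‖a - 1‖ * (d / 4) ≤ 1/8 * (d / 4) := by gcongr
    linarith [pq v hv]
  have nξ' : ∀ v : ℂ, ‖v‖ < 2 * (d / 8) → d / 2 ≤ ‖rig ξ' 1 v‖ := fun v hv => by
    have := norm_sub_norm_le (rig ξ a v) (rig ξ' 1 v)
    linarith [pq2 v hv, nξ v hv]
  have gen : ∀ (k : ℂ → ℂ) (K : ℝ), Measurable k → 0 ≤ K → (∀ v ∈ S, ‖k v‖ ≤ K) → IntegrableOn (fun v => k v * f0 n v) S := by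
    intro k K hk hK hkb
    refine (const_bd (fun v => k v * f0 n v) (hk.mul (f0_meas n)) S mS 0 (d / 8) (K * (n / ρ' ^ 2)) (by positivity) (by positivity)
      inter_subset_right (fun v hv => ?_)).1
    rw [norm_mul, f0_norm n hn]
    have : ρ' ≤ ‖v‖ := (le_of_lt hv.1).trans ((le_abs_self _).trans (Complex.abs_im_le_norm v))
    gcongr
    exact hkb v hv
  have mem : ∀ v ∈ S, ‖v‖ < 2 * (d / 8) := fun v hv => by
    have : ‖v‖ < d / 8 := by simpa using hv.2
    linarith
  have mk1 : Measurable fun v => κ * g (rig ξ a v) := measurable_const.mul (hG.meas.comp (rig_measurable ξ a))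
  have mk2 : Measurable fun v => g (rig ξ' 1 v) := hG.meas.comp (rig_measurable ξ' 1)
  have i1 := gen (fun v => κ * g (rig ξ a v)) (12 * t / d ^ 3) mk1 (by positivity) (fun v hv => by
    rw [norm_mul, kap_norm n a ha, one_mul]
    exact g12 n g t d ρ B hG ht hd _ (by linarith [nξ v (mem v hv)]))
  have i2 := gen (fun v => g (rig ξ' 1 v)) (12 * t / d ^ 3) mk2 (by positivity) (fun v hv =>
    g12 n g t d ρ B hG ht hd _ (by linarith [nξ' v (mem v hv)]))
  rw [← integral_sub i1 i2]
  simp only [← sub_mul]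
  have := h ρ' (d / 8) ((12 * C1 + 192) * N * Y) (fun v => κ * g (rig ξ a v) - g (rig ξ' 1 v)) hρ' (by positivity)
    (by positivity) (mk1.sub mk2)
    (fun v hv => by
      have hv : ‖v‖ < 2 * (d / 8) := by simpa using hv
      have q1 := nξ v hv
      have q2 := nξ' v hv
      refine DifferentiableAt.differentiableWithinAt ?_
      refine DifferentiableAt.sub ?_ ?_
      · exact ((hG.diff _ (norm_pos_iff.1 (by linarith))).comp v (rig_diff ξ a v)).const_mul _
      · exact ((hG.diff _ (norm_pos_iff.1 (by linarith))).comp v (rig_diff ξ' 1 v)))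
    (fun v hv => by
      have hv : ‖v‖ < 2 * (d / 8) := by simpa using hv
      have q1 := nξ v hv
      have b1 := g12 n g t d ρ B hG ht hd (rig ξ a v) (by linarith)
      have b2 := g_lip n g t d ρ B hG ht hd _ _ q1 (pq2 v hv)
      have b3 := h1 a (by linarith)
      rw [← hκ] at b3
      rw [show κ * g (rig ξ a v) - g (rig ξ' 1 v) = (κ - 1) * g (rig ξ a v) + (g (rig ξ a v) - g (rig ξ' 1 v)) by ring]
      refine (norm_add_le _ _).trans ?_
      rw [norm_mul]
      have b4 : ‖rig ξ a v - rig ξ' 1 v‖ ≤ N * (d * d ^ ε) + N * d ^ ε * (d / 4) := by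
        refine (pq v hv).trans ?_
        gcongr
      have hz : 0 ≤ N * (t / d ^ 3 * d ^ ε) := by positivity
      calc _ ≤ (C1 * (N * d ^ ε)) * (12 * t / d ^ 3) + 96 * t / d ^ 4 * (N * (d * d ^ ε) + N * d ^ ε * (d / 4)) := by
            gcongr
            · exact b3.trans (by gcongr)
            · exact b2.trans (by gcongr)
        _ = (12 * C1 + 120) * (N * (t / d ^ 3 * d ^ ε)) := by field_simp; ring
        _ ≤ (12 * C1 + 192) * (N * (t / d ^ 3 * d ^ ε)) := by gcongr; norm_num
        _ ≤ (12 * C1 + 192) * (N * Y) := by gcongr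
        _ = _ := by ring)
  refine this.trans (le_of_eq (by ring))

lemma vol_real_ball (c : ℂ) (R : ℝ) (hR : 0 ≤ R) : volume.real (ball c R) = Real.pi * R ^ 2 := by
  rw [Measure.real, Complex.volume_ball, ENNReal.toReal_mul, ENNReal.toReal_pow, ENNReal.toReal_ofReal hR]
  simp [mul_comm]

lemma ann (f : ℂ → ℂ) (S : Set ℂ) (c : ℂ) (R η K : ℝ) (hη : 0 ≤ η) (hηR : η ≤ R) (hK : 0 ≤ K)
    (hS : S ⊆ ball c R \ ball c (R - η)) (hf : ∀ v ∈ S, ‖f v‖ ≤ K) : ‖∫ v in S, f v‖ ≤ K * (2 * Real.pi * R * η) := by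
  have fin : volume (ball c R) < ⊤ := measure_ball_lt_top
  have h1 : volume S < ⊤ := (measure_mono (hS.trans sdiff_subset)).trans_lt fin
  refine (norm_setIntegral_le_of_norm_le_const h1 hf).trans ?_
  have h2 : volume.real S ≤ volume.real (ball c R \ ball c (R - η)) :=
    measureReal_mono hS ((measure_mono sdiff_subset).trans_lt fin).ne
  have h3 : volume.real (ball c R \ ball c (R - η)) = volume.real (ball c R) - volume.real (ball c (R - η)) :=
    measureReal_sdiff (ball_subset_ball (by linarith)) measurableSet_ball
  rw [h3, vol_real_ball c R (by linarith), vol_real_ball c _ (by linarith)] at h2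
  gcongr
  nlinarith [Real.pi_pos, sq_nonneg η, mul_nonneg Real.pi_pos.le (sq_nonneg η)]

lemma S3 (n : ℕ) (hn : 1 ≤ n) (ε : ℝ) (hε1 : ε < 1) : ∃ C : ℝ, 0 < C ∧
    ∀ (g : ℂ → ℂ) (ξ ξ' : ℂ) (H : Set ℂ) (t d ρ B N : ℝ), Gk n g t d ρ B → MeasurableSet H → 0 < t → t ≤ d →
      0 ≤ N → ‖ξ‖ = d → ‖ξ - ξ'‖ ≤ d / 16 → ‖ξ - ξ'‖ ≤ N * d ^ (1 + ε) →
      ‖(∫ v in H ∩ (ball 0 (d / 8) ∪ ball ξ (d / 8))ᶜ, g v * f0 n (v - ξ)) -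
        ∫ v in H ∩ (ball 0 (d / 8) ∪ ball ξ' (d / 8))ᶜ, g v * f0 n (v - ξ')‖ ≤ C * N * (t ^ ε / d ^ 2) := by
  obtain ⟨C5, hC5, h5⟩ := out_bd 5 (by norm_num)
  obtain ⟨C6, hC6, h6⟩ := f0_lip n hn
  refine ⟨C5 * (9 * 729 * C6 * 512) + 2 * (192 * n * Real.pi), by positivity,
    fun g ξ ξ' H t d ρ B N hG hH ht htd hN hξ hη hηN => ?_⟩
  have hd : 0 < d := by linarith
  have x0 := tpow3 ε t d hε1 ht htd
  set Y := t ^ ε / d ^ 2 with hY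
  rw [powNd ε d hd] at hηN
  set η := ‖ξ - ξ'‖ with hηd
  have hη0 : 0 ≤ η := norm_nonneg _
  set R := d / 8 with hR
  have hR0 : 0 < R := by positivity
  have mA : MeasurableSet (ball (0:ℂ) R) := measurableSet_ball
  have mF : ∀ x : ℂ, MeasurableSet ((ball 0 R ∪ ball x R)ᶜ) := fun x => (mA.union measurableSet_ball).compl
  have nA : ∀ x v : ℂ, v ∈ (ball 0 R ∪ ball x R)ᶜ → R ≤ ‖v‖ ∧ R ≤ ‖v - x‖ := by
    intro x v hv
    have h1 : v ∉ ball (0:ℂ) R := fun h => hv (Or.inl h)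
    have h2 : v ∉ ball x R := fun h => hv (Or.inr h)
    exact ⟨by simpa using h1, by simpa [dist_eq_norm] using h2⟩
  have hξ' : ‖ξ'‖ ≤ 2 * d ∧ 15 * d / 16 ≤ ‖ξ'‖ := by
    have h1 := norm_sub_norm_le ξ' ξ
    have h2 := norm_sub_norm_le ξ ξ'
    rw [norm_sub_rev, ← hηd] at h1
    constructor <;> linarith
  have bd' : ∀ v, v ≠ 0 → ‖g v‖ ≤ (2 * t) / ‖v‖ ^ 3 + (2 * t) / (2 * d) / ‖v‖ ^ 2 := fun v hv => by
    refine (hG.bd v hv).trans ?_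
    rw [mul_div_mul_left _ _ two_ne_zero]
    gcongr; linarith
  have iG : IntegrableOn (fun v => g v * f0 n (v - ξ)) (H ∩ (ball 0 R ∪ ball ξ R)ᶜ) :=
    G_int n hn g t d R R ξ hd ht hξ.le hG.meas hG.bd hR0 hR0 _ (hH.inter (mF ξ))
      (fun v hv => (nA ξ v hv.2).1) (fun v hv => (nA ξ v hv.2).2)
  have iG' : IntegrableOn (fun v => g v * f0 n (v - ξ')) (H ∩ (ball 0 R ∪ ball ξ' R)ᶜ) :=
    G_int n hn g (2 * t) (2 * d) R R ξ' (by positivity) (by positivity) hξ'.1 hG.meas bd' hR0 hR0 _ (hH.inter (mF ξ'))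
      (fun v hv => (nA ξ' v hv.2).1) (fun v hv => (nA ξ' v hv.2).2)
  set W := H ∩ (ball 0 R ∪ ball ξ R)ᶜ with hW
  set W' := H ∩ (ball 0 R ∪ ball ξ' R)ᶜ with hW'
  have mW : MeasurableSet W := hH.inter (mF ξ)
  have mW' : MeasurableSet W' := hH.inter (mF ξ')
  have s1 := integral_inter_add_sdiff mW' iG
  have s2 := integral_inter_add_sdiff mW iG'
  rw [inter_comm] at s2
  have j1 := iG.mono_set (inter_subset_left : W ∩ W' ⊆ W)
  have j2 := iG'.mono_set (inter_subset_right : W ∩ W' ⊆ W')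
  have s3 := integral_sub j1 j2
  have n1 := (h5 (fun v => g v * f0 n (v - ξ) - g v * f0 n (v - ξ')) ((G_meas n g hG.meas ξ).sub (G_meas n g hG.meas ξ'))
    (W ∩ W') (mW.inter mW') 0 R (9 * 729 * C6 * (t / d * η)) hR0 (by positivity) (fun v hv h => hv.1.2 (Or.inl h))
    (fun v hv => by
      obtain ⟨k1, k2⟩ := nA ξ v hv.1.2
      have hv0 : 0 < ‖v‖ := by linarith
      have hx0 : 0 < ‖v - ξ‖ := by linarith
      have q1 := h6 (v - ξ) (ξ - ξ') (by rw [← hηd]; linarith)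
      rw [sub_add_sub_cancel, ← hηd, norm_sub_rev] at q1
      have q2 : ‖v‖ ≤ 9 * ‖v - ξ‖ := by
        have a := norm_add_le (v - ξ) ξ
        rw [sub_add_cancel, hξ] at a
        linarith
      have q3 : C6 * η / ‖v - ξ‖ ^ 3 ≤ 729 * C6 * η / ‖v‖ ^ 3 := by
        rw [div_le_div_iff₀ (by positivity) (by positivity)]
        calc C6 * η * ‖v‖ ^ 3 ≤ C6 * η * (9 * ‖v - ξ‖) ^ 3 := by gcongr
          _ = _ := by ring
      have q4 : ‖g v‖ ≤ 9 * (t / d) / ‖v‖ ^ 2 := by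
        refine (hG.bd v (norm_pos_iff.1 hv0)).trans ?_
        have : t / ‖v‖ ^ 3 ≤ 8 * (t / d) / ‖v‖ ^ 2 := by
          have : t / ‖v‖ ≤ t / R := by gcongr
          calc t / ‖v‖ ^ 3 = (t / ‖v‖) / ‖v‖ ^ 2 := by field_simp
            _ ≤ (t / R) / ‖v‖ ^ 2 := by gcongr
            _ = _ := by rw [hR]; field_simp
        calc _ ≤ 8 * (t / d) / ‖v‖ ^ 2 + t / d / ‖v‖ ^ 2 := by gcongr
          _ = _ := by ring
      rw [← mul_sub, norm_mul, sub_zero, Real.rpow_neg hv0.le, show (5:ℝ) = (5:ℕ) by norm_num, Real.rpow_natCast]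
      calc _ ≤ (9 * (t / d) / ‖v‖ ^ 2) * (729 * C6 * η / ‖v‖ ^ 3) := by
            gcongr; exact q1.trans q3
        _ = _ := by field_simp)).2
  have pt : ∀ x v : ℂ, d / 2 ≤ ‖v‖ → R ≤ ‖v - x‖ → ‖g v * f0 n (v - x)‖ ≤ 768 * n * (t / d ^ 5) := by
    intro x v h1 h2
    rw [norm_mul, f0_norm n hn]
    calc _ ≤ (12 * t / d ^ 3) * (n / R ^ 2) := by
          gcongr
          exact g12 n g t d ρ B hG ht hd v h1
      _ = _ := by rw [hR]; field_simp; norm_num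
  have n2 := ann (fun v => g v * f0 n (v - ξ)) (W \ W') ξ' R η (768 * n * (t / d ^ 5)) hη0 (by linarith) (by positivity)
    (fun v hv => by
      obtain ⟨k1, k2⟩ := nA ξ v hv.1.2
      have : v ∈ ball ξ' R := by
        by_contra hcon
        refine hv.2 ⟨hv.1.1, ?_⟩
        rintro (h | h)
        · exact hv.1.2 (Or.inl h)
        · exact hcon h
      refine ⟨this, ?_⟩
      rw [mem_ball, dist_eq_norm, not_lt]
      have := norm_sub_le (v - ξ') (ξ - ξ')
      rw [sub_sub_sub_cancel_right, ← hηd] at this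
      linarith)
    (fun v hv => by
      obtain ⟨k1, k2⟩ := nA ξ v hv.1.2
      have : v ∈ ball ξ' R := by
        by_contra hcon
        refine hv.2 ⟨hv.1.1, ?_⟩
        rintro (h | h)
        · exact hv.1.2 (Or.inl h)
        · exact hcon h
      rw [mem_ball, dist_eq_norm] at this
      have h3 := norm_sub_norm_le ξ' v
      rw [norm_sub_rev] at h3
      exact pt ξ v (by linarith [hξ'.2]) k2)
  have n3 := ann (fun v => g v * f0 n (v - ξ')) (W' \ W) ξ R η (768 * n * (t / d ^ 5)) hη0 (by linarith) (by positivity)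
    (fun v hv => by
      obtain ⟨k1, k2⟩ := nA ξ' v hv.1.2
      have : v ∈ ball ξ R := by
        by_contra hcon
        refine hv.2 ⟨hv.1.1, ?_⟩
        rintro (h | h)
        · exact hv.1.2 (Or.inl h)
        · exact hcon h
      refine ⟨this, ?_⟩
      rw [mem_ball, dist_eq_norm, not_lt]
      have := norm_add_le (v - ξ) (ξ - ξ')
      rw [sub_add_sub_cancel, ← hηd] at this
      linarith)
    (fun v hv => by
      obtain ⟨k1, k2⟩ := nA ξ' v hv.1.2
      have : v ∈ ball ξ R := by
        by_contra hcon
        refine hv.2 ⟨hv.1.1, ?_⟩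
        rintro (h | h)
        · exact hv.1.2 (Or.inl h)
        · exact hcon h
      rw [mem_ball, dist_eq_norm] at this
      have h3 := norm_sub_norm_le ξ v
      rw [norm_sub_rev] at h3
      exact pt ξ' v (by linarith) k2)
  have e : (∫ v in W, g v * f0 n (v - ξ)) - ∫ v in W', g v * f0 n (v - ξ') =
      (∫ v in W ∩ W', (g v * f0 n (v - ξ) - g v * f0 n (v - ξ'))) + (∫ v in W \ W', g v * f0 n (v - ξ)) -
      ∫ v in W' \ W, g v * f0 n (v - ξ') := by
    rw [← s1, ← s2, s3]; ring
  rw [e]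
  refine (norm_sub_le _ _).trans ((add_le_add_left (norm_add_le _ _) _).trans ?_)
  have hz : t / d ^ 4 * η ≤ N * Y := by
    calc t / d ^ 4 * η ≤ t / d ^ 4 * (N * (d * d ^ ε)) := by gcongr
      _ = N * (t / d ^ 3 * d ^ ε) := by field_simp
      _ ≤ _ := by gcongr
  have r3 : R ^ ((2:ℝ) - 5) = 512 / d ^ 3 := by
    rw [show (2:ℝ) - 5 = -(3:ℕ) by norm_num, Real.rpow_neg hR0.le, Real.rpow_natCast, hR]; field_simp; norm_num
  rw [r3] at n1
  calc _ ≤ _ := add_le_add (add_le_add n1 n2) n3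
    _ = (C5 * (9 * 729 * C6 * 512) + 2 * (192 * n * Real.pi)) * (t / d ^ 4 * η) := by rw [hR]; field_simp; ring
    _ ≤ (C5 * (9 * 729 * C6 * 512) + 2 * (192 * n * Real.pi)) * (N * Y) := by gcongr
    _ = _ := by ring

lemma caseB (n : ℕ) (hn : 1 ≤ n) (ε M r D B r1 : ℝ) (hε0 : 0 < ε) (hε1 : ε < 1) (hM : 0 ≤ M) (hr : 0 < r)
    (hD : 0 < D) (hB : 0 ≤ B) (hr1r : 10 * r1 < r) (hr1 : ∀ d, 0 < d → d ≤ r1 → 40000 * M * d ^ ε ≤ 1) :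
    ∃ C : ℝ, 0 < C ∧ ∀ E ξ a ρ ρ' t d g, Cfg n ε M r D B E ξ a ρ ρ' t d g → d ≤ r1 → ρ < 2 * d →
      ‖∫ v in E, g v * f0 n (v - ξ)‖ ≤ C * (t ^ ε / d ^ 2) := by
  obtain ⟨C1, hC1, h1⟩ := N0 n hn ε hε0 hε1
  obtain ⟨C2, hC2, h2⟩ := NX n hn ε hε0
  obtain ⟨C3, hC3, h3⟩ := FAR n hn ε hε0 hε1
  obtain ⟨C4, hC4, h4⟩ := S1 n hn ε hε0 hε1
  obtain ⟨C5, hC5, h5⟩ := S2 n hn ε hε1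
  obtain ⟨C6, hC6, h6⟩ := S3 n hn ε hε1
  set N := 1200 * M with hN
  have hN0 : 0 ≤ N := by positivity
  set X := C1 * M + C4 * (B + 1) * N + C2 * M + C5 * N + C3 * (n * 729 * (M * 8 ^ (2 - ε) + D ^ (2 - ε) * r ^ (-2 : ℝ))) + C6 * N with hX
  have hX0 : 0 ≤ X := by positivity
  refine ⟨X + 1, by positivity, fun E ξ a ρ ρ' t d g hc hd1 hρd => ?_⟩
  have ht := hc.ht
  have htd := hc.htd
  have htρ := hc.htρ
  have hdD := hc.hdD
  have hξ := hc.hξ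
  have hd : 0 < d := by linarith
  have ha := hc.FX.hu
  have hρ' : ρ' < 3 * d := by
    have := (abs_le.1 hc.hρρ').1; linarith
  have hdε := hr1 d hd hd1
  set τ := M * (10 * d) ^ (1 + ε) with hτ
  have hτN : τ ≤ 100 * M * (d * d ^ ε) := by
    rw [hτ, Real.mul_rpow (by norm_num) hd.le, powNd ε d hd]
    have : (10:ℝ) ^ (1 + ε) ≤ 10 ^ (2:ℝ) := Real.rpow_le_rpow_of_exponent_le (by norm_num) (by linarith)
    have e : (10:ℝ) ^ (2:ℝ) = 100 := by norm_num
    rw [e] at this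
    calc _ ≤ M * (100 * (d * d ^ ε)) := by gcongr
      _ = _ := by ring
  have hτd : 400 * τ ≤ d := by
    calc 400 * τ ≤ (40000 * M * d ^ ε) * d := by linarith
      _ ≤ 1 * d := by gcongr
      _ = d := one_mul d
  have hτ0 : 0 ≤ τ := by positivity
  obtain ⟨ca, ci⟩ := consist E ε M r d τ ρ ρ' ξ a hε0 hM hc.F0 hc.FX hd hξ.le hρd hρ' (by linarith) hτ (by linarith)
  set ξ' : ℂ := ξ + ((ρ - ρ' - ξ.im : ℝ) : ℂ) * I with hξ'
  have him : ξ'.im = ρ - ρ' := by simp [hξ']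
  have hη : ‖ξ - ξ'‖ ≤ 12 * τ := by
    rw [hξ', sub_add_cancel_left, norm_neg, norm_mul, norm_I, mul_one, Complex.norm_real, Real.norm_eq_abs, abs_sub_comm]
    exact ci
  have hη1 : ‖ξ - ξ'‖ ≤ d / 16 := by linarith
  have hηN : ‖ξ - ξ'‖ ≤ N * d ^ (1 + ε) := by rw [powNd ε d hd, hN]; linarith
  have ha1 : ‖a - 1‖ ≤ 1 / 8 := by
    refine ca.trans ?_
    rw [div_le_iff₀ hd]; linarith
  have haN : ‖a - 1‖ ≤ N * d ^ ε := by
    refine ca.trans ?_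
    rw [div_le_iff₀ hd, hN]
    have : 0 ≤ M * (d * d ^ ε) := by positivity
    linarith
  have x0 := tpow3 ε t d hε1 ht htd
  have x1 := farD ε t d D hε1 ht htd hdD
  have x2 := farE ε t d hε1 ht htd
  have n1 := h1 E M r ρ t d (d / 8) B g ξ hc.hE hM hc.F0 hc.G hξ ht htρ htd (by positivity) (by linarith) (by linarith)
  have n2 := h2 E M r ρ ρ' t d (d / 8) B g ξ a hc.hE hM hc.FX hc.G hξ ht hd (by positivity) (by linarith) (by linarith)
  have nA : ∀ x v : ℂ, v ∈ (ball 0 (d / 8) ∪ ball x (d / 8))ᶜ → d / 8 ≤ ‖v‖ ∧ d / 8 ≤ ‖v - x‖ := by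
    intro x v hv
    have h1 : v ∉ ball (0:ℂ) (d / 8) := fun h => hv (Or.inl h)
    have h2 : v ∉ ball x (d / 8) := fun h => hv (Or.inr h)
    exact ⟨by simpa using h1, by simpa [dist_eq_norm] using h2⟩
  have n3 := h3 E M r ρ t d (d / 8) (d / 8) B g ξ (ball 0 (d / 8) ∪ ball ξ (d / 8))ᶜ hc.hE hM hc.F0 hc.G hξ ht htd
    (by positivity) (by positivity) hr (by linarith) (measurableSet_ball.union measurableSet_ball).compl
    (fun v hv => (nA ξ v hv).1) (fun v hv => (nA ξ v hv).2)
  have n4 := h4 g ξ ξ' t d ρ B N hc.G ht htρ htd hB hN0 hξ hη1 hηN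
  have n5 := h5 g ξ ξ' a t d ρ ρ' B N hc.G ht hc.FX.pos htd hN0 hξ ha ha1 haN him hη1 hηN
  have n6 := h6 g ξ ξ' (halfp 0 1 ρ) t d ρ B N hc.G (halfp_meas _ _ _) ht htd hN0 hξ hη1 hηN
  have m2 : C2 * M * (t / d ^ 3 * (d / 8) ^ ε) ≤ C2 * M * (t ^ ε / d ^ 2) := by
    have : (d / 8) ^ ε ≤ d ^ ε := by gcongr; linarith
    have : t / d ^ 3 * (d / 8) ^ ε ≤ t ^ ε / d ^ 2 := le_trans (by gcongr) x0
    gcongr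
  have m3 : C3 * ((n * (t / (d / 8) + t / d) * (1 + d / (d / 8)) ^ 2) * (M * (d / 8) ^ (ε - 2) + r ^ (-2 : ℝ))) ≤
      C3 * (n * 729 * (M * 8 ^ (2 - ε) + D ^ (2 - ε) * r ^ (-2 : ℝ))) * (t ^ ε / d ^ 2) := by
    have e1 : (d / 8) ^ (ε - 2) = 8 ^ (2 - ε) * d ^ (ε - 2) := by
      rw [Real.div_rpow hd.le (by norm_num), show ε - 2 = -(2 - ε) by ring, Real.rpow_neg (by norm_num : (0:ℝ) ≤ 8),
        div_inv_eq_mul, mul_comm]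
    have e2 : n * (t / (d / 8) + t / d) * (1 + d / (d / 8)) ^ 2 = n * 729 * (t / d) := by field_simp; norm_num
    rw [e1, e2]
    calc _ = C3 * (n * 729 * (M * 8 ^ (2 - ε) * (t / d * d ^ (ε - 2)) + r ^ (-2 : ℝ) * (t / d))) := by ring
      _ ≤ C3 * (n * 729 * (M * 8 ^ (2 - ε) * (t ^ ε / d ^ 2) + r ^ (-2 : ℝ) * (D ^ (2 - ε) * (t ^ ε / d ^ 2)))) := by gcongr
      _ = _ := by ring
  have iE := G_int n hn g t d ρ ρ' ξ hd ht hξ.le hc.G.meas hc.G.bd hc.F0.pos hc.FX.pos E hc.hE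
    (fun v hv => by simpa using hc.F0.emp v hv) (fun v hv => hc.FX.emp v hv)
  have dis : Disjoint (ball (0:ℂ) (d / 8)) (ball ξ (d / 8)) := by
    apply ball_disjoint_ball
    rw [dist_comm, dist_zero_right, hξ]; linarith
  have hξn : ‖ξ'‖ ≤ 2 * d ∧ 15 * d / 16 ≤ ‖ξ'‖ := by
    have h1 := norm_sub_norm_le ξ' ξ
    have h2 := norm_sub_norm_le ξ ξ'
    rw [norm_sub_rev] at h1
    constructor <;> linarith
  have dis' : Disjoint (ball (0:ℂ) (d / 8)) (ball ξ' (d / 8)) := by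
    apply ball_disjoint_ball
    rw [dist_comm, dist_zero_right]; linarith [hξn.2]
  have bd' : ∀ v, v ≠ 0 → ‖g v‖ ≤ (2 * t) / ‖v‖ ^ 3 + (2 * t) / (2 * d) / ‖v‖ ^ 2 := fun v hv => by
    refine (hc.G.bd v hv).trans ?_
    rw [mul_div_mul_left _ _ two_ne_zero]
    gcongr; linarith
  have eH : ∀ v ∈ halfp 0 1 ρ, ρ ≤ ‖v‖ := fun v hv => by
    simpa using (halfp_norm 0 1 (by simp) ρ v hv).le
  have eH' : ∀ v ∈ halfp 0 1 ρ, ρ' ≤ ‖v - ξ'‖ := fun v hv => by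
    rw [halfp01] at hv
    have hv : ρ < v.im := hv
    refine le_trans ?_ ((le_abs_self _).trans (Complex.abs_im_le_norm (v - ξ')))
    rw [sub_im, him]; linarith
  have iH : IntegrableOn (fun v => g v * f0 n (v - ξ')) (halfp 0 1 ρ) :=
    G_int n hn g (2 * t) (2 * d) ρ ρ' ξ' (by positivity) (by positivity) hξn.1 hc.G.meas bd' hc.F0.pos hc.FX.pos _
      (halfp_meas _ _ _) eH eH'
  have z := split3 _ (halfp 0 1 ρ) _ _ measurableSet_ball measurableSet_ball dis' iH
  rw [hc.G.canc2 ξ' (by rw [him]; linarith [hc.FX.pos])] at z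
  rw [split3 _ E _ _ measurableSet_ball measurableSet_ball dis iE]
  have hA : (∫ v in halfp 0 1 ρ ∩ ball 0 (d / 8), g v * (f0 n (v - ξ) - f0 n (v - ξ'))) =
      (∫ v in halfp 0 1 ρ ∩ ball 0 (d / 8), g v * f0 n (v - ξ)) - ∫ v in halfp 0 1 ρ ∩ ball 0 (d / 8), g v * f0 n (v - ξ') := by
    rw [← integral_sub _ (iH.mono_set inter_subset_left)]
    · simp only [mul_sub]
    · refine G_int n hn g t d ρ (d / 2) ξ hd ht hξ.le hc.G.meas hc.G.bd hc.F0.pos (by positivity) _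
        ((halfp_meas _ _ _).inter measurableSet_ball) (fun v hv => eH v hv.1) (fun v hv => ?_)
      have h3 : ‖v‖ < d / 8 := by simpa using hv.2
      have := norm_sub_norm_le ξ v
      rw [norm_sub_rev] at this; linarith
  rw [hA] at n4
  set IA := ∫ v in E ∩ ball 0 (d / 8), g v * f0 n (v - ξ)
  set HA := ∫ v in halfp 0 1 ρ ∩ ball 0 (d / 8), g v * f0 n (v - ξ)
  set HA' := ∫ v in halfp 0 1 ρ ∩ ball 0 (d / 8), g v * f0 n (v - ξ')
  set IB := ∫ v in E ∩ ball ξ (d / 8), g v * f0 n (v - ξ)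
  set HB := ∫ v in halfp ξ a ρ' ∩ ball ξ (d / 8), g v * f0 n (v - ξ)
  set HB' := ∫ v in halfp 0 1 ρ ∩ ball ξ' (d / 8), g v * f0 n (v - ξ')
  set IF := ∫ v in E ∩ (ball 0 (d / 8) ∪ ball ξ (d / 8))ᶜ, g v * f0 n (v - ξ)
  set HF := ∫ v in halfp 0 1 ρ ∩ (ball 0 (d / 8) ∪ ball ξ (d / 8))ᶜ, g v * f0 n (v - ξ)
  set HF' := ∫ v in halfp 0 1 ρ ∩ (ball 0 (d / 8) ∪ ball ξ' (d / 8))ᶜ, g v * f0 n (v - ξ')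
  calc ‖IA + IB + IF‖ = ‖(IA - HA) + (HA - HA') + (IB - HB) + (HB - HB') + (IF - HF) + (HF - HF')‖ := by
        congr 1; linear_combination (-1 : ℂ) * z
    _ ≤ ‖IA - HA‖ + ‖HA - HA'‖ + ‖IB - HB‖ + ‖HB - HB'‖ + ‖IF - HF‖ + ‖HF - HF'‖ := by
        refine (norm_add_le _ _).trans (add_le_add_left ?_ _)
        refine (norm_add_le _ _).trans (add_le_add_left ?_ _)
        refine (norm_add_le _ _).trans (add_le_add_left ?_ _)
        refine (norm_add_le _ _).trans (add_le_add_left ?_ _)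
        exact norm_add_le _ _
    _ ≤ X * (t ^ ε / d ^ 2) := by
        rw [hX, add_mul, add_mul, add_mul, add_mul, add_mul]
        exact add_le_add (add_le_add (add_le_add (add_le_add (add_le_add n1 n4) (n2.trans m2)) n5) (n3.trans m3)) n6
    _ ≤ _ := by gcongr; linarith

lemma thmP (n : ℕ) (hn : 1 ≤ n) (ε M r D B : ℝ) (hε0 : 0 < ε) (hε1 : ε < 1) (hM : 0 ≤ M) (hr : 0 < r)
    (hD : 0 < D) (hB : 0 ≤ B) :
    ∃ C : ℝ, 0 < C ∧ ∀ E ξ a ρ ρ' t d g, Cfg n ε M r D B E ξ a ρ ρ' t d g →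
      ‖∫ v in E, g v * f0 n (v - ξ)‖ ≤ C * (t ^ ε / d ^ 2) := by
  set r1 := min (r / 20) ((1 / (40000 * (M + 1))) ^ (1 / ε)) with hr1
  have hr10 : 0 < r1 := lt_min (by positivity) (by positivity)
  have hr1r : r1 ≤ r / 20 := min_le_left _ _
  obtain ⟨C1, hC1, h1⟩ := caseA n hn ε M r D B hε0 hε1 hM hr hD
  obtain ⟨C2, hC2, h2⟩ := caseC n hn ε M r D B r1 hε0 hε1 hM hr hD hB hr10 (by linarith)
  obtain ⟨C3, hC3, h3⟩ := caseB n hn ε M r D B r1 hε0 hε1 hM hr hD hB (by linarith) (fun d hd hdr => by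
    have : d ≤ (1 / (40000 * (M + 1))) ^ (1 / ε) := hdr.trans (min_le_right _ _)
    have q : d ^ ε ≤ 1 / (40000 * (M + 1)) := by
      calc d ^ ε ≤ ((1 / (40000 * (M + 1))) ^ (1 / ε)) ^ ε := by gcongr
        _ = _ := by rw [← Real.rpow_mul (by positivity), one_div_mul_cancel hε0.ne', Real.rpow_one]
    calc 40000 * M * d ^ ε ≤ 40000 * (M + 1) * (1 / (40000 * (M + 1))) := by gcongr; linarith
      _ = 1 := by field_simp)
  refine ⟨C1 + C2 + C3, by positivity, fun E ξ a ρ ρ' t d g hc => ?_⟩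
  have ht := hc.ht
  have hd : 0 < d := by linarith [hc.htd]
  have hY0 : 0 ≤ t ^ ε / d ^ 2 := by positivity
  by_cases hρ : 2 * d ≤ ρ
  · exact (h1 E ξ a ρ ρ' t d g hc hρ).trans (by gcongr; linarith)
  by_cases hdr : r1 ≤ d
  · exact (h2 E ξ a ρ ρ' t d g hc hdr).trans (by gcongr; linarith)
  · exact (h3 E ξ a ρ ρ' t d g hc (not_le.1 hdr).le (not_le.1 hρ)).trans (by gcongr; linarith)

lemma cube_line (y : ℝ) (hy : 0 < y) :
    ∃ h : ℂ → ℂ, UHP h ∧ ∀ x : ℝ, (((x + y * I : ℂ)) ^ 3)⁻¹ = h x := by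
  have hb : (-(y * I) : ℂ).im < 0 := by simpa using hy
  refine ⟨_, (UHP_frac 2 (by norm_num) (-(y * I)) (-1) hb).sub (UHP_frac 2 (by norm_num) (-(y * I)) 0 hb), fun x => ?_⟩
  simp only [sub_neg_eq_add, sub_zero]
  norm_num
  rw [← sub_div, add_sub_cancel_left, one_div]

lemma Gk3 (n : ℕ) (hn : 1 ≤ n) : ∃ B : ℝ, 0 < B ∧ ∀ t d ρ : ℝ, 0 < t → 0 < d → 0 < ρ →
    Gk n (fun v => (t:ℂ) * (v ^ 3)⁻¹) t d ρ B := by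
  obtain ⟨C, hC, h⟩ := out_bd 3 (by norm_num)
  refine ⟨C, hC, fun t d ρ ht hd hρ => ?_⟩
  have mg : Measurable fun v : ℂ => (t:ℂ) * (v ^ 3)⁻¹ := by fun_prop
  have ng : ∀ v : ℂ, ‖(t:ℂ) * (v ^ 3)⁻¹‖ = t / ‖v‖ ^ 3 := fun v => by
    rw [norm_mul, norm_inv, norm_pow, Complex.norm_real, Real.norm_eq_abs, abs_of_pos ht]; rfl
  have out : ∀ (s : Set ℂ) (R : ℝ), MeasurableSet s → 0 < R → s ⊆ (ball 0 R)ᶜ →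
      IntegrableOn (fun v : ℂ => (t:ℂ) * (v ^ 3)⁻¹) s ∧ ‖∫ v in s, (t:ℂ) * (v ^ 3)⁻¹‖ ≤ C * t / R := by
    intro s R hs hR hsR
    have := h _ mg s hs 0 R t hR ht.le hsR (fun v hv => by
      rw [ng, sub_zero, Real.rpow_neg (norm_nonneg _), show (3:ℝ) = (3:ℕ) by norm_num, Real.rpow_natCast]; rfl)
    refine ⟨this.1, this.2.trans (le_of_eq ?_)⟩
    rw [show (2:ℝ) - 3 = -1 by norm_num, Real.rpow_neg hR.le, Real.rpow_one]; field_simp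
  constructor
  · exact mg
  · intro v hv
    have : v ^ 3 ≠ 0 := pow_ne_zero _ hv
    fun_prop (disch := assumption)
  · intro v hv
    rw [ng]
    have : 0 ≤ t / d / ‖v‖ ^ 2 := by positivity
    linarith
  · intro R hR hRd
    have z : ∫ v in halfp 0 1 ρ, (t:ℂ) * (v ^ 3)⁻¹ = 0 := by
      rw [halfp01]
      apply halfplane_zero
      intro y hy
      obtain ⟨h1, u1, e1⟩ := cube_line y (by linarith)
      simp only [e1]
      exact line_zero _ (u1.const_mul _)
    have iH := (out (halfp 0 1 ρ) ρ (halfp_meas _ _ _) hρ (fun v hv => by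
      have := (halfp_norm 0 1 (by simp) ρ v hv).le
      simpa using this)).1
    have s := integral_inter_add_sdiff (measurableSet_ball (x := (0:ℂ)) (ε := R)) iH
    rw [z] at s
    rw [eq_neg_of_add_eq_zero_left s, norm_neg]
    exact (out _ R ((halfp_meas _ _ _).diff measurableSet_ball) hR (fun v hv => hv.2)).2
  · intro ξ' hξ'
    rw [halfp01]
    apply halfplane_zero (fun v => (t:ℂ) * (v ^ 3)⁻¹ * f0 n (v - ξ'))
    intro y hy
    obtain ⟨h1, u1, e1⟩ := cube_line y (by linarith)
    obtain ⟨h2, u2, e2⟩ := f0_line n hn ξ' y (by linarith)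
    simp only [e1, e2]
    exact line_zero _ ((u1.const_mul _).mul u2)

lemma Gk2 (n : ℕ) (hn : 1 ≤ n) (c d ρ : ℝ) (hc : 0 < c) (hd : 0 < d) (hρ : c * d ≤ ρ) :
    Gk n (fun v => (c:ℂ) * (v ^ 2)⁻¹) (c * d) d ρ (Real.pi / c ^ 2) := by
  have mg : Measurable fun v : ℂ => (c:ℂ) * (v ^ 2)⁻¹ := by fun_prop
  have ng : ∀ v : ℂ, ‖(c:ℂ) * (v ^ 2)⁻¹‖ = c / ‖v‖ ^ 2 := fun v => by
    rw [norm_mul, norm_inv, norm_pow, Complex.norm_real, Real.norm_eq_abs, abs_of_pos hc]; rfl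
  have hcd : 0 < c * d := by positivity
  have hρ0 : 0 < ρ := by linarith
  constructor
  · exact mg
  · intro v hv
    have : v ^ 2 ≠ 0 := pow_ne_zero _ hv
    fun_prop (disch := assumption)
  · intro v hv
    rw [ng, mul_div_cancel_right₀ _ hd.ne']
    have : 0 ≤ c * d / ‖v‖ ^ 3 := by positivity
    linarith
  · intro R hR hRd
    refine (const_bd _ mg _ ((halfp_meas _ _ _).inter measurableSet_ball) 0 R (c / (c * d) ^ 2) hR (by positivity)
      inter_subset_right (fun v hv => ?_)).2.trans ?_
    · rw [ng]
      have := (halfp_norm 0 1 (by simp) ρ v hv.1).le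
      rw [sub_zero] at this
      gcongr; linarith
    · have : R * R ^ 2 ≤ d * d ^ 2 := by gcongr
      rw [le_div_iff₀ hR]
      calc c / (c * d) ^ 2 * (Real.pi * R ^ 2) * R = Real.pi / (c * d ^ 2) * (R * R ^ 2) := by field_simp
        _ ≤ Real.pi / (c * d ^ 2) * (d * d ^ 2) := by gcongr
        _ = _ := by field_simp
  · intro ξ' hξ'
    rw [halfp01]
    apply halfplane_zero (fun v => (c:ℂ) * (v ^ 2)⁻¹ * f0 n (v - ξ'))
    intro y hy
    obtain ⟨h1, u1, e1⟩ := sq_line 0 y (by simp; linarith)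
    obtain ⟨h2, u2, e2⟩ := f0_line n hn ξ' y (by linarith)
    simp only [sub_zero] at e1
    simp only [e1, e2]
    exact line_zero _ ((u1.const_mul _).mul u2)

lemma Flat.rig {E : Set ℂ} {ε M r ρ : ℝ} {c u' : ℂ} (h : Flat E ε M r c u' ρ) (z u : ℂ) (hu : ‖u‖ = 1) :
    Flat (rig z u ⁻¹' E) ε M r ((starRingEnd ℂ) u * (c - z)) ((starRingEnd ℂ) u * u') ρ := by
  have cu := conj_mul_self' u hu
  have e1 : ∀ v, _root_.rig z u v - c = u * (v - (starRingEnd ℂ) u * (c - z)) := fun v => by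
    simp only [_root_.rig]; linear_combination (c - z) * cu
  have e2 : ∀ v, ‖v - (starRingEnd ℂ) u * (c - z)‖ = ‖_root_.rig z u v - c‖ := fun v => by
    rw [e1, norm_mul, hu, one_mul]
  have e3 : ∀ v, (starRingEnd ℂ) ((starRingEnd ℂ) u * u') * (v - (starRingEnd ℂ) u * (c - z)) =
      (starRingEnd ℂ) u' * (_root_.rig z u v - c) := fun v => by
    rw [e1, map_mul, Complex.conj_conj]; ring
  constructor
  · rw [norm_mul, RCLike.norm_conj, hu, h.hu, one_mul]
  · exact h.pos
  · intro w hw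
    rw [e2]; exact h.emp _ hw
  · intro hr w hw hn
    have := h.flat hr (_root_.rig z u w) (by rwa [← e2]) (by
      have q : w ∈ halfp ((starRingEnd ℂ) u * (c - z)) ((starRingEnd ℂ) u * u') ρ ↔ _root_.rig z u w ∈ halfp c u' ρ := by
        simp only [halfp, mem_ofPred_eq, e3]
      rw [q] at hn
      exact hn)
    simp only [strip, mem_ofPred_eq] at this ⊢
    rw [e3, e2]; exact this

lemma normalizeC (n m : ℕ) (E : Set ℂ) (z ζ u : ℂ) (hu : ‖u‖ = 1) (s : ℝ) (hs : 0 < s) :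
    ‖∫ w in E, ((w - z) ^ m)⁻¹ * f0 n (w - ζ)‖ =
      ‖∫ v in rig z u ⁻¹' E, ((s : ℂ) * (v ^ m)⁻¹) * f0 n (v - (starRingEnd ℂ) u * (ζ - z))‖ / s := by
  rw [rig_cov z u hu]
  have cu := conj_mul_self' u hu
  have e : ∀ v, ((rig z u v - z) ^ m)⁻¹ * f0 n (rig z u v - ζ) =
      ((u ^ m)⁻¹ * ((starRingEnd ℂ) u ^ (n-1) / u ^ (n+1)) * (s:ℂ)⁻¹) *
        (((s : ℂ) * (v ^ m)⁻¹) * f0 n (v - (starRingEnd ℂ) u * (ζ - z))) := fun v => by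
    have hs' : (s:ℂ) ≠ 0 := by exact_mod_cast hs.ne'
    rw [show rig z u v - ζ = u * (v - (starRingEnd ℂ) u * (ζ - z)) by
      simp only [rig]; linear_combination (ζ - z) * cu, f0_rot, show rig z u v - z = u * v by simp [rig], mul_pow, mul_inv]
    field_simp
  simp only [e]
  rw [integral_const_mul, norm_mul, norm_mul, norm_mul, kap_norm n u hu, norm_inv, norm_inv, norm_pow, hu, one_pow,
    Complex.norm_real, Real.norm_eq_abs, abs_of_pos hs]
  rw [inv_one, one_mul, one_mul, div_eq_inv_mul]

structure Two (E : Set ℂ) (ε M r D : ℝ) (z ζ u u' : ℂ) (ρ ρ' : ℝ) : Prop where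
  hE : MeasurableSet E
  Fz : Flat E ε M r z u ρ
  Fζ : Flat E ε M r ζ u' ρ'
  ne : ζ ≠ z
  hD : ‖ζ - z‖ ≤ D
  hρρ' : |ρ - ρ'| ≤ ‖ζ - z‖

lemma Two.cfg {n : ℕ} {E : Set ℂ} {ε M r D : ℝ} {z ζ u u' : ℂ} {ρ ρ' : ℝ} (h : Two E ε M r D z ζ u u' ρ ρ')
    (g : ℂ → ℂ) (B t : ℝ) (hG : Gk n g t ‖ζ - z‖ ρ B) (ht : 0 < t) (htρ : t ≤ ρ) (htd : t ≤ ‖ζ - z‖) :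
    Cfg n ε M r D B (rig z u ⁻¹' E) ((starRingEnd ℂ) u * (ζ - z)) ((starRingEnd ℂ) u * u') ρ ρ' t ‖ζ - z‖ g := by
  have hu := h.Fz.hu
  refine ⟨rig_measurable z u h.hE, ?_, h.Fζ.rig z u hu, hG, ?_, ht, htρ, htd, h.hD, h.hρρ'⟩
  · have := h.Fz.rig z u hu
    rwa [sub_self, mul_zero, conj_mul_self' u hu] at this
  · rw [norm_mul, RCLike.norm_conj, hu, one_mul]

lemma app3 (n : ℕ) (hn : 1 ≤ n) (ε M r D : ℝ) (hε0 : 0 < ε) (hε1 : ε < 1) (hM : 0 ≤ M) (hr : 0 < r)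
    (hD : 0 < D) :
    ∃ C : ℝ, 0 < C ∧ ∀ E z ζ u u' ρ ρ', Two E ε M r D z ζ u u' ρ ρ' →
      ‖∫ w in E, ((w - z) ^ 3)⁻¹ * f0 n (w - ζ)‖ ≤ C * ((min ρ ‖ζ - z‖) ^ (ε - 1) / ‖ζ - z‖ ^ 2) := by
  obtain ⟨B, hB, hG⟩ := Gk3 n hn
  obtain ⟨C, hC, h⟩ := thmP n hn ε M r D B hε0 hε1 hM hr hD hB.le
  refine ⟨C, hC, fun E z ζ u u' ρ ρ' h2 => ?_⟩
  have hd : 0 < ‖ζ - z‖ := norm_pos_iff.2 (sub_ne_zero.2 h2.ne)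
  have ht : 0 < min ρ ‖ζ - z‖ := lt_min h2.Fz.pos hd
  rw [normalizeC n 3 E z ζ u h2.Fz.hu _ ht]
  have := h _ _ _ _ _ _ _ _ (h2.cfg _ B (min ρ ‖ζ - z‖) (hG _ _ _ ht hd h2.Fz.pos) ht (min_le_left _ _) (min_le_right _ _))
  rw [div_le_iff₀ ht]
  refine this.trans (le_of_eq ?_)
  rw [Real.rpow_sub ht, Real.rpow_one]; field_simp

lemma app2 (n : ℕ) (hn : 1 ≤ n) (ε M r D c : ℝ) (hε0 : 0 < ε) (hε1 : ε < 1) (hM : 0 ≤ M) (hr : 0 < r)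
    (hD : 0 < D) (hc : 0 < c) (hc1 : c ≤ 1) :
    ∃ C : ℝ, 0 < C ∧ ∀ E z ζ u u' ρ ρ', Two E ε M r D z ζ u u' ρ ρ' → c * ‖ζ - z‖ ≤ ρ →
      ‖∫ w in E, ((w - z) ^ 2)⁻¹ * f0 n (w - ζ)‖ ≤ C * (‖ζ - z‖ ^ ε / ‖ζ - z‖ ^ 2) := by
  obtain ⟨C, hC, h⟩ := thmP n hn ε M r D (Real.pi / c ^ 2) hε0 hε1 hM hr hD (by positivity)
  refine ⟨C / c, by positivity, fun E z ζ u u' ρ ρ' h2 hcρ => ?_⟩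
  have hd : 0 < ‖ζ - z‖ := norm_pos_iff.2 (sub_ne_zero.2 h2.ne)
  have hcd : c * ‖ζ - z‖ ≤ ‖ζ - z‖ := by
    calc c * ‖ζ - z‖ ≤ 1 * ‖ζ - z‖ := by gcongr
      _ = _ := one_mul _
  rw [normalizeC n 2 E z ζ u h2.Fz.hu c hc]
  have := h _ _ _ _ _ _ _ _ (h2.cfg _ _ (c * ‖ζ - z‖) (Gk2 n hn c _ _ hc hd hcρ) (by positivity) hcρ hcd)
  rw [div_mul_eq_mul_div]
  gcongr
  refine this.trans ?_
  gcongr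

def HB (ε : ℝ) (Ω : Set ℂ) : Prop :=
  ∀ a ∈ frontier Ω, ∃ r > 0, ∃ e : ℂ, ‖e‖ = 1 ∧ ∃ φ : ℝ → ℝ,
    ContDiff ℝ 1 φ ∧
    (∃ c : ℝ≥0, HolderOnWith c ε.toNNReal (deriv φ) univ) ∧
    Ω ∩ ball a r = {z ∈ ball a r | (e * z).im < φ ((e * z).re)}

/-- boundary flatness at the boundary point p -/
def BF (Ω : Set ℂ) (ε M r : ℝ) (p : ℂ) : Prop :=
  ∃ u : ℂ, ‖u‖ = 1 ∧ ∀ w, ‖w - p‖ < r → ¬ (w ∉ Ω ↔ 0 < ((starRingEnd ℂ) u * (w - p)).im) →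
    |((starRingEnd ℂ) u * (w - p)).im| ≤ M * ‖w - p‖ ^ (1 + ε)

lemma BF.mono {Ω : Set ℂ} {ε M r M' r' : ℝ} {p : ℂ} (h : BF Ω ε M r p) (hM : M ≤ M') (hr : r' ≤ r) :
    BF Ω ε M' r' p := by
  obtain ⟨u, hu, h⟩ := h
  refine ⟨u, hu, fun w hw hn => (h w (hw.trans_le hr) hn).trans ?_⟩
  gcongr

lemma taylor_holder (ε : ℝ) (hε0 : 0 < ε) (φ : ℝ → ℝ) (hφ : ContDiff ℝ 1 φ) (c : ℝ≥0)
    (hc : HolderOnWith c ε.toNNReal (deriv φ) univ) (a x : ℝ) :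
    |φ (a + x) - φ a - deriv φ a * x| ≤ c * |x| ^ (1 + ε) := by
  have hd : ∀ y, HasDerivAt φ (deriv φ y) y := fun y =>
    ((hφ.differentiable one_ne_zero) y).hasDerivAt
  have hh : ∀ y, |deriv φ y - deriv φ a| ≤ c * |y - a| ^ ε := fun y => by
    have := hc.dist_le (mem_univ y) (mem_univ a)
    rwa [Real.dist_eq, Real.dist_eq, Real.coe_toNNReal _ hε0.le] at this
  have hg : ∀ s ∈ Icc (0:ℝ) 1, HasDerivWithinAt (fun s => φ (a + s * x) - s * (deriv φ a * x))
      ((deriv φ (a + s * x) - deriv φ a) * x) (Icc 0 1) s := fun s _ => by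
    have h1 : HasDerivAt (fun s : ℝ => a + s * x) x s := by
      simpa using ((hasDerivAt_id s).mul_const x).const_add a
    have h2 := (hd (a + s * x)).comp s h1
    have h3 : HasDerivAt (fun s : ℝ => s * (deriv φ a * x)) (deriv φ a * x) s := by
      simpa using (hasDerivAt_id s).mul_const (deriv φ a * x)
    have := (h2.sub h3).hasDerivWithinAt (s := Icc 0 1)
    rw [← sub_mul] at this
    exact this
  have := norm_image_sub_le_of_norm_deriv_le_segment_01' (C := c * |x| ^ (1 + ε)) hg (fun s hs => by
    rw [norm_mul, Real.norm_eq_abs, Real.norm_eq_abs]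
    have h4 := hh (a + s * x)
    rw [add_sub_cancel_left, abs_mul, abs_of_nonneg hs.1] at h4
    have h5 : (s * |x|) ^ ε ≤ |x| ^ ε := by
      apply Real.rpow_le_rpow (by have := hs.1; positivity) _ hε0.le
      exact mul_le_of_le_one_left (abs_nonneg _) hs.2.le
    calc |deriv φ (a + s * x) - deriv φ a| * |x| ≤ (c * |x| ^ ε) * |x| := by
          gcongr
          exact h4.trans (by gcongr)
      _ = c * |x| ^ (1 + ε) := by
        rcases eq_or_ne x 0 with rfl | hx
        · rw [abs_zero, Real.zero_rpow (by linarith : (1 + ε) ≠ 0)]; simp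
        · rw [Real.rpow_add (abs_pos.2 hx), Real.rpow_one]; ring)
  simp only [Real.norm_eq_abs, one_mul, zero_mul, add_zero, sub_zero] at this
  rwa [sub_right_comm]

lemma BF_local (ε : ℝ) (hε0 : 0 < ε) (Ω : Set ℂ) (hΩo : IsOpen Ω) (hΩ : HB ε Ω) (a : ℂ)
    (ha : a ∈ frontier Ω) :
    ∃ r > 0, ∃ M : ℝ, 0 ≤ M ∧ ∀ p ∈ ball a r ∩ frontier Ω, BF Ω ε M r p := by
  obtain ⟨r, hr, e, he, φ, hφ, ⟨c, hc⟩, hg⟩ := hΩ a ha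
  refine ⟨r / 2, by positivity, c, c.2, fun p ⟨hp, hpf⟩ => ?_⟩
  have hg' : ∀ w ∈ ball a r, (w ∈ Ω ↔ (e * w).im < φ (e * w).re) := fun w hw => by
    have := Set.ext_iff.1 hg w
    simp only [mem_inter_iff, mem_ofPred_eq, hw, and_true, true_and] at this
    exact this
  have hpr : p ∈ ball a r := ball_subset_ball (by linarith) hp
  rw [hΩo.frontier_eq] at hpf
  have h1 : φ (e * p).re ≤ (e * p).im := not_lt.1 (fun h => hpf.2 ((hg' p hpr).2 h))
  have h2 : (e * p).im ≤ φ (e * p).re := by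
    have : p ∈ closure (Ω ∩ ball a r) := by
      have := isOpen_ball.inter_closure (s := ball a r) (t := Ω) ⟨hpr, hpf.1⟩
      rwa [inter_comm] at this
    have hcl : IsClosed {w : ℂ | (e * w).im ≤ φ (e * w).re} :=
      isClosed_le (by fun_prop) (hφ.continuous.comp (by fun_prop))
    refine closure_minimal (fun w hw => ?_) hcl this
    exact ((hg' w hw.2).1 hw.1).le
  have hpe : (e * p).im = φ (e * p).re := le_antisymm h2 h1
  set m := deriv φ (e * p).re with hm
  set s := √(1 + m ^ 2) with hs
  have hs1 : 1 ≤ s := Real.one_le_sqrt.2 (by nlinarith)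
  have hs0 : 0 < s := by linarith
  have hn : ‖(1 - m * I : ℂ)‖ = s := by
    rw [hs, Complex.norm_eq_sqrt_sq_add_sq]; simp
  refine ⟨(starRingEnd ℂ) (e * (1 - m * I) / s), ?_, fun w hw hne => ?_⟩
  · rw [RCLike.norm_conj, norm_div, norm_mul, he, hn, Complex.norm_real, Real.norm_eq_abs, abs_of_pos hs0]
    field_simp
  rw [Complex.conj_conj] at hne ⊢
  set x := (e * (w - p)).re with hx
  set y := (e * (w - p)).im with hy
  have him : (e * (1 - m * I) / s * (w - p)).im = (y - m * x) / s := by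
    have : e * (1 - m * I) / s * (w - p) = ((1 - m * I) * (e * (w - p))) / s := by ring
    rw [this, Complex.div_ofReal_im]
    congr 1
    rw [Complex.mul_im, ← hx, ← hy]; simp; ring
  rw [him] at hne ⊢
  have hxw : |x| ≤ ‖w - p‖ := by
    have := Complex.abs_re_le_norm (e * (w - p))
    rwa [norm_mul, he, one_mul] at this
  have hwr : w ∈ ball a r := by
    rw [mem_ball] at hp ⊢
    rw [← dist_eq_norm] at hw
    linarith [dist_triangle w p a]
  have hre : (e * w).re = (e * p).re + x := by rw [hx, mul_sub, Complex.sub_re]; ring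
  have hiy : (e * w).im = (e * p).im + y := by rw [hy, mul_sub, Complex.sub_im]; ring
  have T := taylor_holder ε hε0 φ hφ c hc (e * p).re x
  rw [← hm, ← hpe, ← hre] at T
  have key : |y - m * x| ≤ |φ (e * w).re - (e * p).im - m * x| := by
    rw [hg' w hwr, hiy] at hne
    have q : 0 < (y - m * x) / s ↔ 0 < y - m * x := by
      constructor
      · intro h; by_contra h'; push Not at h'
        exact absurd h (not_lt.2 (div_nonpos_of_nonpos_of_nonneg h' hs0.le))
      · intro h; positivity
    rw [q] at hne
    by_cases h0 : 0 < y - m * x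
    · have h3 : (e * p).im + y < φ (e * w).re := by tauto
      rw [abs_of_pos h0]
      exact le_trans (by linarith) (le_abs_self _)
    · have h3 : ¬ ((e * p).im + y < φ (e * w).re) := by tauto
      rw [abs_of_nonpos (not_lt.1 h0)]
      exact le_trans (by linarith) (neg_le_abs _)
  rw [abs_div, abs_of_pos hs0]
  calc |y - m * x| / s ≤ |y - m * x| := div_le_self (abs_nonneg _) hs1
    _ ≤ c * |x| ^ (1 + ε) := key.trans T
    _ ≤ _ := by gcongr

lemma BF_global (ε : ℝ) (hε0 : 0 < ε) (Ω : Set ℂ) (hΩo : IsOpen Ω) (hΩb : Bornology.IsBounded Ω)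
    (hΩ : HB ε Ω) : ∃ r > 0, ∃ M : ℝ, 0 ≤ M ∧ ∀ p ∈ frontier Ω, BF Ω ε M r p := by
  have hc : IsCompact (frontier Ω) := hΩb.isCompact_closure.of_isClosed_subset isClosed_frontier frontier_subset_closure
  refine hc.induction_on (p := fun S => ∃ r > 0, ∃ M : ℝ, 0 ≤ M ∧ ∀ p ∈ S, BF Ω ε M r p) ?_ ?_ ?_ ?_
  · exact ⟨1, one_pos, 0, le_rfl, by simp⟩
  · rintro s t hst ⟨r, hr, M, hM, h⟩
    exact ⟨r, hr, M, hM, fun p hp => h p (hst hp)⟩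
  · rintro s t ⟨r, hr, M, hM, h⟩ ⟨r', hr', M', hM', h'⟩
    refine ⟨min r r', lt_min hr hr', max M M', le_max_of_le_left hM, fun p hp => ?_⟩
    rcases hp with hp | hp
    · exact (h p hp).mono (le_max_left _ _) (min_le_left _ _)
    · exact (h' p hp).mono (le_max_right _ _) (min_le_right _ _)
  · intro a ha
    obtain ⟨r, hr, M, hM, h⟩ := BF_local ε hε0 Ω hΩo hΩ a ha
    refine ⟨ball a r ∩ frontier Ω, ?_, r, hr, M, hM, h⟩
    exact inter_mem (mem_nhdsWithin_of_mem_nhds (ball_mem_nhds a hr)) self_mem_nhdsWithin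

lemma align (Ω : Set ℂ) (ε M r ρ : ℝ) (hε0 : 0 < ε) (hM : 0 ≤ M) (hr : 0 < r) (p z u : ℂ) (hu : ‖u‖ = 1)
    (hb : ∀ w, ‖w - p‖ < r → ¬ (w ∉ Ω ↔ 0 < ((starRingEnd ℂ) u * (w - p)).im) →
      |((starRingEnd ℂ) u * (w - p)).im| ≤ M * ‖w - p‖ ^ (1 + ε))
    (hp : ‖p - z‖ = ρ) (hd : ∀ w, w ∉ Ω → ρ ≤ ‖w - z‖) :
    ((starRingEnd ℂ) u * (p - z)).im = ρ := by
  have hρ : 0 ≤ ρ := hp ▸ norm_nonneg _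
  have cu := conj_mul_self' u hu
  set q := (starRingEnd ℂ) u * (p - z) with hq
  have hqn : ‖q‖ = ρ := by rw [hq, norm_mul, RCLike.norm_conj, hu, one_mul, hp]
  have hsq : q.re ^ 2 + q.im ^ 2 = ρ ^ 2 := by
    rw [← hqn, ← Complex.normSq_eq_norm_sq, Complex.normSq_apply]; ring
  -- directional inequality
  have dir : ∀ v : ℂ, 0 < v.im → 0 ≤ q.re * v.re + q.im * v.im := by
    intro v hv
    have hv0 : 0 < ‖v‖ := norm_pos_iff.2 (fun h => by simp [h] at hv)
    by_contra hneg
    push Not at hneg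
    set b := -(q.re * v.re + q.im * v.im) with hbdef
    have hb0 : 0 < b := by linarith
    have lim1 : Tendsto (fun s : ℝ => M * (‖v‖ ^ (1 + ε) * s ^ ε)) (𝓝[>] 0) (𝓝 0) := by
      have : Tendsto (fun s : ℝ => M * (‖v‖ ^ (1 + ε) * s ^ ε)) (𝓝 0) (𝓝 (M * (‖v‖ ^ (1 + ε) * (0:ℝ) ^ ε))) := by
        have : ContinuousAt (fun s : ℝ => s ^ ε) 0 := Real.continuousAt_rpow_const 0 ε (Or.inr hε0.le)
        exact (this.tendsto.const_mul _).const_mul _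
      rw [Real.zero_rpow hε0.ne'] at this
      simp only [mul_zero] at this
      exact this.mono_left nhdsWithin_le_nhds
    have lim2 : Tendsto (fun s : ℝ => s * ‖v‖) (𝓝[>] 0) (𝓝 0) := by
      have : Tendsto (fun s : ℝ => s * ‖v‖) (𝓝 0) (𝓝 (0 * ‖v‖)) := (continuous_id.mul continuous_const).tendsto 0
      rw [zero_mul] at this
      exact this.mono_left nhdsWithin_le_nhds
    have lim3 : Tendsto (fun s : ℝ => s * ‖v‖ ^ 2) (𝓝[>] 0) (𝓝 0) := by
      have : Tendsto (fun s : ℝ => s * ‖v‖ ^ 2) (𝓝 0) (𝓝 (0 * ‖v‖ ^ 2)) := (continuous_id.mul continuous_const).tendsto 0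
      rw [zero_mul] at this
      exact this.mono_left nhdsWithin_le_nhds
    obtain ⟨s, ⟨h1, h2, h3⟩, hs⟩ := ((lim1.eventually (gt_mem_nhds hv)).and ((lim2.eventually (gt_mem_nhds hr)).and
      (lim3.eventually (gt_mem_nhds hb0))) |>.and self_mem_nhdsWithin).exists
    have hs : 0 < s := hs
    have e0 : (starRingEnd ℂ) u * ((p + u * (s * v)) - p) = s * v := by linear_combination (s * v) * cu
    have e1 : ‖(p + u * (s * v)) - p‖ = s * ‖v‖ := by
      rw [add_sub_cancel_left, norm_mul, hu, one_mul, norm_mul, Complex.norm_real, Real.norm_eq_abs, abs_of_pos hs]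
    have hin : (p + u * (s * v)) ∉ Ω := by
      by_contra hcon
      have him : ((s:ℂ) * v).im = s * v.im := by simp
      have hpos : 0 < s * v.im := by positivity
      have := hb (p + u * (s * v)) (by rw [e1]; exact h2) (by
        rw [e0, him]; tauto)
      rw [e0, him, e1, abs_of_pos hpos, Real.mul_rpow hs.le hv0.le, Real.rpow_add hs, Real.rpow_one] at this
      have h7 : s * (M * (‖v‖ ^ (1 + ε) * s ^ ε)) < s * v.im := by gcongr
      nlinarith
    have h4 := hd _ hin
    have e2 : ‖(p + u * (s * v)) - z‖ = ‖q + s * v‖ := by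
      have : q + s * v = (starRingEnd ℂ) u * ((p + u * (s * v)) - z) := by
        rw [hq]; linear_combination -(s * v) * cu
      rw [this, norm_mul, RCLike.norm_conj, hu, one_mul]
    rw [e2] at h4
    have h5 : ρ ^ 2 ≤ ‖q + s * v‖ ^ 2 := by gcongr
    have h6 : ‖q + s * v‖ ^ 2 = ρ ^ 2 - 2 * s * b + s * (s * ‖v‖ ^ 2) := by
      rw [← hsq, ← Complex.normSq_eq_norm_sq, ← Complex.normSq_eq_norm_sq, Complex.normSq_apply, Complex.normSq_apply, hbdef]
      simp; ring
    have : s * (s * ‖v‖ ^ 2) < s * b := by gcongr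
    nlinarith
  have h1 := dir I (by simp)
  simp at h1
  have h2 : q.re = 0 := by
    by_contra h0
    have h3 : 0 < q.re ^ 2 := by positivity
    set η := q.re ^ 2 / (2 * (q.im + 1)) with hη
    have hη0 : 0 < η := by positivity
    have := dir (-q.re + η * I) (by simpa using hη0)
    simp at this
    have h4 : η * (2 * (q.im + 1)) = q.re ^ 2 := by rw [hη]; field_simp
    nlinarith
  rw [h2] at hsq
  nlinarith [sq_nonneg (q.im - ρ)]

lemma flatness (ε : ℝ) (hε0 : 0 < ε) (Ω : Set ℂ) (hΩo : IsOpen Ω) (hΩb : Bornology.IsBounded Ω)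
    (hΩ : HB ε Ω) : ∃ r > 0, ∃ M : ℝ, 0 ≤ M ∧ ∀ z ∈ Ω, ∃ u, Flat Ωᶜ ε M r z u (infDist z Ωᶜ) := by
  obtain ⟨r, hr, M, hM, h⟩ := BF_global ε hε0 Ω hΩo hΩb hΩ
  have hne : (Ωᶜ).Nonempty := by
    rw [nonempty_compl]
    rintro rfl
    exact NormedSpace.unbounded_univ ℝ ℂ hΩb
  have hcl : IsClosed Ωᶜ := hΩo.isClosed_compl
  refine ⟨r / 2, by positivity, M * 2 ^ (1 + ε), by positivity, fun z hz => ?_⟩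
  have hpos : 0 < infDist z Ωᶜ := (hcl.notMem_iff_infDist_pos hne).1 (fun h => h hz)
  have hemp : ∀ w ∈ Ωᶜ, infDist z Ωᶜ ≤ ‖w - z‖ := fun w hw => by
    rw [← dist_eq_norm, dist_comm]; exact infDist_le_dist_of_mem hw
  obtain ⟨p, hpE, hpd⟩ := hcl.exists_infDist_eq_dist hne z
  set ρ := infDist z Ωᶜ with hρ
  have hpz : ‖p - z‖ = ρ := by rw [← dist_eq_norm, dist_comm, hpd]
  have hpf : p ∈ frontier Ω := by
    rw [hΩo.frontier_eq]
    refine ⟨?_, hpE⟩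
    have h1 : p ∈ closure (ball z ρ) := by
      rw [closure_ball _ hpos.ne', mem_closedBall, dist_eq_norm, hpz]
    refine closure_mono (fun w hw => ?_) h1
    by_contra hw'
    have := hemp w hw'
    rw [mem_ball, dist_eq_norm] at hw
    linarith
  obtain ⟨u, hu, hb⟩ := h p hpf
  have al := align Ω ε M r ρ hε0 hM hr p z u hu hb hpz (fun w hw => hemp w hw)
  refine ⟨u, hu, hpos, hemp, fun hρr w hw hn => ?_⟩
  have e1 : ((starRingEnd ℂ) u * (w - z)).im - ρ = ((starRingEnd ℂ) u * (w - p)).im := by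
    rw [← al, ← Complex.sub_im]; congr 1; ring
  have e2 : w ∈ halfp z u ρ ↔ 0 < ((starRingEnd ℂ) u * (w - p)).im := by
    rw [← e1, sub_pos]; rfl
  have hρw : ρ ≤ ‖w - z‖ := by
    by_cases hw' : w ∈ Ωᶜ
    · exact hemp w hw'
    · have : w ∈ halfp z u ρ := by tauto
      exact (halfp_norm z u hu ρ w this).le
  have e3 : ‖w - p‖ ≤ ‖w - z‖ + ρ := by
    rw [← hpz, norm_sub_rev p z]
    exact (norm_sub_le_norm_sub_add_norm_sub w z p)
  have := hb w (by linarith) (by rw [e2] at hn; exact hn)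
  show |((starRingEnd ℂ) u * (w - z)).im - ρ| ≤ _
  rw [e1]
  calc _ ≤ M * ‖w - p‖ ^ (1 + ε) := this
    _ ≤ M * (2 * ‖w - z‖) ^ (1 + ε) := by gcongr; linarith
    _ = _ := by rw [Real.mul_rpow (by norm_num) (norm_nonneg _)]; ring

lemma inward (ε M r : ℝ) (hε0 : 0 < ε) (hM : 0 ≤ M) (hr : 0 < r) : ∃ κ : ℝ, 0 < κ ∧ κ ≤ r / 20 ∧
    (∀ d, 0 < d → d ≤ κ → 40 * (M * (10 * d) ^ (1 + ε)) ≤ d) ∧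
    ∀ (Ω : Set ℂ), (Ωᶜ).Nonempty → ∀ z u ρ, Flat Ωᶜ ε M r z u ρ → ∀ s, 0 ≤ s → ρ + s ≤ κ →
      z - s * (I * u) ∈ Ω ∧ (ρ + s) / 2 ≤ infDist (z - s * (I * u)) Ωᶜ := by
  have lim : Tendsto (fun d : ℝ => 40 * (M * (10 * (10 * d) ^ ε))) (𝓝[>] 0) (𝓝 0) := by
    have h1 : Tendsto (fun d : ℝ => (10 * d) ^ ε) (𝓝 0) (𝓝 ((10 * 0) ^ ε)) := by
      have : ContinuousAt (fun s : ℝ => s ^ ε) (10 * 0) := Real.continuousAt_rpow_const _ ε (Or.inr hε0.le)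
      exact this.tendsto.comp ((continuous_const.mul continuous_id).tendsto 0)
    have h2 := ((h1.const_mul 10).const_mul M).const_mul 40
    rw [mul_zero, Real.zero_rpow hε0.ne'] at h2
    simp only [mul_zero] at h2
    exact h2.mono_left nhdsWithin_le_nhds
  obtain ⟨κ₀, h0, hκ₀⟩ := ((lim.eventually (gt_mem_nhds one_pos)).and self_mem_nhdsWithin).exists
  have hκ₀ : 0 < κ₀ := hκ₀
  have main : ∀ d, 0 < d → d ≤ min κ₀ (r / 20) → 40 * (M * (10 * d) ^ (1 + ε)) ≤ d := by
    intro d hd hdκ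
    have h1 : (10 * d) ^ ε ≤ (10 * κ₀) ^ ε := by
      gcongr; exact hdκ.trans (min_le_left _ _)
    rw [Real.rpow_add (by positivity), Real.rpow_one]
    have h2 : 40 * (M * (10 * (10 * d) ^ ε)) ≤ 1 := le_trans (by gcongr) h0.le
    nlinarith
  refine ⟨min κ₀ (r / 20), lt_min hκ₀ (by positivity), min_le_right _ _, main, ?_⟩
  intro Ω hne z u ρ F s hs hρs
  have hρ := F.pos
  have hq : 0 < ρ + s := by linarith
  have key : ∀ w ∈ Ωᶜ, (ρ + s) / 2 ≤ ‖w - (z - s * (I * u))‖ := by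
    intro w hw
    by_contra hlt
    push Not at hlt
    have cu := conj_mul_self' u F.hu
    have hwz : ‖w - z‖ ≤ 2 * (ρ + s) := by
      have : w - z = (w - (z - s * (I * u))) - s * (I * u) := by ring
      rw [this]
      refine (norm_sub_le _ _).trans ?_
      have : ‖(s:ℂ) * (I * u)‖ = s := by
        rw [norm_mul, norm_mul, F.hu, Complex.norm_I, Complex.norm_real, Real.norm_eq_abs, abs_of_nonneg hs]; ring
      rw [this]; linarith
    have hr20 : ρ + s ≤ r / 20 := hρs.trans (min_le_right _ _)
    have him : ((starRingEnd ℂ) u * (w - z)).im + s ≤ ‖w - (z - s * (I * u))‖ := by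
      have e : (starRingEnd ℂ) u * (w - (z - s * (I * u))) = (starRingEnd ℂ) u * (w - z) + s * I := by
        linear_combination (s * I) * cu
      calc _ = ((starRingEnd ℂ) u * (w - (z - s * (I * u)))).im := by rw [e]; simp
        _ ≤ ‖(starRingEnd ℂ) u * (w - (z - s * (I * u)))‖ := Complex.im_le_norm _
        _ = _ := by rw [norm_mul, RCLike.norm_conj, F.hu, one_mul]
    by_cases hH : w ∈ halfp z u ρ
    · have : ρ < ((starRingEnd ℂ) u * (w - z)).im := hH
      linarith
    · have := F.flat (by linarith) w (by linarith) (by tauto)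
      have h1 : |((starRingEnd ℂ) u * (w - z)).im - ρ| ≤ M * ‖w - z‖ ^ (1 + ε) := this
      have h2 : M * ‖w - z‖ ^ (1 + ε) ≤ M * (10 * (ρ + s)) ^ (1 + ε) := by
        gcongr; linarith
      have h3 := main (ρ + s) hq hρs
      have h4 := neg_abs_le (((starRingEnd ℂ) u * (w - z)).im - ρ)
      linarith
  refine ⟨?_, (le_infDist hne).2 (fun w hw => ?_)⟩
  · by_contra h
    have := key _ h
    rw [sub_self, norm_zero] at this
    linarith
  · rw [dist_comm, dist_eq_norm]; exact key w hw

structure KD (Ω : Set ℂ) (ε A : ℝ) (ζ : ℂ) (k k' : ℂ → ℂ) : Prop where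
  der : ∀ z ∈ Ω, HasDerivAt k (k' z) z
  bd : ∀ z ∈ Ω, z ≠ ζ → ‖k' z‖ ≤ A * ((min (infDist z Ωᶜ) ‖ζ - z‖) ^ (ε - 1) / ‖ζ - z‖ ^ 2)

lemma KD.bd' {Ω : Set ℂ} {ε A : ℝ} {ζ : ℂ} {k k' : ℂ → ℂ} (h : KD Ω ε A ζ k k') (hε1 : ε < 1) (hA : 0 ≤ A)
    (d m : ℝ) (hd : 0 < d) (hm : 0 < m) (z : ℂ) (hz : z ∈ Ω) (h1 : m ≤ infDist z Ωᶜ) (h2 : d / 4 ≤ ‖ζ - z‖)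
    (h3 : m ≤ d / 4) : ‖k' z‖ ≤ 16 * A * m ^ (ε - 1) / d ^ 2 := by
  have hne : z ≠ ζ := by
    rintro rfl
    rw [sub_self, norm_zero] at h2; linarith
  refine (h.bd z hz hne).trans ?_
  have e1 : (min (infDist z Ωᶜ) ‖ζ - z‖) ^ (ε - 1) ≤ m ^ (ε - 1) :=
    Real.rpow_le_rpow_of_nonpos hm (le_min h1 (h3.trans h2)) (by linarith)
  calc _ ≤ A * (m ^ (ε - 1) / (d / 4) ^ 2) := by gcongr
    _ = _ := by field_simp; ring

lemma KD.path {Ω : Set ℂ} {ε A : ℝ} {ζ : ℂ} {k k' : ℂ → ℂ} (h : KD Ω ε A ζ k k') (hε0 : 0 < ε) (hε1 : ε < 1) (hA : 0 ≤ A)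
    (d ρ S : ℝ) (z u : ℂ) (hu : ‖u‖ = 1) (hd : 0 < d) (hρ : 0 < ρ) (hS : 0 ≤ S) (hSd : ρ + S ≤ d / 2)
    (hin : ∀ s : ℝ, 0 ≤ s → s ≤ S → z - s * (I * u) ∈ Ω ∧ (ρ + s) / 2 ≤ infDist (z - s * (I * u)) Ωᶜ)
    (hfar : d / 4 + S ≤ ‖ζ - z‖) :
    ‖k (z - S * (I * u)) - k z‖ ≤ 32 * A / ε * ((ρ + S) ^ ε / d ^ 2) := by
  have hds : ∀ s : ℝ, 0 ≤ s → s ≤ S → HasDerivAt (fun s : ℝ => k (z - s * (I * u)) - k z)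
      (k' (z - s * (I * u)) * (-(I * u))) s := by
    intro s h0 hs
    have h1 : HasDerivAt (fun s : ℝ => z - (s:ℂ) * (I * u)) (-(I * u)) s := by
      simpa using ((Complex.ofRealCLM.hasDerivAt (x := s)).mul_const (I * u)).const_sub z
    exact ((h.der _ (hin s h0 hs).1).comp s h1).sub_const _
  have hB : ∀ s : ℝ, 0 ≤ s → HasDerivAt (fun s : ℝ => 32 * A / ε / d ^ 2 * ((ρ + s) ^ ε - ρ ^ ε))
      (32 * A / d ^ 2 * (ρ + s) ^ (ε - 1)) s := by
    intro s h0
    have h1 : HasDerivAt (fun s : ℝ => ρ + s) 1 s := (hasDerivAt_id s).const_add ρ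
    have h2 := (h1.rpow_const (p := ε) (Or.inl (by linarith : ρ + s ≠ 0))).sub_const (ρ ^ ε) |>.const_mul (32 * A / ε / d ^ 2)
    have e : 32 * A / d ^ 2 * (ρ + s) ^ (ε - 1) = 32 * A / ε / d ^ 2 * (1 * ε * (ρ + s) ^ (ε - 1)) := by
      field_simp
    rw [e]; exact h2
  have := image_norm_le_of_norm_deriv_right_le_deriv_boundary' (a := 0) (b := S)
    (f := fun s : ℝ => k (z - s * (I * u)) - k z) (f' := fun s => k' (z - s * (I * u)) * (-(I * u)))
    (B := fun s : ℝ => 32 * A / ε / d ^ 2 * ((ρ + s) ^ ε - ρ ^ ε)) (B' := fun s => 32 * A / d ^ 2 * (ρ + s) ^ (ε - 1))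
    (fun s hs => (hds s hs.1 hs.2).continuousAt.continuousWithinAt)
    (fun s hs => (hds s hs.1 hs.2.le).hasDerivWithinAt)
    (by simp)
    (fun s hs => (hB s hs.1).continuousAt.continuousWithinAt)
    (fun s hs => (hB s hs.1).hasDerivWithinAt)
    (fun s hs => by
      have hs0 := hs.1
      have hs1 := hs.2
      obtain ⟨i1, i2⟩ := hin s hs.1 hs.2.le
      have nI : ‖(I * u : ℂ)‖ = 1 := by rw [norm_mul, Complex.norm_I, hu, one_mul]
      rw [norm_mul, norm_neg, nI, mul_one]
      have f : d / 4 ≤ ‖ζ - (z - s * (I * u))‖ := by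
        have e : ζ - z = (ζ - (z - s * (I * u))) - s * (I * u) := by ring
        have := norm_sub_le (ζ - (z - s * (I * u))) (s * (I * u))
        rw [← e, norm_mul, nI, Complex.norm_real, Real.norm_eq_abs, abs_of_nonneg hs0] at this
        linarith
      refine (h.bd' hε1 hA d ((ρ + s) / 2) hd (by linarith) _ i1 i2 f (by linarith)).trans ?_
      have : ((ρ + s) / 2) ^ (ε - 1) ≤ 2 * (ρ + s) ^ (ε - 1) := by
        rw [Real.div_rpow (by linarith) (by norm_num), div_le_iff₀ (by positivity)]
        have h4 : (2:ℝ)⁻¹ ≤ 2 ^ (ε - 1) := by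
          rw [← Real.rpow_neg_one]
          exact Real.rpow_le_rpow_of_exponent_le (by norm_num) (by linarith)
        have h5 : 0 ≤ (ρ + s) ^ (ε - 1) := Real.rpow_nonneg (by linarith) _
        nlinarith
      calc 16 * A * ((ρ + s) / 2) ^ (ε - 1) / d ^ 2 ≤ 16 * A * (2 * (ρ + s) ^ (ε - 1)) / d ^ 2 := by gcongr
        _ = _ := by ring)
    (right_mem_Icc.2 hS)
  refine this.trans ?_
  have h6 : 0 ≤ ρ ^ ε := by positivity
  calc 32 * A / ε / d ^ 2 * ((ρ + S) ^ ε - ρ ^ ε) ≤ 32 * A / ε / d ^ 2 * ((ρ + S) ^ ε) := by gcongr; linarith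
    _ = _ := by ring

lemma KD.seg {Ω : Set ℂ} {ε A : ℝ} {ζ : ℂ} {k k' : ℂ → ℂ} (h : KD Ω ε A ζ k k') (hε1 : ε < 1) (hA : 0 ≤ A)
    (d m R : ℝ) (z y : ℂ) (hd : 0 < d) (hm : 0 < m) (hmd : m ≤ d / 4)
    (hzy : ‖y - z‖ ≤ R) (h1 : R + m ≤ infDist z Ωᶜ) (h2 : d / 4 + R ≤ ‖ζ - z‖) :
    ‖k y - k z‖ ≤ 16 * A * m ^ (ε - 1) / d ^ 2 * R := by
  have inB : ∀ x ∈ closedBall z R, m ≤ infDist x Ωᶜ := fun x hx => by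
    have := infDist_le_infDist_add_dist (s := Ωᶜ) (x := z) (y := x)
    rw [mem_closedBall, dist_comm] at hx
    linarith
  have inΩ : ∀ x ∈ closedBall z R, x ∈ Ω := fun x hx => by
    by_contra hx'
    have h3 := inB x hx
    rw [infDist_zero_of_mem (show x ∈ Ωᶜ from hx')] at h3
    linarith
  have hR : 0 ≤ R := (norm_nonneg _).trans hzy
  refine (Convex.norm_image_sub_le_of_norm_hasDerivWithin_le (s := closedBall z R) (C := 16 * A * m ^ (ε - 1) / d ^ 2)
    (fun x hx => (h.der x (inΩ x hx)).hasDerivWithinAt) (fun x hx => ?_) (convex_closedBall z R)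
    (mem_closedBall_self hR) (by rwa [mem_closedBall, dist_eq_norm])).trans (by gcongr)
  refine h.bd' hε1 hA d m hd hm x (inΩ x hx) (inB x hx) ?_ hmd
  have e : ζ - z = (ζ - x) + (x - z) := by ring
  have := norm_add_le (ζ - x) (x - z)
  rw [← e] at this
  rw [mem_closedBall, dist_eq_norm] at hx
  linarith

lemma k_der (n : ℕ) (hn : 1 ≤ n) (E : Set ℂ) (hE : MeasurableSet E) (z ζ : ℂ) (ρ ρ' : ℝ) (hρ : 0 < ρ) (hρ' : 0 < ρ')
    (h : ∀ w ∈ E, ρ ≤ ‖w - z‖) (h' : ∀ w ∈ E, ρ' ≤ ‖w - ζ‖) :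
    HasDerivAt (fun x => ∫ w in E, ((w - x) ^ 2)⁻¹ * f0 n (w - ζ))
      (2 * ∫ w in E, ((w - z) ^ 3)⁻¹ * f0 n (w - ζ)) z := by
  obtain ⟨C, hC, H⟩ := out_bd 3 (by norm_num)
  have hsub : E ⊆ (ball z ρ)ᶜ := fun w hw => by
    rw [mem_compl_iff, mem_ball, dist_eq_norm, not_lt]; exact h w hw
  have p3 : ∀ x : ℝ, 0 ≤ x → x ^ (-3 : ℝ) = (x ^ 3)⁻¹ := fun x hx => by
    rw [Real.rpow_neg hx, show (3:ℝ) = (3:ℕ) by norm_num, Real.rpow_natCast]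
  have mf : Measurable fun w : ℂ => f0 n (w - ζ) := (f0_meas n).comp (measurable_id.sub_const ζ)
  have m2 : ∀ x : ℂ, Measurable fun w : ℂ => ((w - x) ^ 2)⁻¹ * f0 n (w - ζ) := fun x =>
    Measurable.mul (by fun_prop) mf
  have m3 : Measurable fun w : ℂ => 2 * ((w - z) ^ 3)⁻¹ * f0 n (w - ζ) := Measurable.mul (by fun_prop) mf
  have hn0 : (0:ℝ) < n := by exact_mod_cast hn
  have i1 : IntegrableOn (fun w : ℂ => ((w - z) ^ 2)⁻¹ * f0 n (w - ζ)) E := by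
    refine (H _ (m2 z) E hE z ρ (n * ((1 + ‖ζ - z‖ / ρ') / ρ')) hρ (by positivity) hsub (fun w hw => ?_)).1
    have a1 := h w hw
    have a2 := h' w hw
    have b1 : 0 < ‖w - z‖ := by linarith
    have b2 : 0 < ‖w - ζ‖ := by linarith
    rw [norm_mul, norm_inv, norm_pow, f0_norm n hn, p3 _ b1.le]
    have a3 : ‖w - z‖ ≤ ‖w - ζ‖ * (1 + ‖ζ - z‖ / ρ') := by
      have e1 : ‖w - z‖ ≤ ‖w - ζ‖ + ‖ζ - z‖ := norm_sub_le_norm_sub_add_norm_sub w ζ z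
      have e2 : ‖ζ - z‖ ≤ ‖w - ζ‖ * (‖ζ - z‖ / ρ') := by
        calc ‖ζ - z‖ = ρ' * (‖ζ - z‖ / ρ') := by field_simp
          _ ≤ _ := by gcongr
      linarith
    have a4 : ‖w - z‖ * ρ' ≤ ‖w - ζ‖ ^ 2 * (1 + ‖ζ - z‖ / ρ') := by
      calc _ ≤ (‖w - ζ‖ * (1 + ‖ζ - z‖ / ρ')) * ‖w - ζ‖ := by gcongr
        _ = _ := by ring
    have a5 : 1 / ‖w - ζ‖ ^ 2 ≤ (1 + ‖ζ - z‖ / ρ') / ρ' / ‖w - z‖ := by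
      rw [div_div, div_le_div_iff₀ (by positivity) (by positivity)]
      linarith
    calc (‖w - z‖ ^ 2)⁻¹ * (n / ‖w - ζ‖ ^ 2) = n * (‖w - z‖ ^ 2)⁻¹ * (1 / ‖w - ζ‖ ^ 2) := by ring
      _ ≤ n * (‖w - z‖ ^ 2)⁻¹ * ((1 + ‖ζ - z‖ / ρ') / ρ' / ‖w - z‖) := by gcongr
      _ = _ := by
        generalize (1 + ‖ζ - z‖ / ρ') = q
        field_simp
  have i2 : IntegrableOn (fun w : ℂ => (((16 * n / ρ' ^ 2) * (‖w - z‖ ^ 3)⁻¹ : ℝ) : ℂ)) E := by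
    refine (H _ (by fun_prop) E hE z ρ (16 * n / ρ' ^ 2) hρ (by positivity) hsub (fun w hw => ?_)).1
    rw [Complex.norm_real, Real.norm_eq_abs, abs_of_nonneg (by positivity), p3 _ (norm_nonneg _)]
  have i3 : IntegrableOn (fun w : ℂ => (16 * n / ρ' ^ 2) * (‖w - z‖ ^ 3)⁻¹) E := by
    exact i2.re
  have half : ∀ w ∈ E, ∀ x ∈ ball z (ρ / 2), ‖w - z‖ / 2 ≤ ‖w - x‖ := fun w hw x hx => by
    rw [mem_ball, dist_eq_norm] at hx
    have := h w hw
    have := norm_sub_le_norm_sub_add_norm_sub w x z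
    linarith
  have := (hasDerivAt_integral_of_dominated_loc_of_deriv_le (μ := volume.restrict E) (𝕜 := ℂ)
    (F := fun x w => ((w - x) ^ 2)⁻¹ * f0 n (w - ζ)) (x₀ := z)
    (F' := fun x w => 2 * ((w - x) ^ 3)⁻¹ * f0 n (w - ζ))
    (bound := fun w => (16 * n / ρ' ^ 2) * (‖w - z‖ ^ 3)⁻¹)
    (ball_mem_nhds z (half_pos hρ))
    (Eventually.of_forall fun x => (m2 x).aestronglyMeasurable) i1 m3.aestronglyMeasurable
    ((ae_restrict_iff' hE).2 (Eventually.of_forall fun w hw x hx => ?_)) i3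
    ((ae_restrict_iff' hE).2 (Eventually.of_forall fun w hw x hx => ?_))).2
  · rw [← integral_const_mul]
    simpa only [mul_assoc] using this
  · have a1 := h w hw
    have a2 := h' w hw
    have a3 := half w hw x hx
    have b1 : 0 < ‖w - z‖ := by linarith
    rw [norm_mul, norm_mul, norm_inv, norm_pow, f0_norm n hn, Complex.norm_ofNat]
    calc 2 * (‖w - x‖ ^ 3)⁻¹ * (n / ‖w - ζ‖ ^ 2) ≤ 2 * ((‖w - z‖ / 2) ^ 3)⁻¹ * (n / ρ' ^ 2) := by gcongr
      _ = _ := by field_simp; ring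
  · have a1 := h w hw
    have a3 := half w hw x hx
    have hne : w - x ≠ 0 := norm_pos_iff.1 (by linarith)
    have h1 : HasDerivAt (fun x => w - x) (-1) x := (hasDerivAt_id x).const_sub w
    have h2 := ((h1.pow 2).inv (pow_ne_zero 2 hne)).mul_const (f0 n (w - ζ))
    refine h2.congr_deriv ?_
    congr 1
    field_simp
    simp
    ring

lemma pow_const (ε K x : ℝ) (hε1 : ε < 1) (hK : 1 ≤ K) (hx : 0 ≤ x) : (K * x) ^ ε ≤ K * x ^ ε := by
  rw [Real.mul_rpow (by linarith) hx]
  gcongr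
  calc K ^ ε ≤ K ^ (1:ℝ) := Real.rpow_le_rpow_of_exponent_le hK hε1.le
    _ = K := Real.rpow_one K

def InW (Ω : Set ℂ) (ε M r κ : ℝ) : Prop := ∀ z u ρ, Flat Ωᶜ ε M r z u ρ → ∀ s : ℝ, 0 ≤ s → ρ + s ≤ κ →
      z - s * (I * u) ∈ Ω ∧ (ρ + s) / 2 ≤ infDist (z - s * (I * u)) Ωᶜ

lemma KD.near {Ω : Set ℂ} {ε A : ℝ} {ζ : ℂ} {k k' : ℂ → ℂ} (h : KD Ω ε A ζ k k') (hε0 : 0 < ε) (hε1 : ε < 1)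
    (hA : 0 ≤ A) (M r κ : ℝ) (hM : 0 ≤ M) (hr : 0 < r) (hκr : κ ≤ r / 20)
    (hκ : ∀ d, 0 < d → d ≤ κ → 40 * (M * (10 * d) ^ (1 + ε)) ≤ d) (hin : InW Ω ε M r κ)
    (z₁ z₂ u₁ u₂ : ℂ) (F₁ : Flat Ωᶜ ε M r z₁ u₁ (infDist z₁ Ωᶜ)) (F₂ : Flat Ωᶜ ε M r z₂ u₂ (infDist z₂ Ωᶜ))
    (δ d : ℝ) (hδ : 0 < δ) (hδe : ‖z₂ - z₁‖ = δ) (hde : ‖ζ - z₁‖ = d) (h1 : 128 * δ ≤ d) (h2 : 19 * δ ≤ κ) :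
    ‖k z₁ - k z₂‖ ≤ 1300 * A / ε * (δ ^ ε / d ^ 2) := by
  have hd : 0 < d := by linarith
  have hε1' : 1 ≤ 1 / ε := by rw [le_div_iff₀ hε0]; linarith
  have hq : 0 ≤ δ ^ ε / d ^ 2 := by positivity
  have hAq : 0 ≤ A * (δ ^ ε / d ^ 2) := by positivity
  have pw : ∀ K : ℝ, 0 < K → (K * δ) ^ (ε - 1) * (K * δ) = (K * δ) ^ ε := fun K hK => by
    rw [Real.rpow_sub_one (by positivity)]; field_simp
  by_cases hρ : 2 * δ ≤ infDist z₁ Ωᶜ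
  · have := h.seg hε1 hA d δ δ z₁ z₂ hd hδ (by linarith) hδe.le (by linarith) (by linarith)
    rw [norm_sub_rev]
    refine this.trans ?_
    have p1 := pw 1 one_pos
    simp only [one_mul] at p1
    calc 16 * A * δ ^ (ε - 1) / d ^ 2 * δ = 16 * (A * ((δ ^ (ε - 1) * δ) / d ^ 2)) := by ring
      _ = 16 * (A * (δ ^ ε / d ^ 2)) := by rw [p1]
      _ ≤ 1300 * (1 / ε) * (A * (δ ^ ε / d ^ 2)) := by gcongr; linarith
      _ = _ := by ring
  push Not at hρ
  have hρ₂ : infDist z₂ Ωᶜ < 3 * δ := by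
    have := infDist_le_infDist_add_dist (s := Ωᶜ) (x := z₂) (y := z₁)
    rw [dist_eq_norm, hδe] at this
    linarith
  have cs := consist (rig z₁ u₁ ⁻¹' Ωᶜ) ε M r δ _ (infDist z₁ Ωᶜ) (infDist z₂ Ωᶜ) ((starRingEnd ℂ) u₁ * (z₂ - z₁))
    ((starRingEnd ℂ) u₁ * u₂) hε0 hM (by
      have := F₁.rig z₁ u₁ F₁.hu
      rwa [sub_self, mul_zero, conj_mul_self' u₁ F₁.hu] at this) (F₂.rig z₁ u₁ F₁.hu) hδ
    (by rw [norm_mul, RCLike.norm_conj, F₁.hu, one_mul, hδe]) hρ hρ₂ (by linarith) rfl (hκ δ hδ (by linarith))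
  have hu : ‖u₂ - u₁‖ ≤ 6 / 40 := by
    have c1 := cs.1
    have e : u₂ - u₁ = u₁ * ((starRingEnd ℂ) u₁ * u₂ - 1) := by
      linear_combination -u₂ * (conj_mul_self' u₁ F₁.hu)
    rw [e, norm_mul, F₁.hu, one_mul]
    refine c1.trans ?_
    rw [div_le_div_iff₀ hδ (by norm_num)]
    linarith [hκ δ hδ (by linarith)]
  have key : ∀ z u, Flat Ωᶜ ε M r z u (infDist z Ωᶜ) → infDist z Ωᶜ < 3 * δ → d - δ ≤ ‖ζ - z‖ →
      ‖k (z - (16 * δ : ℝ) * (I * u)) - k z‖ ≤ 608 * A / ε * (δ ^ ε / d ^ 2) := by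
    intro z u F hz hfar
    refine (h.path hε0 hε1 hA d (infDist z Ωᶜ) (16 * δ) z u F.hu hd F.pos (by positivity) (by linarith)
      (fun s h0 hs => hin z u _ F s h0 (by linarith)) (by linarith)).trans ?_
    have : (infDist z Ωᶜ + 16 * δ) ^ ε ≤ 19 * δ ^ ε := by
      refine le_trans ?_ (pow_const ε 19 δ hε1 (by norm_num) hδ.le)
      have := F.pos
      gcongr; linarith
    calc _ ≤ 32 * A / ε * ((19 * δ ^ ε) / d ^ 2) := by gcongr
      _ = _ := by ring
  have k1 := key z₁ u₁ F₁ (by linarith) (by linarith)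
  have k2 := key z₂ u₂ F₂ hρ₂ (by
    have := norm_sub_le_norm_sub_add_norm_sub ζ z₂ z₁
    linarith)
  have i1 := (hin z₁ u₁ _ F₁ (16 * δ) (by positivity) (by linarith)).2
  have hp := F₁.pos
  set y₁ := z₁ - (16 * δ : ℝ) * (I * u₁) with hy₁
  set y₂ := z₂ - (16 * δ : ℝ) * (I * u₂) with hy₂
  have nn : ∀ v : ℂ, ‖((16 * δ : ℝ) : ℂ) * (I * v)‖ = 16 * δ * ‖v‖ := fun v => by
    rw [norm_mul, norm_mul, Complex.norm_I, Complex.norm_real, Real.norm_eq_abs, abs_of_nonneg (by positivity)]; ring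
  have hyy : ‖y₂ - y₁‖ ≤ 4 * δ := by
    have e : y₂ - y₁ = (z₂ - z₁) - (16 * δ : ℝ) * (I * (u₂ - u₁)) := by rw [hy₁, hy₂]; ring
    rw [e]
    refine (norm_sub_le _ _).trans ?_
    rw [nn, hδe]
    nlinarith
  have k3 := h.seg hε1 hA d (4 * δ) (4 * δ) y₁ y₂ hd (by positivity) (by linarith) hyy (by linarith) (by
    have e : ζ - y₁ = (ζ - z₁) + (16 * δ : ℝ) * (I * u₁) := by rw [hy₁]; ring
    have := norm_sub_le (ζ - y₁) ((16 * δ : ℝ) * (I * u₁))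
    rw [e, add_sub_cancel_right, nn, F₁.hu, hde, ← e] at this
    linarith)
  have k3' : ‖k y₂ - k y₁‖ ≤ 64 * A * (δ ^ ε / d ^ 2) := by
    refine k3.trans ?_
    calc 16 * A * (4 * δ) ^ (ε - 1) / d ^ 2 * (4 * δ) = 16 * A * ((4 * δ) ^ (ε - 1) * (4 * δ)) / d ^ 2 := by ring
      _ = 16 * A * (4 * δ) ^ ε / d ^ 2 := by rw [pw 4 (by norm_num)]
      _ ≤ 16 * A * (4 * δ ^ ε) / d ^ 2 := by
        have := pow_const ε 4 δ hε1 (by norm_num) hδ.le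
        gcongr
      _ = _ := by ring
  have e : k z₁ - k z₂ = (k y₂ - k z₂) - (k y₁ - k z₁) - (k y₂ - k y₁) := by ring
  rw [e]
  refine (norm_sub_le _ _).trans ((add_le_add_left (norm_sub_le _ _) _).trans ?_)
  have f : 64 * A * (δ ^ ε / d ^ 2) ≤ 64 * A / ε * (δ ^ ε / d ^ 2) := by
    calc 64 * A * (δ ^ ε / d ^ 2) = 64 * (A * (δ ^ ε / d ^ 2)) * 1 := by ring
      _ ≤ 64 * (A * (δ ^ ε / d ^ 2)) * (1 / ε) := by gcongr
      _ = _ := by ring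
  have g : 608 * A / ε * (δ ^ ε / d ^ 2) + 608 * A / ε * (δ ^ ε / d ^ 2) + 64 * A / ε * (δ ^ ε / d ^ 2) ≤
      1300 * A / ε * (δ ^ ε / d ^ 2) := by
    have : 0 ≤ A / ε * (δ ^ ε / d ^ 2) := by positivity
    calc _ = 1280 * (A / ε * (δ ^ ε / d ^ 2)) := by ring
      _ ≤ 1300 * (A / ε * (δ ^ ε / d ^ 2)) := by gcongr; norm_num
      _ = _ := by ring
  linarith

lemma KD.far {Ω : Set ℂ} {ε A : ℝ} {ζ : ℂ} {k k' : ℂ → ℂ} (h : KD Ω ε A ζ k k') (hε0 : 0 < ε) (hε1 : ε < 1)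
    (hA : 0 ≤ A) (M r κ θ A₂ : ℝ) (hA₂ : 0 ≤ A₂) (hin : InW Ω ε M r κ)
    (hθ : 0 < θ) (hθ8 : θ ≤ 1 / 8)
    (hb : ∀ y ∈ Ω, y ≠ ζ → θ / 4 * ‖ζ - y‖ ≤ infDist y Ωᶜ → ‖k y‖ ≤ A₂ * (‖ζ - y‖ ^ ε / ‖ζ - y‖ ^ 2))
    (z u : ℂ) (hz : z ∈ Ω) (F : Flat Ωᶜ ε M r z u (infDist z Ωᶜ))
    (d : ℝ) (hd : 0 < d) (h1 : d / 2 ≤ ‖ζ - z‖) (h2 : ‖ζ - z‖ ≤ 3 / 2 * d) (h3 : 2 * θ * d ≤ κ) :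
    ‖k z‖ ≤ (32 * A₂ + 32 * A / ε) * (d ^ ε / d ^ 2) := by
  have hq : 0 ≤ d ^ ε / d ^ 2 := by positivity
  have pt : ∀ y ∈ Ω, d / 4 ≤ ‖ζ - y‖ → ‖ζ - y‖ ≤ 2 * d → θ / 4 * ‖ζ - y‖ ≤ infDist y Ωᶜ →
      ‖k y‖ ≤ 32 * A₂ * (d ^ ε / d ^ 2) := by
    intro y hy g1 g2 g3
    have hne : y ≠ ζ := by
      rintro rfl
      rw [sub_self, norm_zero] at g1; linarith
    refine (hb y hy hne g3).trans ?_
    calc A₂ * (‖ζ - y‖ ^ ε / ‖ζ - y‖ ^ 2) ≤ A₂ * ((2 * d) ^ ε / (d / 4) ^ 2) := by gcongr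
      _ ≤ A₂ * ((2 * d ^ ε) / (d / 4) ^ 2) := by
        have := pow_const ε 2 d hε1 (by norm_num) hd.le
        gcongr
      _ = _ := by field_simp; ring
  have hθd : 0 < θ * d := by positivity
  have hθd8 : θ * d ≤ d / 8 := by nlinarith
  by_cases hρ : θ * d ≤ infDist z Ωᶜ
  · refine (pt z hz (by linarith) (by linarith) (by nlinarith)).trans ?_
    gcongr
    have : 0 ≤ 32 * A / ε := by positivity
    linarith
  push Not at hρ
  have hp := F.pos
  have P := h.path hε0 hε1 hA d (infDist z Ωᶜ) (θ * d) z u F.hu hd F.pos hθd.le (by linarith)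
      (fun s h0 hs => hin z u _ F s h0 (by linarith)) (by linarith)
  obtain ⟨i0, i1⟩ := hin z u _ F (θ * d) hθd.le (by linarith)
  set y := z - ((θ * d : ℝ) : ℂ) * (I * u) with hy
  have hyz : ‖y - z‖ = θ * d := by
    rw [hy, sub_sub_cancel_left, norm_neg, norm_mul, norm_mul, Complex.norm_I, F.hu, Complex.norm_real, Real.norm_eq_abs,
      abs_of_pos hθd]; ring
  have t1 := norm_sub_le_norm_sub_add_norm_sub ζ y z
  have t2 := norm_sub_le_norm_sub_add_norm_sub ζ z y
  rw [norm_sub_rev z y] at t2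
  have K := pt y i0 (by linarith) (by linarith) (by
    have : θ / 4 * ‖ζ - y‖ ≤ θ / 4 * (2 * d) := by gcongr; linarith
    linarith)
  have e : k z = k y - (k y - k z) := by ring
  rw [e]
  refine (norm_sub_le _ _).trans ?_
  have : (infDist z Ωᶜ + θ * d) ^ ε ≤ d ^ ε := by gcongr; linarith
  have P' : 32 * A / ε * ((infDist z Ωᶜ + θ * d) ^ ε / d ^ 2) ≤ 32 * A / ε * (d ^ ε / d ^ 2) := by gcongr
  linarith

lemma final_bd (ε : ℝ) (hε0 : 0 < ε) (hε1 : ε < 1) (n : ℕ) (hn : 1 ≤ n)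
    (Ω : Set ℂ) (hΩo : IsOpen Ω) (hΩb : Bornology.IsBounded Ω) (hΩ : HB ε Ω) :
    ∃ C : ℝ, 0 < C ∧
      ∀ z₁ ∈ Ω, ∀ z₂ ∈ Ω, ∀ ζ ∈ Ω, 2 * ‖z₁ - z₂‖ ≤ ‖ζ - z₁‖ →
        ‖(∫ w in Ωᶜ, ((w - z₁) ^ 2)⁻¹ * f0 n (w - ζ)) - ∫ w in Ωᶜ, ((w - z₂) ^ 2)⁻¹ * f0 n (w - ζ)‖
          ≤ C * ‖z₁ - z₂‖ ^ ε / ‖ζ - z₁‖ ^ 2 := by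
  obtain ⟨r, hr, M, hM, hflat⟩ := flatness ε hε0 Ω hΩo hΩb hΩ
  have hne : (Ωᶜ).Nonempty := by
    rw [nonempty_compl]
    rintro rfl
    exact NormedSpace.unbounded_univ ℝ ℂ hΩb
  have hE : MeasurableSet Ωᶜ := hΩo.measurableSet.compl
  obtain ⟨D₀, hD₀⟩ := Metric.isBounded_iff.1 hΩb
  obtain ⟨D, hD, hDD⟩ : ∃ D : ℝ, 0 < D ∧ ∀ x ∈ Ω, ∀ y ∈ Ω, ‖x - y‖ ≤ D :=
    ⟨max D₀ 1, by positivity, fun x hx y hy => by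
      rw [← dist_eq_norm]; exact (hD₀ hx hy).trans (le_max_left _ _)⟩
  obtain ⟨κ, hκ, hκr, hκd, hin⟩ := inward ε M r hε0 hM hr
  have hin' : InW Ω ε M r κ := hin Ω hne
  set θ := min (1 / 8) (κ / (2 * D)) with hθ
  have hθ0 : 0 < θ := by positivity
  have hθ8 : θ ≤ 1 / 8 := min_le_left _ _
  have hθκ : 2 * θ * D ≤ κ := by
    have := min_le_right (1 / 8) (κ / (2 * D))
    rw [← hθ, le_div_iff₀ (by positivity)] at this
    linarith
  set η := min (1 / 128) (κ / (19 * D)) with hη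
  have hη0 : 0 < η := by positivity
  have hη1 : η ≤ 1 / 128 := min_le_left _ _
  have hηκ : 19 * (η * D) ≤ κ := by
    have := min_le_right (1 / 128) (κ / (19 * D))
    rw [← hη, le_div_iff₀ (by positivity)] at this
    linarith
  obtain ⟨A₀, hA₀, H3⟩ := app3 n hn ε M r D hε0 hε1 hM hr hD
  obtain ⟨A₂, hA₂, H2⟩ := app2 n hn ε M r D (θ / 4) hε0 hε1 hM hr hD (by positivity) (by linarith)
  have two : ∀ z ∈ Ω, ∀ ζ ∈ Ω, z ≠ ζ → ∃ u u', Two Ωᶜ ε M r D z ζ u u' (infDist z Ωᶜ) (infDist ζ Ωᶜ) := by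
    intro z hz ζ hζ hzζ
    obtain ⟨u, hu⟩ := hflat z hz
    obtain ⟨u', hu'⟩ := hflat ζ hζ
    refine ⟨u, u', hE, hu, hu', hzζ.symm, hDD _ hζ _ hz, ?_⟩
    rw [abs_sub_comm, ← dist_eq_norm, ← Real.dist_eq]
    simpa using (lipschitz_infDist_pt Ωᶜ).dist_le_mul ζ z
  set A := 2 * A₀ with hA
  have hA0 : 0 ≤ A := by positivity
  set B := 32 * A₂ + 32 * A / ε with hB
  have hB0 : 0 < B := by positivity
  refine ⟨1300 * A / ε + 2 * B * (1 / η) ^ ε, by positivity, fun z₁ hz₁ z₂ hz₂ ζ hζ hsep => ?_⟩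
  set k : ℂ → ℂ := fun z => ∫ w in Ωᶜ, ((w - z) ^ 2)⁻¹ * f0 n (w - ζ) with hk
  show ‖k z₁ - k z₂‖ ≤ _
  rcases eq_or_ne z₁ z₂ with rfl | hz12
  · rw [sub_self, norm_zero]; positivity
  have kd : KD Ω ε A ζ k (fun z => 2 * ∫ w in Ωᶜ, ((w - z) ^ 3)⁻¹ * f0 n (w - ζ)) := by
    constructor
    · intro z hz
      obtain ⟨u, hu⟩ := hflat z hz
      obtain ⟨u', hu'⟩ := hflat ζ hζ
      exact k_der n hn Ωᶜ hE z ζ _ _ hu.pos hu'.pos hu.emp hu'.emp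
    · intro z hz hzζ
      obtain ⟨u, u', h2⟩ := two z hz ζ hζ hzζ
      have := H3 _ _ _ _ _ _ _ h2
      rw [norm_mul, Complex.norm_ofNat, hA, mul_assoc]
      gcongr
  obtain ⟨u₁, F₁⟩ := hflat z₁ hz₁
  obtain ⟨u₂, F₂⟩ := hflat z₂ hz₂
  set δ := ‖z₁ - z₂‖ with hδ
  have hδ0 : 0 < δ := norm_pos_iff.2 (sub_ne_zero.2 hz12)
  set d := ‖ζ - z₁‖ with hd
  have hd0 : 0 < d := by linarith
  have hdD : d ≤ D := hDD _ hζ _ hz₁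
  have hq : 0 ≤ δ ^ ε / d ^ 2 := by positivity
  rw [mul_div_assoc, add_mul]
  by_cases hc : δ ≤ η * d
  · have := kd.near hε0 hε1 hA0 M r κ hM hr hκr hκd hin' z₁ z₂ u₁ u₂ F₁ F₂ δ d hδ0 (norm_sub_rev _ _) rfl
      (by nlinarith) (by
        have : η * d ≤ η * D := by gcongr
        linarith)
    have : 0 ≤ 2 * B * (1 / η) ^ ε * (δ ^ ε / d ^ 2) := by positivity
    linarith
  · push Not at hc
    have fb : ∀ z ∈ Ω, d / 2 ≤ ‖ζ - z‖ → ‖ζ - z‖ ≤ 3 / 2 * d → ‖k z‖ ≤ B * (d ^ ε / d ^ 2) := by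
      intro z hz g1 g2
      obtain ⟨u, F⟩ := hflat z hz
      refine kd.far hε0 hε1 hA0 M r κ θ A₂ hA₂.le hin' hθ0 hθ8 (fun y hy hyζ hyc => ?_) z u hz F d hd0 g1 g2 ?_
      · obtain ⟨u, u', h2⟩ := two y hy ζ hζ hyζ
        exact H2 _ _ _ _ _ _ _ h2 hyc
      · have : 2 * θ * d ≤ 2 * θ * D := by gcongr
        linarith
    have t1 := norm_sub_le_norm_sub_add_norm_sub ζ z₂ z₁
    have t2 := norm_sub_le_norm_sub_add_norm_sub ζ z₁ z₂
    rw [norm_sub_rev z₂ z₁] at t1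
    have f1 := fb z₁ hz₁ (by linarith) (by linarith)
    have f2 := fb z₂ hz₂ (by linarith) (by linarith)
    have f3 : d ^ ε ≤ (1 / η) ^ ε * δ ^ ε := by
      rw [← Real.mul_rpow (by positivity) hδ0.le]
      gcongr
      rw [div_mul_eq_mul_div, one_mul, le_div_iff₀ hη0]
      linarith
    have f4 : B * (d ^ ε / d ^ 2) ≤ B * (((1 / η) ^ ε * δ ^ ε) / d ^ 2) := by gcongr
    have f5 : 0 ≤ 1300 * A / ε * (δ ^ ε / d ^ 2) := by positivity
    have f6 : 2 * B * (1 / η) ^ ε * (δ ^ ε / d ^ 2) = 2 * (B * (((1 / η) ^ ε * δ ^ ε) / d ^ 2)) := by ring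
    rw [f6]
    refine (norm_sub_le _ _).trans ?_
    linarith
/-- For a bounded `C^{1+ε}` domain `Ω ⊆ ℂ` and `n ≥ 1`, the kernel `K_n`
satisfies `|K_n(z₁,ζ) − K_n(z₂,ζ)| ≤ C |z₁−z₂|^ε / |ζ−z₁|²` whenever `|ζ−z₁| ≥ 2|z₁−z₂|`,
for `z₁, z₂, ζ ∈ Ω`, with `C = C(n,ε,Ω)`. -/
theorem statement10 (ε : ℝ) (hε0 : 0 < ε) (hε1 : ε < 1) (n : ℕ) (hn : 1 ≤ n)
    (Ω : Set ℂ) (hΩo : IsOpen Ω) (hΩc : IsConnected Ω)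
    (hΩb : Bornology.IsBounded Ω) (hΩ : HasC1HolderBoundaryC ε Ω) :
    ∃ C : ℝ, 0 < C ∧
      ∀ z₁ ∈ Ω, ∀ z₂ ∈ Ω, ∀ ζ ∈ Ω, 2 * ‖z₁ - z₂‖ ≤ ‖ζ - z₁‖ →
        ‖Kker Ω n z₁ ζ - Kker Ω n z₂ ζ‖ ≤ C * ‖z₁ - z₂‖ ^ ε / ‖ζ - z₁‖ ^ 2 := by
  obtain ⟨C, hC, h⟩ := final_bd ε hε0 hε1 n hn Ω hΩo hΩb hΩ
  have e : ∀ z ζ, Kker Ω n z ζ = ∫ w in Ωᶜ, ((w - z) ^ 2)⁻¹ * f0 n (w - ζ) := fun z ζ => by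
    simp only [Kker, f0]
    congr 1
    funext w
    rw [← neg_sub w z, neg_sq]
  refine ⟨C, hC, fun z₁ h1 z₂ h2 ζ h3 h4 => ?_⟩
  rw [e, e]
  exact h z₁ h1 z₂ h2 ζ h3 h4

end
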